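/- Let m = ⌈(1/2 + 1/70) n log n⌉. With high probability, the graph G_m of the König process contains at least one isolated vertex (a vertex of degree 0); in particular G_m has no perfect matching. -/

import Mathlib

open scoped Classical

noncomputable section

/-- `M` is a matching in the graph `G`: a set of edges of `G` that are pairwise disjoint. -/
def IsMatchingOn {n : ℕ} (G : SimpleGraph (Fin n)) (M : Finset (Sym2 (Fin n))) : Prop :=
  (∀ e ∈ M, e ∈ G.edgeSet) ∧
  ∀ e ∈ M, ∀ f ∈ M, e ≠ f → ∀ v : Fin n, v ∈ e → v ∉ f

/-- ν(G): the maximum size of a matching of `G`. -/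
def matchNum {n : ℕ} (G : SimpleGraph (Fin n)) : ℕ :=
  sSup {k | ∃ M : Finset (Sym2 (Fin n)), IsMatchingOn G M ∧ M.card = k}

/-- `C` is a vertex cover of `G`. -/
def IsVertexCover {n : ℕ} (G : SimpleGraph (Fin n)) (C : Finset (Fin n)) : Prop :=
  ∀ e ∈ G.edgeSet, ∃ v ∈ C, v ∈ e

/-- τ(G): the minimum size of a vertex cover of `G`. -/
def coverNum {n : ℕ} (G : SimpleGraph (Fin n)) : ℕ :=
  sInf {k | ∃ C : Finset (Fin n), IsVertexCover G C ∧ C.card = k}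

/-- `G` is a König graph: ν(G) = τ(G). -/
def IsKonig {n : ℕ} (G : SimpleGraph (Fin n)) : Prop := matchNum G = coverNum G

/-- An ordering `e_1, …, e_N` (0-indexed: `σ 0, …, σ (N-1)`) of the `N = n(n-1)/2` edges of
the complete graph on `Fin n`: an injective function from `Fin N` to non-diagonal elements
of `Sym2 (Fin n)`, hence a bijection onto the edge set of `K_n`. -/
def EdgeOrdering (n : ℕ) : Type :=
  {σ : Fin (n*(n-1)/2) → Sym2 (Fin n) // Function.Injective σ ∧ ∀ i, ¬ (σ i).IsDiag}

/-- The König process: `KonigProc σ m` is the graph `G_m`, where `G_0 = ⊥` and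
`G_{m+1} = G_m + e_{m+1}` if that graph is König, `G_{m+1} = G_m` otherwise. -/
def KonigProc {n : ℕ} (σ : EdgeOrdering n) : ℕ → SimpleGraph (Fin n)
  | 0 => ⊥
  | m+1 =>
    if h : m < n*(n-1)/2 then
      (if IsKonig (KonigProc σ m ⊔ SimpleGraph.fromEdgeSet {σ.1 ⟨m, h⟩})
        then KonigProc σ m ⊔ SimpleGraph.fromEdgeSet {σ.1 ⟨m, h⟩}
        else KonigProc σ m)
    else KonigProc σ m

/-- The probability of an event `A` under the uniformly random edge ordering. -/
def Pr (n : ℕ) (A : EdgeOrdering n → Prop) : ℝ :=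
  (Nat.card {σ : EdgeOrdering n // A σ} : ℝ) / (Nat.card (EdgeOrdering n) : ℝ)

/-! ### Matchings and covers -/

section Structure

variable {n : ℕ}

/-- The matching `M` leaves the vertex `v` uncovered. -/
def Misses (M : Finset (Sym2 (Fin n))) (v : Fin n) : Prop := ∀ e ∈ M, v ∉ e

/-- `M` is a maximum matching of `G`. -/
def IsMaxMatching (G : SimpleGraph (Fin n)) (M : Finset (Sym2 (Fin n))) : Prop :=
  IsMatchingOn G M ∧ M.card = matchNum G

/-- `C` is a minimum vertex cover of `G`. -/
def IsMinCover (G : SimpleGraph (Fin n)) (C : Finset (Fin n)) : Prop :=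
  IsVertexCover G C ∧ C.card = coverNum G

/-- Some maximum matching of `G` misses both `a` and `b`. -/
def CoMissed (G : SimpleGraph (Fin n)) (a b : Fin n) : Prop :=
  ∃ M, IsMaxMatching G M ∧ Misses M a ∧ Misses M b

/-- The vertices missed by some maximum matching. -/
def missable (G : SimpleGraph (Fin n)) : Finset (Fin n) :=
  Finset.univ.filter fun v => ∃ M, IsMaxMatching G M ∧ Misses M v

/-- The vertices contained in no minimum vertex cover. -/
def uncovered (G : SimpleGraph (Fin n)) : Finset (Fin n) :=
  Finset.univ.filter fun v => ∀ C, IsMinCover G C → v ∉ C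

/-- The vertices contained in no minimum cover and missed by no maximum matching. -/
def rigid (G : SimpleGraph (Fin n)) : Finset (Fin n) := uncovered G \ missable G

/-- The isolated vertices. -/
def isolated (G : SimpleGraph (Fin n)) : Finset (Fin n) :=
  Finset.univ.filter fun v => ∀ w, ¬ G.Adj v w

/-- Ordered pairs of distinct vertices missed by a common maximum matching. -/
def coPairs (G : SimpleGraph (Fin n)) : Finset (Fin n × Fin n) :=
  Finset.univ.filter fun p => p.1 ≠ p.2 ∧ CoMissed G p.1 p.2

theorem IsMatchingOn.card_le_card_cover {G : SimpleGraph (Fin n)} {M : Finset (Sym2 (Fin n))}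
    {C : Finset (Fin n)} (hM : IsMatchingOn G M) (hC : IsVertexCover G C) :
    M.card ≤ C.card := by
  have h : ∀ e ∈ M, ∃ v ∈ C, v ∈ e := fun e he => hC e (hM.1 e he)
  refine Finset.card_le_card_of_forall_subsingleton (fun e v => v ∈ e) h ?_
  intro v _ e he e' he'
  by_contra hne
  exact hM.2 e he.1 e' he'.1 hne v he.2 he'.2

theorem isVertexCover_univ (G : SimpleGraph (Fin n)) : IsVertexCover G Finset.univ := by
  intro e he
  induction e with
  | _ a b => exact ⟨a, Finset.mem_univ _, by simp⟩

theorem matchNum_bddAbove (G : SimpleGraph (Fin n)) :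
    BddAbove {k | ∃ M : Finset (Sym2 (Fin n)), IsMatchingOn G M ∧ M.card = k} := by
  refine ⟨(Finset.univ : Finset (Fin n)).card, ?_⟩
  rintro k ⟨M, hM, rfl⟩
  exact hM.card_le_card_cover (isVertexCover_univ G)

theorem IsMatchingOn.card_le {G : SimpleGraph (Fin n)} {M : Finset (Sym2 (Fin n))}
    (hM : IsMatchingOn G M) : M.card ≤ matchNum G :=
  le_csSup (matchNum_bddAbove G) ⟨M, hM, rfl⟩

theorem exists_isMaxMatching (G : SimpleGraph (Fin n)) : ∃ M, IsMaxMatching G M :=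
  Nat.sSup_mem (s := {k | ∃ M : Finset (Sym2 (Fin n)), IsMatchingOn G M ∧ M.card = k})
    ⟨0, ∅, by simp [IsMatchingOn], rfl⟩ (matchNum_bddAbove G)

theorem IsVertexCover.coverNum_le {G : SimpleGraph (Fin n)} {C : Finset (Fin n)}
    (hC : IsVertexCover G C) : coverNum G ≤ C.card :=
  Nat.sInf_le ⟨C, hC, rfl⟩

theorem exists_isMinCover (G : SimpleGraph (Fin n)) : ∃ C, IsMinCover G C :=
  Nat.sInf_mem (s := {k | ∃ C : Finset (Fin n), IsVertexCover G C ∧ C.card = k})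
    ⟨_, Finset.univ, isVertexCover_univ G, rfl⟩

theorem matchNum_le_coverNum (G : SimpleGraph (Fin n)) : matchNum G ≤ coverNum G := by
  obtain ⟨M, hM⟩ := exists_isMaxMatching G
  obtain ⟨C, hC⟩ := exists_isMinCover G
  rw [← hM.2, ← hC.2]
  exact hM.1.card_le_card_cover hC.1

theorem matchNum_mono {G H : SimpleGraph (Fin n)} (h : G ≤ H) : matchNum G ≤ matchNum H := by
  obtain ⟨M, hM⟩ := exists_isMaxMatching G
  rw [← hM.2]
  exact IsMatchingOn.card_le ⟨fun e he => SimpleGraph.edgeSet_mono h (hM.1.1 e he), hM.1.2⟩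

theorem isVertexCover_iff {G : SimpleGraph (Fin n)} {C : Finset (Fin n)} :
    IsVertexCover G C ↔ ∀ a b, G.Adj a b → a ∈ C ∨ b ∈ C := by
  constructor
  · intro h a b hab
    obtain ⟨v, hv, hve⟩ := h s(a, b) hab
    rcases Sym2.mem_iff.1 hve with rfl | rfl
    · exact Or.inl hv
    · exact Or.inr hv
  · intro h e he
    induction e with
    | _ a b =>
      rcases h a b he with h | h
      · exact ⟨a, h, by simp⟩
      · exact ⟨b, h, by simp⟩

theorem isKonig_bot : IsKonig (⊥ : SimpleGraph (Fin n)) := by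
  refine le_antisymm (matchNum_le_coverNum _) ?_
  have : IsVertexCover (⊥ : SimpleGraph (Fin n)) ∅ := isVertexCover_iff.2 (by simp)
  exact this.coverNum_le.trans (by simp)

/-- The vertices covered by a matching. -/
def matchedVerts (M : Finset (Sym2 (Fin n))) : Finset (Fin n) :=
  Finset.univ.filter fun v => ∃ e ∈ M, v ∈ e

theorem card_matchedVerts {G : SimpleGraph (Fin n)} {M : Finset (Sym2 (Fin n))}
    (hM : IsMatchingOn G M) : (matchedVerts M).card = 2 * M.card := by
  have h : matchedVerts M = M.biUnion Sym2.toFinset := by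
    ext v; simp [matchedVerts]
  rw [h, Finset.card_biUnion]
  · rw [Finset.sum_congr rfl (g := fun _ => 2), Finset.sum_const, smul_eq_mul, mul_comm]
    intro e he
    exact Sym2.card_toFinset_of_not_isDiag e
      (fun hd => (SimpleGraph.not_isDiag_of_mem_edgeSet G (hM.1 e he)) hd)
  · intro e he f hf hne
    rw [Function.onFun, Finset.disjoint_left]
    intro v hv hvf
    exact hM.2 e he f hf hne v (Sym2.mem_toFinset.1 hv) (Sym2.mem_toFinset.1 hvf)

/-- The vertices missed by a matching. -/
def missedVerts (M : Finset (Sym2 (Fin n))) : Finset (Fin n) :=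
  Finset.univ.filter fun v => Misses M v

theorem card_missedVerts {G : SimpleGraph (Fin n)} {M : Finset (Sym2 (Fin n))}
    (hM : IsMatchingOn G M) : (missedVerts M).card + 2 * M.card = n := by
  rw [← card_matchedVerts hM]
  have h : missedVerts M = Finset.univ \ matchedVerts M := by
    ext v
    simp only [missedVerts, matchedVerts, Finset.mem_filter, Finset.mem_sdiff,
      Finset.mem_univ, true_and, not_exists, not_and]
    exact Iff.rfl
  have := Finset.card_sdiff_add_card_eq_card (Finset.subset_univ (matchedVerts M))
  rw [h, this, Finset.card_univ, Fintype.card_fin]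

theorem isolated_misses {G : SimpleGraph (Fin n)} {M : Finset (Sym2 (Fin n))}
    (hM : IsMatchingOn G M) {v : Fin n} (hv : v ∈ isolated G) : Misses M v := by
  intro e he hve
  obtain ⟨w, rfl⟩ := hve
  exact (Finset.mem_filter.1 hv).2 w (hM.1 _ he)

theorem card_isolated_add_le (G : SimpleGraph (Fin n)) :
    (isolated G).card + 2 * matchNum G ≤ n := by
  obtain ⟨M, hM⟩ := exists_isMaxMatching G
  have h := card_missedVerts hM.1
  rw [hM.2] at h
  have : (isolated G).card ≤ (missedVerts M).card :=
    Finset.card_le_card fun v hv => Finset.mem_filter.2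
      ⟨Finset.mem_univ _, isolated_misses hM.1 hv⟩
  omega

theorem isolated_subset_missable (G : SimpleGraph (Fin n)) : isolated G ⊆ missable G := by
  intro v hv
  obtain ⟨M, hM⟩ := exists_isMaxMatching G
  exact Finset.mem_filter.2 ⟨Finset.mem_univ _, M, hM, isolated_misses hM.1 hv⟩

theorem card_uncovered_add_le {G : SimpleGraph (Fin n)} (hG : IsKonig G) :
    (uncovered G).card + matchNum G ≤ n := by
  obtain ⟨C, hC⟩ := exists_isMinCover G
  rw [hG, ← hC.2]
  have hd : Disjoint (uncovered G) C := by
    rw [Finset.disjoint_left]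
    intro v hv
    exact (Finset.mem_filter.1 hv).2 C hC
  rw [← Finset.card_union_of_disjoint hd]
  exact (Finset.card_le_univ _).trans (by simp)

/-- A König graph whose maximum matchings cover all non-isolated vertices has all its
non-isolated uncovered vertices rigid. -/
theorem card_uncovered_le_card_rigid_add {G : SimpleGraph (Fin n)}
    (h : n ≤ (isolated G).card + 2 * matchNum G) :
    (uncovered G).card ≤ (rigid G).card + (isolated G).card := by
  have hsub : missable G ⊆ isolated G := by
    intro v hv
    obtain ⟨M, hM, hv⟩ := (Finset.mem_filter.1 hv).2
    have hc := card_missedVerts hM.1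
    rw [hM.2] at hc
    have hs : isolated G ⊆ missedVerts M := fun v hv => Finset.mem_filter.2
      ⟨Finset.mem_univ _, isolated_misses hM.1 hv⟩
    rw [Finset.eq_of_subset_of_card_le hs (by omega)]
    exact Finset.mem_filter.2 ⟨Finset.mem_univ _, hv⟩
  have : uncovered G ⊆ rigid G ∪ isolated G := by
    intro v hv
    by_cases hm : v ∈ missable G
    · exact Finset.mem_union_right _ (hsub hm)
    · exact Finset.mem_union_left _ (Finset.mem_sdiff.2 ⟨hv, hm⟩)
  exact (Finset.card_le_card this).trans (Finset.card_union_le _ _)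

theorem mul_pred_le_card_coPairs (G : SimpleGraph (Fin n)) :
    (n - 2 * matchNum G) * (n - 2 * matchNum G - 1) ≤ (coPairs G).card := by
  obtain ⟨M, hM⟩ := exists_isMaxMatching G
  have hc := card_missedVerts hM.1
  rw [hM.2] at hc
  have h1 : n - 2 * matchNum G = (missedVerts M).card := by omega
  have h2 : (missedVerts M).offDiag ⊆ coPairs G := by
    intro p hp
    rw [Finset.mem_offDiag] at hp
    exact Finset.mem_filter.2 ⟨Finset.mem_univ _, hp.2.2, M, hM,
      (Finset.mem_filter.1 hp.1).2, (Finset.mem_filter.1 hp.2.1).2⟩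
  have h3 := Finset.card_le_card h2
  rw [Finset.offDiag_card] at h3
  rw [h1, Nat.mul_sub, mul_one]
  exact h3

/-! ### Adding an edge -/

/-- Add the edge `e` to `G` if the result is König. -/
def addIf (G : SimpleGraph (Fin n)) (e : Sym2 (Fin n)) : SimpleGraph (Fin n) :=
  if IsKonig (G ⊔ SimpleGraph.fromEdgeSet {e}) then G ⊔ SimpleGraph.fromEdgeSet {e} else G

theorem le_addIf (G : SimpleGraph (Fin n)) (e : Sym2 (Fin n)) : G ≤ addIf G e := by
  unfold addIf
  split_ifs
  · exact le_sup_left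
  · exact le_rfl

theorem IsKonig.addIf {G : SimpleGraph (Fin n)} (hG : IsKonig G) (e : Sym2 (Fin n)) :
    IsKonig (addIf G e) := by
  unfold _root_.addIf
  split_ifs with h
  · exact h
  · exact hG

theorem sup_edge_adj {G : SimpleGraph (Fin n)} {x y a b : Fin n} :
    (G ⊔ SimpleGraph.fromEdgeSet {s(x, y)}).Adj a b ↔
      G.Adj a b ∨ (s(a, b) = s(x, y) ∧ a ≠ b) := by
  simp [SimpleGraph.sup_adj, SimpleGraph.fromEdgeSet_adj]

theorem adj_of_addIf_adj {G : SimpleGraph (Fin n)} {e : Sym2 (Fin n)} {a b : Fin n}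
    (h : (addIf G e).Adj a b) : G.Adj a b ∨ s(a, b) = e := by
  unfold addIf at h
  split_ifs at h
  · induction e with
    | _ x y => exact (sup_edge_adj.1 h).imp id And.left
  · exact Or.inl h

/-- An edge is accepted as soon as one endpoint lies in a minimum cover. -/
theorem addIf_adj_of_notMem_uncovered {G : SimpleGraph (Fin n)} (hG : IsKonig G) {x y : Fin n}
    (hxy : x ≠ y) (hy : y ∉ uncovered G) : (addIf G s(x, y)).Adj x y := by
  have hK : IsKonig (G ⊔ SimpleGraph.fromEdgeSet {s(x, y)}) := by
    simp only [uncovered, Finset.mem_filter, Finset.mem_univ, true_and, not_forall,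
      not_not] at hy
    obtain ⟨C, hC, hyC⟩ := hy
    refine le_antisymm (matchNum_le_coverNum _) ?_
    have hC' : IsVertexCover (G ⊔ SimpleGraph.fromEdgeSet {s(x, y)}) C := by
      rw [isVertexCover_iff]
      intro a b hab
      rcases sup_edge_adj.1 hab with h | ⟨h, -⟩
      · exact isVertexCover_iff.1 hC.1 a b h
      · rcases Sym2.eq_iff.1 h with ⟨rfl, rfl⟩ | ⟨rfl, rfl⟩
        · exact Or.inr hyC
        · exact Or.inl hyC
    refine hC'.coverNum_le.trans ?_
    rw [hC.2, ← hG]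
    exact matchNum_mono le_sup_left
  rw [addIf, if_pos hK]
  exact sup_edge_adj.2 (Or.inr ⟨rfl, hxy⟩)

theorem coMissed_accept {G : SimpleGraph (Fin n)} (hG : IsKonig G) {x y : Fin n}
    (hxy : x ≠ y) (h : CoMissed G x y) :
    IsKonig (G ⊔ SimpleGraph.fromEdgeSet {s(x, y)}) ∧
      matchNum G + 1 ≤ matchNum (G ⊔ SimpleGraph.fromEdgeSet {s(x, y)}) := by
  obtain ⟨M, hM, hx, hy⟩ := h
  have hne : s(x, y) ∉ M := fun he => hx _ he (by simp)
  have hM' : IsMatchingOn (G ⊔ SimpleGraph.fromEdgeSet {s(x, y)}) (insert s(x, y) M) := by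
    have key : ∀ e ∈ M, ∀ v : Fin n, v ∈ s(x, y) → v ∉ e := by
      intro e he v hv
      rcases Sym2.mem_iff.1 hv with rfl | rfl
      · exact hx e he
      · exact hy e he
    refine ⟨fun e he => ?_, fun e he f hf hef v hve hvf => ?_⟩
    · rcases Finset.mem_insert.1 he with rfl | he
      · exact sup_edge_adj.2 (Or.inr ⟨rfl, hxy⟩)
      · exact SimpleGraph.edgeSet_mono le_sup_left (hM.1.1 e he)
    · rcases Finset.mem_insert.1 he with rfl | he <;> rcases Finset.mem_insert.1 hf with rfl | hf
      · exact hef rfl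
      · exact key f hf v hve hvf
      · exact key e he v hvf hve
      · exact hM.1.2 e he f hf hef v hve hvf
  have h1 := hM'.card_le
  rw [Finset.card_insert_of_notMem hne, hM.2] at h1
  refine ⟨le_antisymm (matchNum_le_coverNum _) (le_trans ?_ h1), h1⟩
  obtain ⟨C, hC⟩ := exists_isMinCover G
  have hC' : IsVertexCover (G ⊔ SimpleGraph.fromEdgeSet {s(x, y)}) (insert x C) := by
    rw [isVertexCover_iff]
    intro a b hab
    rcases sup_edge_adj.1 hab with h | ⟨h, -⟩
    · exact (isVertexCover_iff.1 hC.1 a b h).imp (Finset.mem_insert_of_mem ·)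
        (Finset.mem_insert_of_mem ·)
    · rcases Sym2.eq_iff.1 h with ⟨rfl, rfl⟩ | ⟨rfl, rfl⟩ <;> simp
  refine hC'.coverNum_le.trans ((Finset.card_insert_le _ _).trans ?_)
  rw [hC.2, ← hG]

theorem addIf_adj_of_coMissed {G : SimpleGraph (Fin n)} (hG : IsKonig G) {x y : Fin n}
    (hxy : x ≠ y) (h : CoMissed G x y) : (addIf G s(x, y)).Adj x y := by
  rw [addIf, if_pos (coMissed_accept hG hxy h).1]
  exact sup_edge_adj.2 (Or.inr ⟨rfl, hxy⟩)

theorem matchNum_addIf_of_coMissed {G : SimpleGraph (Fin n)} (hG : IsKonig G) {x y : Fin n}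
    (hxy : x ≠ y) (h : CoMissed G x y) : matchNum G + 1 ≤ matchNum (addIf G s(x, y)) := by
  rw [addIf, if_pos (coMissed_accept hG hxy h).1]
  exact (coMissed_accept hG hxy h).2

/-- An edge joining an isolated vertex to a rigid vertex is rejected. -/
theorem addIf_eq_of_rigid {G : SimpleGraph (Fin n)} (hG : IsKonig G) {u y : Fin n}
    (hu : u ∈ isolated G) (hy : y ∈ rigid G) : addIf G s(u, y) = G := by
  obtain ⟨hyJ, hyD⟩ := Finset.mem_sdiff.1 hy
  have huy : u ≠ y := fun h => hyD (h ▸ isolated_subset_missable G hu)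
  have hu' : ∀ w, ¬ G.Adj u w := (Finset.mem_filter.1 hu).2
  rw [addIf, if_neg]
  intro hK
  set H := G ⊔ SimpleGraph.fromEdgeSet {s(u, y)} with hH
  have h1 : coverNum G + 1 ≤ coverNum H := by
    by_contra hlt
    obtain ⟨C, hC⟩ := exists_isMinCover H
    have hCG : IsVertexCover G C := isVertexCover_iff.2 fun a b hab =>
      isVertexCover_iff.1 hC.1 a b (sup_edge_adj.2 (Or.inl hab))
    have hle := hCG.coverNum_le
    have hcard : C.card = coverNum G := by have := hC.2; omega
    rcases isVertexCover_iff.1 hC.1 u y (sup_edge_adj.2 (Or.inr ⟨rfl, huy⟩)) with h | h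
    · have : IsVertexCover G (C.erase u) := isVertexCover_iff.2 fun a b hab => by
        have hau : a ≠ u := by rintro rfl; exact hu' b hab
        have hbu : b ≠ u := by rintro rfl; exact hu' a hab.symm
        simpa [hau, hbu] using isVertexCover_iff.1 hCG a b hab
      have := this.coverNum_le
      rw [Finset.card_erase_of_mem h] at this
      have : 0 < C.card := Finset.card_pos.2 ⟨u, h⟩
      omega
    · exact (Finset.mem_filter.1 hyJ).2 C ⟨hCG, hcard⟩ h
  have h2 : matchNum G + 1 ≤ matchNum H := by rw [hK, hG]; exact h1
  obtain ⟨M, hM⟩ := exists_isMaxMatching H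
  have hsub : IsMatchingOn G (M.erase s(u, y)) := by
    refine ⟨fun e he => ?_, fun e he f hf => hM.1.2 e (Finset.mem_of_mem_erase he) f
      (Finset.mem_of_mem_erase hf)⟩
    have h := hM.1.1 e (Finset.mem_of_mem_erase he)
    have hne := Finset.ne_of_mem_erase he
    induction e with
    | _ a b =>
      rcases sup_edge_adj.1 h with h | ⟨h, -⟩
      · exact h
      · exact absurd h hne
  have hle := hsub.card_le
  by_cases hmem : s(u, y) ∈ M
  · rw [Finset.card_erase_of_mem hmem, hM.2] at hle
    apply hyD
    refine Finset.mem_filter.2 ⟨Finset.mem_univ _, M.erase s(u, y), ⟨hsub, ?_⟩, ?_⟩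
    · rw [Finset.card_erase_of_mem hmem, hM.2]; omega
    · intro e he hye
      exact hM.1.2 e (Finset.mem_of_mem_erase he) _ hmem (Finset.ne_of_mem_erase he) y hye
        (by simp)
  · rw [Finset.erase_eq_of_notMem hmem, hM.2] at hle
    omega

/-! ### Cherries -/

/-- `x` has `w` as its only neighbour. -/
def IsPendant (G : SimpleGraph (Fin n)) (x w : Fin n) : Prop := ∀ y, G.Adj x y ↔ y = w

/-- `x` and `x'` are distinct and both have `w` as only neighbour. -/
def IsCherry (G : SimpleGraph (Fin n)) (x x' w : Fin n) : Prop :=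
  x ≠ x' ∧ IsPendant G x w ∧ IsPendant G x' w

theorem IsCherry.symm {G : SimpleGraph (Fin n)} {x x' w : Fin n} (h : IsCherry G x x' w) :
    IsCherry G x' x w := ⟨h.1.symm, h.2.2, h.2.1⟩

theorem IsCherry.coMissed {G : SimpleGraph (Fin n)} {x x' w y : Fin n} (h : IsCherry G x x' w)
    (hy : y ∈ missable G) (hyx' : y ≠ x') : CoMissed G x y := by
  obtain ⟨M, hM, hyM⟩ := (Finset.mem_filter.1 hy).2
  by_cases hx : Misses M x
  · exact ⟨M, hM, hx, hyM⟩
  obtain ⟨hne, hxw, hxw'⟩ := h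
  have hM1 := hM.1
  simp only [Misses, not_forall, not_not] at hx
  obtain ⟨e, he, hxe⟩ := hx
  obtain ⟨b, rfl⟩ := hxe
  obtain rfl : b = w := (hxw b).1 (hM1.1 _ he)
  have hwx' : G.Adj x' b := (hxw' b).2 rfl
  have hbx : x ≠ b := (show G.Adj x b from hM1.1 _ he).ne
  have hother : ∀ f ∈ M.erase s(x, b), b ∉ f ∧ x ∉ f ∧ x' ∉ f := by
    intro f hf
    have hfM := Finset.mem_of_mem_erase hf
    have hfne := Finset.ne_of_mem_erase hf
    refine ⟨hM1.2 _ he f hfM hfne.symm b (by simp), hM1.2 _ he f hfM hfne.symm x (by simp), ?_⟩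
    intro hx'f
    obtain ⟨c, rfl⟩ := hx'f
    obtain rfl : c = b := (hxw' c).1 (hM1.1 _ hfM)
    exact hM1.2 _ he _ hfM hfne.symm c (by simp) (by simp)
  have hyb : y ≠ b := fun hyb => hyM _ he (by simp [hyb])
  have hnm : s(x', b) ∉ M.erase s(x, b) := fun hm => (hother _ hm).1 (by simp)
  refine ⟨insert s(x', b) (M.erase s(x, b)), ⟨⟨?_, ?_⟩, ?_⟩, ?_, ?_⟩
  · intro f hf
    rcases Finset.mem_insert.1 hf with rfl | hf
    · exact hwx'
    · exact hM1.1 _ (Finset.mem_of_mem_erase hf)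
  · intro f hf g hg hfg v hvf hvg
    rcases Finset.mem_insert.1 hf with rfl | hf' <;> rcases Finset.mem_insert.1 hg with rfl | hg'
    · exact hfg rfl
    · rcases Sym2.mem_iff.1 hvf with rfl | rfl
      · exact (hother g hg').2.2 hvg
      · exact (hother g hg').1 hvg
    · rcases Sym2.mem_iff.1 hvg with rfl | rfl
      · exact (hother f hf').2.2 hvf
      · exact (hother f hf').1 hvf
    · exact hM1.2 f (Finset.mem_of_mem_erase hf') g (Finset.mem_of_mem_erase hg') hfg v hvf hvg
  · rw [Finset.card_insert_of_notMem hnm, Finset.card_erase_of_mem he, ← hM.2]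
    have : 0 < M.card := Finset.card_pos.2 ⟨_, he⟩
    omega
  · intro f hf hxf
    rcases Finset.mem_insert.1 hf with rfl | hf
    · rcases Sym2.mem_iff.1 hxf with h | h
      · exact hne h
      · exact hbx h
    · exact (hother f hf).2.1 hxf
  · intro f hf hyf
    rcases Finset.mem_insert.1 hf with rfl | hf
    · rcases Sym2.mem_iff.1 hyf with h | h
      · exact hyx' h
      · exact hyb h
    · exact hyM f (Finset.mem_of_mem_erase hf) hyf

/-- A leaf of a cherry accepts every edge to a non-rigid vertex outside the cherry. -/
theorem IsCherry.addIf_adj {G : SimpleGraph (Fin n)} (hG : IsKonig G) {x x' w y : Fin n}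
    (h : IsCherry G x x' w) (hy : y ∉ rigid G) (hyx : y ≠ x) (hyx' : y ≠ x') :
    (addIf G s(x, y)).Adj x y := by
  by_cases hJ : y ∈ uncovered G
  · have hD : y ∈ missable G := by
      by_contra hD
      exact hy (Finset.mem_sdiff.2 ⟨hJ, hD⟩)
    exact addIf_adj_of_coMissed hG hyx.symm (h.coMissed hD hyx')
  · exact addIf_adj_of_notMem_uncovered hG hyx.symm hJ

end Structure

section Deficiency

variable {n : ℕ}

/-- The neighbourhood of a set of vertices. -/
def nbrs (G : SimpleGraph (Fin n)) (X : Finset (Fin n)) : Finset (Fin n) :=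
  Finset.univ.filter fun w => ∃ x ∈ X, G.Adj x w

theorem mem_nbrs {G : SimpleGraph (Fin n)} {X : Finset (Fin n)} {w : Fin n} :
    w ∈ nbrs G X ↔ ∃ x ∈ X, G.Adj x w := by simp [nbrs]

theorem nbrs_mono {G : SimpleGraph (Fin n)} {X Y : Finset (Fin n)} (h : X ⊆ Y) :
    nbrs G X ⊆ nbrs G Y := by
  intro w hw
  obtain ⟨x, hx, hxw⟩ := mem_nbrs.1 hw
  exact mem_nbrs.2 ⟨x, h hx, hxw⟩

theorem mem_isolated {G : SimpleGraph (Fin n)} {v : Fin n} :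
    v ∈ isolated G ↔ ∀ w, ¬ G.Adj v w := by simp [isolated]

theorem notMem_cover_of_misses {G : SimpleGraph (Fin n)} (hG : IsKonig G)
    {M : Finset (Sym2 (Fin n))} {C : Finset (Fin n)} (hM : IsMaxMatching G M)
    (hC : IsMinCover G C) {v : Fin n} (hv : Misses M v) : v ∉ C := by
  intro hvC
  have h : M.card ≤ (C.erase v).card := by
    refine Finset.card_le_card_of_forall_subsingleton (fun e v => v ∈ e) ?_ ?_
    · intro e he
      obtain ⟨w, hw, hwe⟩ := hC.1 e (hM.1.1 e he)
      exact ⟨w, Finset.mem_erase.2 ⟨fun h => hv e he (h ▸ hwe), hw⟩, hwe⟩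
    · intro v _ e he e' he'
      by_contra hne
      exact hM.1.2 e he.1 e' he'.1 hne v he.2 he'.2
  rw [Finset.card_erase_of_mem hvC, hM.2, hC.2, hG] at h
  have : 0 < C.card := Finset.card_pos.2 ⟨v, hvC⟩
  rw [hC.2] at this
  omega

/-- In a König graph, a maximum matching joins a minimum cover to vertices outside it. -/
theorem IsMaxMatching.notMem_cover {G : SimpleGraph (Fin n)} (hG : IsKonig G)
    {M : Finset (Sym2 (Fin n))} {C : Finset (Fin n)} (hM : IsMaxMatching G M)
    (hC : IsMinCover G C) {c y : Fin n} (he : s(c, y) ∈ M) (hc : c ∈ C) : y ∉ C := by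
  intro hy
  have hcy : c ≠ y := (show G.Adj c y from hM.1.1 _ he).ne
  have h : (M.erase s(c, y)).card ≤ ((C.erase c).erase y).card := by
    refine Finset.card_le_card_of_forall_subsingleton (fun e v => v ∈ e) ?_ ?_
    · intro e he'
      have heM := Finset.mem_of_mem_erase he'
      have hne := Finset.ne_of_mem_erase he'
      obtain ⟨w, hw, hwe⟩ := hC.1 e (hM.1.1 e heM)
      refine ⟨w, Finset.mem_erase.2 ⟨?_, Finset.mem_erase.2 ⟨?_, hw⟩⟩, hwe⟩
      · rintro rfl; exact hM.1.2 _ he e heM hne.symm w (by simp) hwe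
      · rintro rfl; exact hM.1.2 _ he e heM hne.symm w (by simp) hwe
    · intro v _ e he e' he'
      by_contra hne
      exact hM.1.2 e (Finset.mem_of_mem_erase he.1) e' (Finset.mem_of_mem_erase he'.1) hne v
        he.2 he'.2
  rw [Finset.card_erase_of_mem he, Finset.card_erase_of_mem (Finset.mem_erase.2 ⟨hcy.symm, hy⟩),
    Finset.card_erase_of_mem hc, hM.2, hC.2, hG] at h
  have : ({c, y} : Finset (Fin n)).card ≤ C.card :=
    Finset.card_le_card (by intro z hz; simp at hz; rcases hz with rfl | rfl <;> assumption)
  rw [Finset.card_pair hcy, hC.2] at this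
  omega

theorem coMissed_iff_exists_injOn {G : SimpleGraph (Fin n)} (hG : IsKonig G)
    {C : Finset (Fin n)} (hC : IsMinCover G C) {a z : Fin n} (ha : a ∉ C) (hz : z ∉ C) :
    CoMissed G a z ↔ ∃ f : {c // c ∈ C} → Fin n, Function.Injective f ∧
      ∀ c : {c // c ∈ C}, G.Adj c.1 (f c) ∧ f c ∉ C ∧ f c ≠ a ∧ f c ≠ z := by
  constructor
  · rintro ⟨M, hM, haM, hzM⟩
    have h : ∀ c : {c // c ∈ C}, ∃ y, s(c.1, y) ∈ M := by
      intro c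
      by_contra hcon
      refine notMem_cover_of_misses hG hM hC (v := c.1) ?_ c.2
      rintro e he ⟨y, rfl⟩
      exact hcon ⟨y, he⟩
    choose f hf using h
    refine ⟨f, ?_, fun c => ⟨hM.1.1 _ (hf c), hM.notMem_cover hG hC (hf c) c.2, ?_, ?_⟩⟩
    · intro c c' hcc
      by_contra hne
      refine hM.1.2 _ (hf c) _ (hf c') ?_ (f c) (by simp) (by simp [hcc])
      intro h
      rw [← hcc, Sym2.congr_left] at h
      exact hne (Subtype.ext h)
    · intro h; exact haM _ (hf c) (by simp [h])
    · intro h; exact hzM _ (hf c) (by simp [h])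
  · rintro ⟨f, hf, hfc⟩
    have hinj : Function.Injective fun c : {c // c ∈ C} => s(c.1, f c) := by
      intro c c' h
      rcases Sym2.eq_iff.1 h with ⟨h, -⟩ | ⟨h, -⟩
      · exact Subtype.ext h
      · exact absurd (h ▸ c.2) (hfc c').2.1
    have hmiss : ∀ v, v ∉ C → (∀ c, f c ≠ v) →
        Misses (Finset.univ.image fun c : {c // c ∈ C} => s(c.1, f c)) v := by
      intro v hv hvf e he hve
      obtain ⟨c, -, rfl⟩ := Finset.mem_image.1 he
      rcases Sym2.mem_iff.1 hve with h | h
      · exact hv (h ▸ c.2)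
      · exact hvf c h.symm
    refine ⟨Finset.univ.image fun c : {c // c ∈ C} => s(c.1, f c), ⟨⟨?_, ?_⟩, ?_⟩,
      hmiss a ha fun c => (hfc c).2.2.1, hmiss z hz fun c => (hfc c).2.2.2⟩
    · intro e he
      obtain ⟨c, -, rfl⟩ := Finset.mem_image.1 he
      exact (hfc c).1
    · intro e he e' he' hne v hv hv'
      obtain ⟨c, -, rfl⟩ := Finset.mem_image.1 he
      obtain ⟨c', -, rfl⟩ := Finset.mem_image.1 he'
      apply hne
      rcases Sym2.mem_iff.1 hv with rfl | rfl <;> rcases Sym2.mem_iff.1 hv' with h | h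
      · rw [Subtype.ext h]
      · exact absurd (h ▸ c.2) (hfc c').2.1
      · exact absurd (h ▸ c'.2) (hfc c).2.1
      · rw [hf h]
    · rw [Finset.card_image_of_injective _ hinj, Finset.card_univ, Fintype.card_coe, hC.2, hG]

/-- The non-isolated vertices outside `C` other than `a` which are missed together with `a` by
some maximum matching. -/
def coMissedWith (G : SimpleGraph (Fin n)) (C : Finset (Fin n)) (a : Fin n) : Finset (Fin n) :=
  Finset.univ.filter fun z => z ∉ C ∧ z ∉ isolated G ∧ z ≠ a ∧ CoMissed G a z

theorem card_nbrs_coMissedWith_lt {G : SimpleGraph (Fin n)} (hG : IsKonig G)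
    {C : Finset (Fin n)} (hC : IsMinCover G C) {a z₀ : Fin n} (ha : a ∉ C)
    (hz₀ : z₀ ∈ coMissedWith G C a) :
    (nbrs G (coMissedWith G C a)).card < (coMissedWith G C a).card := by
  set T : Finset (Fin n) :=
    Finset.univ.filter fun z => z ∉ C ∧ z ∉ isolated G ∧ z ≠ a with hT
  have hmemT : ∀ z, z ∈ T ↔ z ∉ C ∧ z ∉ isolated G ∧ z ≠ a := by simp [hT]
  let t : {c // c ∈ C} → Finset (Fin n) := fun c => T.filter (G.Adj c)
  have hmemt : ∀ c z, z ∈ t c ↔ z ∈ T ∧ G.Adj c z := by simp [t]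
  -- a co-missed vertex is one whose removal keeps Hall's condition
  have hall : ∀ z ∈ T, (CoMissed G a z ↔
      ∀ B : Finset {c // c ∈ C}, B.card ≤ ((B.biUnion t).erase z).card) := by
    intro z hz
    rw [coMissed_iff_exists_injOn hG hC ha ((hmemT z).1 hz).1]
    have h := Finset.all_card_le_biUnion_card_iff_exists_injective (fun c => (t c).erase z)
    have h' : ∀ B : Finset {c // c ∈ C}, B.biUnion (fun c => (t c).erase z) =
        (B.biUnion t).erase z := by
      intro B; ext w; simp only [Finset.mem_biUnion, Finset.mem_erase]; tauto
    simp only [h'] at h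
    rw [h]
    refine exists_congr fun f => and_congr_right fun _ => forall_congr' fun c => ?_
    rw [Finset.mem_erase, hmemt, hmemT, mem_isolated]
    constructor
    · rintro ⟨h1, h2, h3, h4⟩
      exact ⟨h4, ⟨h2, fun h => h _ h1.symm, h3⟩, h1⟩
    · rintro ⟨h1, ⟨h2, -, h3⟩, h4⟩
      exact ⟨h4, h2, h3, h1⟩
  have hmemS : ∀ z, z ∈ coMissedWith G C a ↔ z ∈ T ∧ CoMissed G a z := by
    intro z
    simp only [coMissedWith, hT, Finset.mem_filter, Finset.mem_univ, true_and]
    tauto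
  obtain ⟨hz₀T, hz₀c⟩ := (hmemS z₀).1 hz₀
  have hz₀h := (hall z₀ hz₀T).1 hz₀c
  have hallT : ∀ B : Finset {c // c ∈ C}, B.card ≤ (B.biUnion t).card := fun B =>
    (hz₀h B).trans (Finset.card_le_card (Finset.erase_subset _ _))
  have htight_union : ∀ A B : Finset {c // c ∈ C}, (A.biUnion t).card ≤ A.card →
      (B.biUnion t).card ≤ B.card → ((A ∪ B).biUnion t).card ≤ (A ∪ B).card := by
    intro A B hA hB
    have h1 := Finset.card_union_add_card_inter A B
    have h2 := Finset.card_union_add_card_inter (A.biUnion t) (B.biUnion t)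
    have h3 := hallT (A ∩ B)
    have h4 : ((A ∩ B).biUnion t).card ≤ (A.biUnion t ∩ B.biUnion t).card := by
      refine Finset.card_le_card fun w hw => ?_
      simp only [Finset.mem_biUnion, Finset.mem_inter] at hw ⊢
      obtain ⟨c, ⟨hA, hB⟩, hc⟩ := hw
      exact ⟨⟨c, hA, hc⟩, ⟨c, hB, hc⟩⟩
    have h5 : (A ∪ B).biUnion t = A.biUnion t ∪ B.biUnion t := Finset.union_biUnion
    rw [h5]
    omega
  obtain ⟨B, hB, hBmax⟩ := Finset.exists_max_image
    (Finset.univ.filter fun B : Finset {c // c ∈ C} => (B.biUnion t).card ≤ B.card)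
    Finset.card ⟨∅, by simp⟩
  replace hB := (Finset.mem_filter.1 hB).2
  have hBtop : ∀ A : Finset {c // c ∈ C}, (A.biUnion t).card ≤ A.card → A ⊆ B := by
    intro A hA
    have h := hBmax (A ∪ B) (Finset.mem_filter.2 ⟨Finset.mem_univ _, htight_union A B hA hB⟩)
    rw [Finset.eq_of_subset_of_card_le Finset.subset_union_right h]
    exact Finset.subset_union_left
  have hS : coMissedWith G C a = T \ B.biUnion t := by
    ext z
    rw [hmemS, Finset.mem_sdiff]
    refine and_congr_right fun hz => ?_
    rw [hall z hz]
    constructor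
    · intro h hzB
      have := h B
      rw [Finset.card_erase_of_mem hzB] at this
      have : 0 < (B.biUnion t).card := Finset.card_pos.2 ⟨z, hzB⟩
      omega
    · intro hzB A
      by_contra hlt
      have h1 := hallT A
      have hzA : z ∈ A.biUnion t := by
        by_contra hzA
        rw [Finset.erase_eq_of_notMem hzA] at hlt
        exact hlt h1
      rw [Finset.card_erase_of_mem hzA] at hlt
      exact hzB (Finset.biUnion_subset_biUnion_of_subset_left t (hBtop A (by omega)) hzA)
  have hTcard : C.card + 1 ≤ T.card := by
    have h := hz₀h Finset.univ
    rw [Finset.card_univ, Fintype.card_coe] at h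
    have h2 : ((Finset.univ.biUnion t).erase z₀) ⊆ T.erase z₀ := by
      refine Finset.erase_subset_erase _ fun w hw => ?_
      obtain ⟨c, -, hc⟩ := Finset.mem_biUnion.1 hw
      exact ((hmemt c w).1 hc).1
    have h3 := Finset.card_le_card h2
    rw [Finset.card_erase_of_mem hz₀T] at h3
    have : 0 < T.card := Finset.card_pos.2 ⟨z₀, hz₀T⟩
    omega
  have hScard : T.card ≤ (coMissedWith G C a).card + B.card := by
    rw [hS]
    have := Finset.le_card_sdiff (B.biUnion t) T
    omega
  have hN : nbrs G (coMissedWith G C a) ⊆ C \ B.map (Function.Embedding.subtype _) := by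
    intro w hw
    obtain ⟨z, hz, hzw⟩ := mem_nbrs.1 hw
    have hzT := ((hmemS z).1 hz).1
    rw [hS, Finset.mem_sdiff] at hz
    have hwC : w ∈ C :=
      (isVertexCover_iff.1 hC.1 z w hzw).resolve_left ((hmemT z).1 hzT).1
    refine Finset.mem_sdiff.2 ⟨hwC, fun hwB => hz.2 ?_⟩
    obtain ⟨c, hc, rfl⟩ := Finset.mem_map.1 hwB
    exact Finset.mem_biUnion.2 ⟨c, hc, (hmemt c z).2 ⟨hzT, hzw.symm⟩⟩
  have hNcard := Finset.card_le_card hN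
  rw [Finset.card_sdiff_of_subset] at hNcard
  · rw [Finset.card_map] at hNcard
    have hBC : B.card ≤ C.card := (Finset.card_le_univ B).trans (by simp)
    omega
  · intro w hw
    obtain ⟨c, -, rfl⟩ := Finset.mem_map.1 hw
    exact c.2

/-- A set with fewer neighbours than elements contains a minimal such set: it has exactly one
neighbour less than elements and every neighbour sees it at least twice. -/
theorem exists_minimal_deficient {G : SimpleGraph (Fin n)} {S : Finset (Fin n)}
    (hS : (nbrs G S).card < S.card) :
    ∃ X ⊆ S, X.card = (nbrs G X).card + 1 ∧
      ∀ w ∈ nbrs G X, 2 ≤ (X.filter fun x => G.Adj x w).card := by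
  obtain ⟨X, hX, hmin⟩ := Finset.exists_min_image
    (S.powerset.filter fun X => (nbrs G X).card < X.card) Finset.card
    ⟨S, Finset.mem_filter.2 ⟨Finset.mem_powerset_self S, hS⟩⟩
  obtain ⟨hXS, hlt⟩ := Finset.mem_filter.1 hX
  rw [Finset.mem_powerset] at hXS
  have hsmall : ∀ x ∈ X, X.card - 1 ≤ (nbrs G (X.erase x)).card := by
    intro x hx
    by_contra h
    have hcard := Finset.card_erase_of_mem hx
    have := hmin (X.erase x) (Finset.mem_filter.2 ⟨Finset.mem_powerset.2
      ((Finset.erase_subset _ _).trans hXS), by omega⟩)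
    have : 0 < X.card := Finset.card_pos.2 ⟨x, hx⟩
    omega
  refine ⟨X, hXS, ?_, ?_⟩
  · obtain ⟨x, hx⟩ : X.Nonempty := Finset.card_pos.1 (by omega)
    have h1 := hsmall x hx
    have h2 := Finset.card_le_card (nbrs_mono (G := G) (Finset.erase_subset x X))
    omega
  · intro w hw
    by_contra hlt2
    obtain ⟨x, hx, hxw⟩ := mem_nbrs.1 hw
    have hone : ∀ x' ∈ X, G.Adj x' w → x' = x := by
      intro x' hx' hxw'
      exact Finset.card_le_one.1 (by omega : (X.filter fun x => G.Adj x w).card ≤ 1) x'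
        (Finset.mem_filter.2 ⟨hx', hxw'⟩) x (Finset.mem_filter.2 ⟨hx, hxw⟩)
    have hsub : nbrs G (X.erase x) ⊆ (nbrs G X).erase w := by
      intro v hv
      obtain ⟨x', hx', hxv⟩ := mem_nbrs.1 hv
      refine Finset.mem_erase.2 ⟨?_, mem_nbrs.2 ⟨x', Finset.mem_of_mem_erase hx', hxv⟩⟩
      rintro rfl
      exact Finset.ne_of_mem_erase hx' (hone x' (Finset.mem_of_mem_erase hx') hxv)
    have h1 := Finset.card_le_card hsub
    rw [Finset.card_erase_of_mem hw] at h1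
    have h2 := hsmall x hx
    have : 0 < (nbrs G X).card := Finset.card_pos.2 ⟨w, hw⟩
    omega

/-- A König graph with at least two missed non-isolated vertices has many co-missed pairs unless
it contains a small deficient set. -/
theorem mul_self_le_card_coPairs {G : SimpleGraph (Fin n)} (hG : IsKonig G)
    (h : (isolated G).card + 2 * matchNum G + 2 ≤ n) (R : ℕ)
    (hR : ∀ X W : Finset (Fin n), X.card = W.card + 1 → Disjoint X W → W.Nonempty →
      (∀ x ∈ X, ∃ w, G.Adj x w) → (∀ x ∈ X, ∀ w, G.Adj x w → w ∈ W) →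
      (∀ w ∈ W, 2 ≤ (X.filter fun x => G.Adj x w).card) → R ≤ X.card) :
    R * R ≤ (coPairs G).card := by
  obtain ⟨C, hC⟩ := exists_isMinCover G
  obtain ⟨M, hM⟩ := exists_isMaxMatching G
  have hbig : ∀ a z₀, a ∉ C → z₀ ∈ coMissedWith G C a → R ≤ (coMissedWith G C a).card := by
    intro a z₀ ha hz₀
    obtain ⟨X, hXS, hXc, hX2⟩ := exists_minimal_deficient
      (card_nbrs_coMissedWith_lt hG hC ha hz₀)
    have hXmem : ∀ x ∈ X, x ∉ C ∧ ∃ w, G.Adj x w := by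
      intro x hx
      obtain ⟨h1, h2, -⟩ := (Finset.mem_filter.1 (hXS hx)).2
      rw [mem_isolated] at h2
      push Not at h2
      exact ⟨h1, h2⟩
    have hXpos : X.Nonempty := Finset.card_pos.1 (by omega)
    refine (hR X (nbrs G X) hXc ?_ ?_ (fun x hx => (hXmem x hx).2)
      (fun x hx w hw => mem_nbrs.2 ⟨x, hx, hw⟩) hX2).trans (Finset.card_le_card hXS)
    · rw [Finset.disjoint_left]
      intro x hx hxN
      obtain ⟨y, hy, hyx⟩ := mem_nbrs.1 hxN
      rcases isVertexCover_iff.1 hC.1 y x hyx with h | h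
      · exact (hXmem y hy).1 h
      · exact (hXmem x hx).1 h
    · obtain ⟨x, hx⟩ := hXpos
      obtain ⟨w, hw⟩ := (hXmem x hx).2
      exact ⟨w, mem_nbrs.2 ⟨x, hx, hw⟩⟩
  have hmiss : 2 ≤ (missedVerts M \ isolated G).card := by
    have h1 := card_missedVerts hM.1
    have h2 := Finset.le_card_sdiff (isolated G) (missedVerts M)
    rw [hM.2] at h1
    omega
  obtain ⟨a, ha, z, hz, haz⟩ := Finset.one_lt_card.1 hmiss
  have hprop : ∀ v ∈ missedVerts M \ isolated G, v ∉ C ∧ v ∉ isolated G ∧ Misses M v := by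
    intro v hv
    obtain ⟨h1, h2⟩ := Finset.mem_sdiff.1 hv
    have h1 := (Finset.mem_filter.1 h1).2
    exact ⟨notMem_cover_of_misses hG hM hC h1, h2, h1⟩
  obtain ⟨haC, haI, haM⟩ := hprop a ha
  obtain ⟨hzC, hzI, hzM⟩ := hprop z hz
  have hza : z ∈ coMissedWith G C a :=
    Finset.mem_filter.2 ⟨Finset.mem_univ _, hzC, hzI, haz.symm, M, hM, haM, hzM⟩
  have hSa := hbig a z haC hza
  have hSb : ∀ b ∈ coMissedWith G C a, R ≤ (coMissedWith G C b).card := by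
    intro b hb
    obtain ⟨hbC, hbI, hba, M', hM', h1, h2⟩ := (Finset.mem_filter.1 hb).2
    exact hbig b a hbC
      (Finset.mem_filter.2 ⟨Finset.mem_univ _, haC, haI, hba.symm, M', hM', h2, h1⟩)
  calc R * R ≤ ∑ b ∈ coMissedWith G C a, (coMissedWith G C b).card := by
        refine (Nat.mul_le_mul_right R hSa).trans ?_
        rw [← smul_eq_mul]
        exact Finset.card_nsmul_le_sum _ _ _ hSb
    _ = ((coMissedWith G C a).sigma fun b => coMissedWith G C b).card :=
        (Finset.card_sigma _ _).symm
    _ ≤ (coPairs G).card := by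
        refine Finset.card_le_card_of_injOn (fun p => (p.1, p.2)) ?_ ?_
        · intro p hp
          obtain ⟨-, -, hne, hco⟩ := (Finset.mem_filter.1 (Finset.mem_sigma.1 hp).2).2
          exact Finset.mem_filter.2 ⟨Finset.mem_univ _, hne.symm, hco⟩
        · rintro ⟨p1, p2⟩ - ⟨q1, q2⟩ - h
          simp only [Prod.mk.injEq] at h
          obtain ⟨rfl, rfl⟩ := h
          rfl

end Deficiency

/-! ### The process as a function of the history -/

section History

variable {n : ℕ}

/-- The number of edges of the complete graph on `n` vertices. -/
abbrev pairCount (n : ℕ) : ℕ := n * (n - 1) / 2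

instance : Fintype (EdgeOrdering n) :=
  inferInstanceAs (Fintype {σ : Fin (n * (n - 1) / 2) → Sym2 (Fin n) //
    Function.Injective σ ∧ ∀ i, ¬ (σ i).IsDiag})

theorem card_nonDiag : Fintype.card {e : Sym2 (Fin n) // ¬ e.IsDiag} = pairCount n := by
  rw [Sym2.card_subtype_not_diag, Fintype.card_fin, Nat.choose_two_right]

instance : Nonempty (EdgeOrdering n) := by
  have e : Fin (pairCount n) ≃ {e : Sym2 (Fin n) // ¬ e.IsDiag} :=
    Fintype.equivOfCardEq (by rw [Fintype.card_fin, card_nonDiag])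
  exact ⟨⟨fun i => (e i).1, fun i j h => e.injective (Subtype.ext h), fun i => (e i).2⟩⟩

/-- The graph obtained by offering the edges of a list, the head being offered last. -/
def Gr : List (Sym2 (Fin n)) → SimpleGraph (Fin n)
  | [] => ⊥
  | e :: h => addIf (Gr h) e

/-- The first `t` edges of an ordering, latest first. -/
def hist (σ : EdgeOrdering n) : ℕ → List (Sym2 (Fin n))
  | 0 => []
  | t + 1 => if h : t < pairCount n then σ.1 ⟨t, h⟩ :: hist σ t else hist σ t

theorem konigProc_eq_gr (σ : EdgeOrdering n) (t : ℕ) : KonigProc σ t = Gr (hist σ t) := by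
  induction t with
  | zero => rfl
  | succ t ih =>
    rw [KonigProc, hist]
    split_ifs with h1 h2
    · rw [Gr, addIf, ← ih, if_pos h2]
    · rw [Gr, addIf, ← ih, if_neg h2]
    · exact ih

theorem hist_succ (σ : EdgeOrdering n) {t : ℕ} (h : t < pairCount n) :
    hist σ (t + 1) = σ.1 ⟨t, h⟩ :: hist σ t := by
  rw [hist, dif_pos h]

theorem length_hist (σ : EdgeOrdering n) {t : ℕ} (h : t ≤ pairCount n) :
    (hist σ t).length = t := by
  induction t with
  | zero => rfl
  | succ t ih => rw [hist_succ σ h, List.length_cons, ih (by omega)]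

theorem hist_suffix (σ : EdgeOrdering n) {s t : ℕ} (h : s ≤ t) : hist σ s <:+ hist σ t := by
  induction t, h using Nat.le_induction with
  | base => exact List.suffix_rfl
  | succ t _ ih =>
    rw [hist]
    split_ifs
    · exact ih.trans (List.suffix_cons _ _)
    · exact ih

theorem mem_hist (σ : EdgeOrdering n) {t : ℕ} (ht : t ≤ pairCount n) {e : Sym2 (Fin n)} :
    e ∈ hist σ t ↔ ∃ i : Fin (pairCount n), i.1 < t ∧ σ.1 i = e := by
  induction t with
  | zero => simp [hist]
  | succ t ih =>
    rw [hist_succ σ ht, List.mem_cons, ih (by omega)]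
    constructor
    · rintro (rfl | ⟨i, hi, rfl⟩)
      · exact ⟨⟨t, ht⟩, by simp, rfl⟩
      · exact ⟨i, by omega, rfl⟩
    · rintro ⟨i, hi, rfl⟩
      rcases Nat.lt_succ_iff_lt_or_eq.1 hi with h | h
      · exact Or.inr ⟨i, h, rfl⟩
      · left
        subst h
        rfl

/-- A list of distinct non-diagonal edges. -/
def ValidHist (h : List (Sym2 (Fin n))) : Prop := h.Nodup ∧ ∀ e ∈ h, ¬ e.IsDiag

theorem validHist_hist (σ : EdgeOrdering n) {t : ℕ} (ht : t ≤ pairCount n) :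
    ValidHist (hist σ t) := by
  refine ⟨?_, fun e he => ?_⟩
  · induction t with
    | zero => exact List.nodup_nil
    | succ t ih =>
      rw [hist_succ σ ht, List.nodup_cons]
      refine ⟨fun h => ?_, ih (by omega)⟩
      obtain ⟨i, hi, hi'⟩ := (mem_hist σ (by omega)).1 h
      rw [σ.2.1 hi'] at hi
      exact lt_irrefl _ hi
  · obtain ⟨i, -, rfl⟩ := (mem_hist σ ht).1 he
    exact σ.2.2 i

/-- The edges not yet offered. -/
def unused (h : List (Sym2 (Fin n))) : Finset (Sym2 (Fin n)) :=
  Finset.univ.filter fun e => ¬ e.IsDiag ∧ e ∉ h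

theorem mem_unused {h : List (Sym2 (Fin n))} {e : Sym2 (Fin n)} :
    e ∈ unused h ↔ ¬ e.IsDiag ∧ e ∉ h := by simp [unused]

theorem card_unused_add {h : List (Sym2 (Fin n))} (hh : ValidHist h) :
    (unused h).card + h.length = pairCount n := by
  rw [← card_nonDiag, Fintype.card_subtype, ← List.toFinset_card_of_nodup hh.1]
  rw [← Finset.card_union_of_disjoint]
  · congr 1
    ext e
    simp only [Finset.mem_union, mem_unused, List.mem_toFinset, Finset.mem_filter,
      Finset.mem_univ, true_and]
    constructor
    · rintro (h | h)
      · exact h.1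
      · exact hh.2 e h
    · intro h
      by_cases he : e ∈ ‹List (Sym2 (Fin n))›
      · exact Or.inr he
      · exact Or.inl ⟨h, he⟩
  · rw [Finset.disjoint_left]
    intro e he he'
    exact (mem_unused.1 he).2 (List.mem_toFinset.1 he')

theorem length_le_pairCount {h : List (Sym2 (Fin n))} (hh : ValidHist h) :
    h.length ≤ pairCount n := by
  have := card_unused_add hh; omega

/-- Interchange the edges at two positions. -/
def swapAt (i j : Fin (pairCount n)) (σ : EdgeOrdering n) : EdgeOrdering n :=
  ⟨σ.1 ∘ Equiv.swap i j, σ.2.1.comp (Equiv.swap i j).injective, fun _ => σ.2.2 _⟩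

theorem swapAt_swapAt (i j : Fin (pairCount n)) (σ : EdgeOrdering n) :
    swapAt i j (swapAt i j σ) = σ := by
  apply Subtype.ext
  funext x
  simp [swapAt]

theorem hist_swapAt {i j : Fin (pairCount n)} (σ : EdgeOrdering n) {t : ℕ} (hi : t ≤ i)
    (hj : t ≤ j) : hist (swapAt i j σ) t = hist σ t := by
  induction t with
  | zero => rfl
  | succ t ih =>
    have ht : t < pairCount n := by have := i.2; omega
    rw [hist_succ _ ht, hist_succ _ ht, ih (by omega) (by omega)]
    congr 1
    simp only [swapAt, Function.comp]
    rw [Equiv.swap_apply_of_ne_of_ne]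
    · intro h; have := congrArg Fin.val h; simp at this; omega
    · intro h; have := congrArg Fin.val h; simp at this; omega

/-- Conditionally on the first `t` edges, the next edge is uniform among the unused ones. -/
theorem sum_hist_succ {t : ℕ} (ht : t < pairCount n) (g : List (Sym2 (Fin n)) → ℝ) :
    ∑ σ : EdgeOrdering n, ∑ e ∈ unused (hist σ t), g (e :: hist σ t) =
      ((pairCount n : ℝ) - t) * ∑ σ : EdgeOrdering n, g (hist σ (t + 1)) := by
  have h1 : ∀ σ : EdgeOrdering n, ∑ e ∈ unused (hist σ t), g (e :: hist σ t) =
      ∑ j ∈ Finset.Ici (⟨t, ht⟩ : Fin (pairCount n)), g (σ.1 j :: hist σ t) := by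
    intro σ
    symm
    refine Finset.sum_bij (fun j _ => σ.1 j) ?_ (fun _ _ _ _ h => σ.2.1 h) ?_ (fun _ _ => rfl)
    · intro j hj
      rw [Finset.mem_Ici, Fin.le_def] at hj
      refine mem_unused.2 ⟨σ.2.2 j, fun h => ?_⟩
      obtain ⟨i, hi, hij⟩ := (mem_hist σ ht.le).1 h
      rw [σ.2.1 hij] at hi
      simp at hj
      omega
    · intro e he
      obtain ⟨hd, hn⟩ := mem_unused.1 he
      have hbij : Function.Bijective fun i => (⟨σ.1 i, σ.2.2 i⟩ : {e : Sym2 (Fin n) //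
          ¬ e.IsDiag}) := by
        rw [Fintype.bijective_iff_injective_and_card]
        refine ⟨fun i j h => σ.2.1 (Subtype.ext_iff.1 h), ?_⟩
        rw [Fintype.card_fin, card_nonDiag]
      obtain ⟨j, hj⟩ := hbij.2 ⟨e, hd⟩
      have hj' : σ.1 j = e := Subtype.ext_iff.1 hj
      refine ⟨j, ?_, hj'⟩
      rw [Finset.mem_Ici, Fin.le_def]
      by_contra hlt
      exact hn ((mem_hist σ ht.le).2 ⟨j, by simpa using hlt, hj'⟩)
  have h2 : ∀ j ∈ Finset.Ici (⟨t, ht⟩ : Fin (pairCount n)),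
      ∑ σ : EdgeOrdering n, g (σ.1 j :: hist σ t) =
        ∑ σ : EdgeOrdering n, g (hist σ (t + 1)) := by
    intro j hj
    rw [Finset.mem_Ici, Fin.le_def] at hj
    refine Finset.sum_bij (fun σ _ => swapAt ⟨t, ht⟩ j σ) (fun _ _ => Finset.mem_univ _) ?_ ?_ ?_
    · intro σ _ σ' _ h
      rw [← swapAt_swapAt ⟨t, ht⟩ j σ, h, swapAt_swapAt]
    · intro σ _
      exact ⟨swapAt ⟨t, ht⟩ j σ, Finset.mem_univ _, swapAt_swapAt _ _ _⟩
    · intro σ _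
      rw [hist_succ _ ht, hist_swapAt σ (by simp) (by simpa using hj)]
      simp [swapAt]
  simp_rw [h1]
  rw [Finset.sum_comm, Finset.sum_congr rfl h2, Finset.sum_const, Fin.card_Ici, nsmul_eq_mul,
    Nat.cast_sub ht.le]

end History

/-! ### Probability -/

section Probability

variable {n : ℕ}

theorem pr_eq (A : EdgeOrdering n → Prop) :
    Pr n A = ((Finset.univ.filter A).card : ℝ) / Fintype.card (EdgeOrdering n) := by
  rw [Pr, Nat.card_eq_fintype_card, Nat.card_eq_fintype_card, Fintype.card_subtype]

theorem card_edgeOrdering_pos : (0 : ℝ) < Fintype.card (EdgeOrdering n) := by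
  exact_mod_cast Fintype.card_pos

theorem pr_nonneg (A : EdgeOrdering n → Prop) : 0 ≤ Pr n A := by
  unfold Pr; positivity

theorem pr_mono {A B : EdgeOrdering n → Prop} (h : ∀ σ, A σ → B σ) : Pr n A ≤ Pr n B := by
  rw [pr_eq, pr_eq]
  have : (Finset.univ.filter A).card ≤ (Finset.univ.filter B).card :=
    Finset.card_le_card (Finset.monotone_filter_right _ fun σ _ => h σ)
  gcongr

theorem pr_not (A : EdgeOrdering n → Prop) : Pr n (fun σ => ¬ A σ) = 1 - Pr n A := by
  rw [pr_eq, pr_eq, eq_sub_iff_add_eq, ← add_div, div_eq_one_iff_eq card_edgeOrdering_pos.ne']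
  have := Finset.card_filter_add_card_filter_not (s := (Finset.univ : Finset (EdgeOrdering n))) A
  rw [add_comm, Finset.card_univ] at this
  norm_cast
  convert this

theorem pr_or_le (A B : EdgeOrdering n → Prop) :
    Pr n (fun σ => A σ ∨ B σ) ≤ Pr n A + Pr n B := by
  rw [pr_eq, pr_eq, pr_eq, ← add_div]
  have := Finset.card_union_le (Finset.univ.filter A) (Finset.univ.filter B)
  rw [← Finset.filter_or] at this
  gcongr
  norm_cast
  convert this

theorem pr_exists_le {ι : Type*} (s : Finset ι) (A : ι → EdgeOrdering n → Prop) :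
    Pr n (fun σ => ∃ i ∈ s, A i σ) ≤ ∑ i ∈ s, Pr n (A i) := by
  induction s using Finset.induction_on with
  | empty => simp [Pr]
  | insert a s ha ih =>
    rw [Finset.sum_insert ha]
    refine le_trans (pr_mono ?_) ((pr_or_le (A a) (fun σ => ∃ i ∈ s, A i σ)).trans
      (add_le_add le_rfl ih))
    rintro σ ⟨i, hi, h⟩
    rcases Finset.mem_insert.1 hi with rfl | hi
    · exact Or.inl h
    · exact Or.inr ⟨i, hi, h⟩

theorem mul_pr_le_of_sum_le {A : EdgeOrdering n → Prop} {X : EdgeOrdering n → ℝ} {a b : ℝ}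
    (hX : ∀ σ, 0 ≤ X σ) (hA : ∀ σ, A σ → a ≤ X σ)
    (hs : ∑ σ, X σ ≤ Fintype.card (EdgeOrdering n) * b) : a * Pr n A ≤ b := by
  rw [pr_eq, ← mul_div_assoc, div_le_iff₀ card_edgeOrdering_pos, mul_comm b]
  refine le_trans ?_ hs
  calc a * ((Finset.univ.filter A).card : ℝ) = ∑ σ ∈ Finset.univ.filter A, a := by
        rw [Finset.sum_const, nsmul_eq_mul, mul_comm]
    _ ≤ ∑ σ ∈ Finset.univ.filter A, X σ :=
        Finset.sum_le_sum fun σ hσ => hA σ (Finset.mem_filter.1 hσ).2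
    _ ≤ ∑ σ, X σ := Finset.sum_le_sum_of_subset_of_nonneg (Finset.filter_subset _ _)
        fun σ _ _ => hX σ

/-- Markov's inequality for the number of events that occur. -/
theorem mul_pr_card_le {ι : Type*} [Fintype ι] (A : ι → EdgeOrdering n → Prop) {a : ℝ} :
    a * Pr n (fun σ => a ≤ (Finset.univ.filter fun i => A i σ).card) ≤ ∑ i, Pr n (A i) := by
  refine mul_pr_le_of_sum_le (X := fun σ => ((Finset.univ.filter fun i => A i σ).card : ℝ))
    (fun σ => by positivity) (fun σ h => h) (le_of_eq ?_)
  have h1 : ∀ i, Pr n (A i) * Fintype.card (EdgeOrdering n) =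
      ∑ σ, if A i σ then (1 : ℝ) else 0 := by
    intro i
    rw [pr_eq, div_mul_cancel₀ _ card_edgeOrdering_pos.ne', Finset.sum_boole]
  rw [mul_comm, Finset.sum_mul, Finset.sum_congr rfl fun i _ => h1 i, Finset.sum_comm]
  refine Finset.sum_congr rfl fun σ _ => ?_
  rw [Finset.sum_boole]

/-- Probability that the next edge ever falls in a small history-dependent set. -/
theorem pr_exists_mem_le {T : ℕ} (hT : T < pairCount n) {b : ℝ}
    (B : List (Sym2 (Fin n)) → Finset (Sym2 (Fin n))) (hB : ∀ h, ((B h).card : ℝ) ≤ b) :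
    Pr n (fun σ => ∃ t < T, ∃ e ∈ B (hist σ t), hist σ (t + 1) = e :: hist σ t) ≤
      T * (b / (pairCount n - T)) := by
  have hpos : (0 : ℝ) < pairCount n - T := by
    rw [sub_pos]; exact_mod_cast hT
  have hb : 0 ≤ b := le_trans (by positivity) (hB [])
  have h1 : ∀ t ∈ Finset.range T,
      Pr n (fun σ => ∃ e ∈ B (hist σ t), hist σ (t + 1) = e :: hist σ t) ≤
        b / (pairCount n - T) := by
    intro t ht
    have htT : t < T := Finset.mem_range.1 ht
    have htN : t < pairCount n := htT.trans hT
    have hpos' : (0 : ℝ) < pairCount n - t := by rw [sub_pos]; exact_mod_cast htN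
    have htT' : (t : ℝ) ≤ T := by exact_mod_cast htT.le
    let g : List (Sym2 (Fin n)) → ℝ := fun h =>
      if ∃ e ∈ B h.tail, h = e :: h.tail then 1 else 0
    have hsum := sum_hist_succ htN g
    have hle : ∑ σ : EdgeOrdering n, ∑ e ∈ unused (hist σ t), g (e :: hist σ t) ≤
        Fintype.card (EdgeOrdering n) * b := by
      rw [← nsmul_eq_mul, ← Finset.card_univ, ← Finset.sum_const]
      refine Finset.sum_le_sum fun σ _ => ?_
      calc ∑ e ∈ unused (hist σ t), g (e :: hist σ t)
          ≤ ∑ e : Sym2 (Fin n), if e ∈ B (hist σ t) then (1 : ℝ) else 0 := by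
            refine (Finset.sum_le_sum fun e _ => ?_).trans
              (Finset.sum_le_sum_of_subset_of_nonneg (Finset.subset_univ _)
                fun e _ _ => by split_ifs <;> norm_num)
            simp only [g, List.tail_cons, List.cons.injEq, and_true]
            split_ifs with h1 h2
            · rfl
            · obtain ⟨e', he', rfl⟩ := h1; exact absurd he' h2
            · norm_num
            · rfl
        _ ≤ b := by rw [Finset.sum_boole]; simpa using hB (hist σ t)
    rw [hsum] at hle
    have hle2 : ∑ σ : EdgeOrdering n, g (hist σ (t + 1)) ≤
        Fintype.card (EdgeOrdering n) * (b / (pairCount n - T)) := by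
      have h3 : ∑ σ : EdgeOrdering n, g (hist σ (t + 1)) ≤
          Fintype.card (EdgeOrdering n) * b / (pairCount n - t) := by
        rw [le_div_iff₀ hpos', mul_comm]; exact hle
      refine h3.trans ?_
      rw [mul_div_assoc]
      gcongr
    have := mul_pr_le_of_sum_le (a := 1)
      (A := fun σ => ∃ e ∈ B (hist σ t), hist σ (t + 1) = e :: hist σ t)
      (fun σ => by simp only [g]; split_ifs <;> norm_num) (fun σ hσ => ?_) hle2
    · simpa using this
    · obtain ⟨e, he, hh⟩ := hσ
      rw [hh]
      exact (if_pos ⟨e, he, rfl⟩ : g (e :: hist σ t) = 1).ge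
  calc _ ≤ Pr n (fun σ => ∃ t ∈ Finset.range T,
        ∃ e ∈ B (hist σ t), hist σ (t + 1) = e :: hist σ t) := by
        refine pr_mono ?_
        rintro σ ⟨t, ht, h⟩
        exact ⟨t, Finset.mem_range.2 ht, h⟩
    _ ≤ _ := pr_exists_le _ _
    _ ≤ _ := by
        refine (Finset.sum_le_sum h1).trans ?_
        rw [Finset.sum_const, Finset.card_range, nsmul_eq_mul]

/-- The maximal inequality for nonnegative supermartingales. -/
theorem mul_pr_exists_le {T : ℕ} (hT : T ≤ pairCount n) {f : List (Sym2 (Fin n)) → ℝ}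
    (hf : ∀ h, 0 ≤ f h)
    (hs : ∀ h, ValidHist h → h.length < T →
      ∑ e ∈ unused h, f (e :: h) ≤ ((pairCount n : ℝ) - h.length) * f h)
    {a : ℝ} (ha : 0 < a) :
    a * Pr n (fun σ => ∃ t ≤ T, a ≤ f (hist σ t)) ≤ f [] := by
  let g : List (Sym2 (Fin n)) → ℝ := fun h => if ∃ h', h' <:+ h ∧ a ≤ f h' then a else f h
  have hg0 : ∀ h, 0 ≤ g h := by
    intro h; simp only [g]; split_ifs
    · exact ha.le
    · exact hf h
  have hgf : ∀ h, (¬ ∃ h', h' <:+ h ∧ a ≤ f h') → ∀ e, g (e :: h) ≤ f (e :: h) := by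
    intro h hh e
    simp only [g]
    split_ifs with h1
    · obtain ⟨h', hsuf, hle⟩ := h1
      rcases List.suffix_cons_iff.1 hsuf with rfl | hsuf
      · exact hle
      · exact absurd ⟨h', hsuf, hle⟩ hh
    · exact le_rfl
  have hgs : ∀ h, ValidHist h → h.length < T →
      ∑ e ∈ unused h, g (e :: h) ≤ ((pairCount n : ℝ) - h.length) * g h := by
    intro h hv hlt
    by_cases hh : ∃ h', h' <:+ h ∧ a ≤ f h'
    · have h1 : g h = a := if_pos hh
      have h2 : ∀ e, g (e :: h) = a := by
        intro e
        obtain ⟨h', hsuf, hle⟩ := hh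
        exact if_pos ⟨h', hsuf.trans (List.suffix_cons _ _), hle⟩
      rw [h1, Finset.sum_congr rfl fun e _ => h2 e, Finset.sum_const, nsmul_eq_mul]
      have := card_unused_add hv
      have h3 : ((unused h).card : ℝ) = pairCount n - h.length := by
        rw [eq_sub_iff_add_eq]; exact_mod_cast this
      rw [h3]
    · have h1 : g h = f h := if_neg hh
      rw [h1]
      exact (Finset.sum_le_sum fun e _ => hgf h hh e).trans (hs h hv hlt)
  have hsum : ∀ t ≤ T, ∑ σ : EdgeOrdering n, g (hist σ t) ≤
      Fintype.card (EdgeOrdering n) * g [] := by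
    intro t
    induction t with
    | zero =>
      intro _
      simp [hist]
    | succ t ih =>
      intro ht
      have htN : t < pairCount n := by omega
      have hpos : (0 : ℝ) < pairCount n - t := by rw [sub_pos]; exact_mod_cast htN
      refine le_trans ?_ (ih (by omega))
      refine le_of_mul_le_mul_left ?_ hpos
      rw [← sum_hist_succ htN, Finset.mul_sum]
      refine Finset.sum_le_sum fun σ _ => ?_
      have hl := length_hist σ htN.le
      have := hgs (hist σ t) (validHist_hist σ htN.le) (by rw [hl]; omega)
      rwa [hl] at this
  have hnil : g [] ≤ f [] := by
    simp only [g]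
    split_ifs with h
    · obtain ⟨h', hsuf, hle⟩ := h
      rwa [List.suffix_nil.1 hsuf] at hle
    · exact le_rfl
  refine (mul_pr_le_of_sum_le (X := fun σ => g (hist σ T)) (fun σ => hg0 _) ?_
    (hsum T le_rfl)).trans hnil
  rintro σ ⟨t, ht, hle⟩
  exact (if_pos ⟨_, hist_suffix σ ht, hle⟩ : g (hist σ T) = a).ge

/-- The sum of `r` over the proper suffixes of a list. -/
def psum (r : List (Sym2 (Fin n)) → ℝ) : List (Sym2 (Fin n)) → ℝ
  | [] => 0
  | _ :: h => psum r h + r h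

theorem psum_hist (r : List (Sym2 (Fin n)) → ℝ) (σ : EdgeOrdering n) {t : ℕ}
    (ht : t ≤ pairCount n) : psum r (hist σ t) = ∑ s ∈ Finset.range t, r (hist σ s) := by
  induction t with
  | zero => rfl
  | succ t ih => rw [hist_succ σ ht, psum, ih (by omega), Finset.sum_range_succ]

/-- A maximal inequality for a process that decays at rate `r` while it is active. -/
theorem mul_pr_exists_exp_le {T : ℕ} (hT : T ≤ pairCount n) {F : List (Sym2 (Fin n)) → ℝ}
    (hF : ∀ h, 0 ≤ F h) (r : List (Sym2 (Fin n)) → ℝ) (active : List (Sym2 (Fin n)) → Prop)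
    (hs : ∀ h, ValidHist h → h.length < T → active h →
      ∑ e ∈ unused h, F (e :: h) ≤ ((pairCount n : ℝ) - h.length) * (Real.exp (-r h) * F h))
    {a : ℝ} (ha : 0 < a) :
    a * Pr n (fun σ => ∃ t ≤ T, (∀ s < t, active (hist σ s)) ∧
      a ≤ F (hist σ t) * Real.exp (∑ s ∈ Finset.range t, r (hist σ s))) ≤ F [] := by
  let f : List (Sym2 (Fin n)) → ℝ := fun h =>
    if ∀ h', h' <:+ h → h' ≠ h → active h' then F h * Real.exp (psum r h) else 0
  have hmain := mul_pr_exists_le hT (f := f) ?_ ?_ ha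
  · have hnil : f [] = F [] := by
      simp only [f]
      rw [if_pos (fun h' hs hne => absurd (List.suffix_nil.1 hs) hne)]
      simp [psum]
    rw [hnil] at hmain
    refine le_trans (mul_le_mul_of_nonneg_left (pr_mono ?_) ha.le) hmain
    rintro σ ⟨t, ht, hact, hle⟩
    refine ⟨t, ht, ?_⟩
    have htN := ht.trans hT
    simp only [f]
    rw [if_pos, psum_hist r σ htN]
    · exact hle
    · intro h' hsuf hne
      have hlen : h'.length < t := by
        have h1 := hsuf.length_le
        rw [length_hist σ htN] at h1
        refine lt_of_le_of_ne h1 fun h2 => hne (hsuf.eq_of_length ?_)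
        rw [h2, length_hist σ htN]
      have : h' = hist σ h'.length := by
        refine ((List.suffix_of_suffix_length_le hsuf (hist_suffix σ hlen.le) ?_).eq_of_length ?_)
        · rw [length_hist σ (by omega)]
        · rw [length_hist σ (by omega)]
      rw [this]
      exact hact _ hlen
  · intro h
    simp only [f]
    split_ifs
    · exact mul_nonneg (hF h) (Real.exp_pos _).le
    · exact le_rfl
  · intro h hv hlt
    by_cases hh : ∀ h', h' <:+ h → active h'
    · have h1 : f h = F h * Real.exp (psum r h) := if_pos fun h' hs _ => hh h' hs
      have h2 : ∀ e, f (e :: h) ≤ F (e :: h) * Real.exp (psum r h + r h) := by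
        intro e
        simp only [f, psum]
        split_ifs
        · exact le_rfl
        · exact mul_nonneg (hF _) (Real.exp_pos _).le
      rw [h1]
      refine (Finset.sum_le_sum fun e _ => h2 e).trans ?_
      rw [← Finset.sum_mul]
      refine (mul_le_mul_of_nonneg_right (hs h hv hlt (hh h List.suffix_rfl))
        (Real.exp_pos _).le).trans (le_of_eq ?_)
      have h3 : Real.exp (-r h) * Real.exp (psum r h + r h) = Real.exp (psum r h) := by
        rw [← Real.exp_add]; congr 1; ring
      calc _ = ((pairCount n : ℝ) - h.length) * (F h *
            (Real.exp (-r h) * Real.exp (psum r h + r h))) := by ring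
        _ = _ := by rw [h3]
    · have h2 : ∀ e, f (e :: h) = 0 := by
        intro e
        refine if_neg fun hall => hh fun h' hs => hall h' (hs.trans (List.suffix_cons _ _)) ?_
        intro heq
        have := hs.length_le
        rw [heq, List.length_cons] at this
        omega
      rw [Finset.sum_eq_zero fun e _ => h2 e]
      have hN : (h.length : ℝ) ≤ pairCount n := by exact_mod_cast length_le_pairCount hv
      refine mul_nonneg (by linarith) ?_
      simp only [f]
      split_ifs
      · exact mul_nonneg (hF h) (Real.exp_pos _).le
      · exact le_rfl

end Probability

/-! ### Exponential estimates -/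

section Estimates

variable {n : ℕ}

theorem gr_mono {h' h : List (Sym2 (Fin n))} (hs : h' <:+ h) : Gr h' ≤ Gr h := by
  induction h with
  | nil => rw [List.suffix_nil.1 hs]
  | cons e h ih =>
    rcases List.suffix_cons_iff.1 hs with rfl | hs
    · exact le_rfl
    · exact (ih hs).trans (le_addIf _ _)

theorem isKonig_gr (h : List (Sym2 (Fin n))) : IsKonig (Gr h) := by
  induction h with
  | nil => exact isKonig_bot
  | cons e h ih => exact ih.addIf e

theorem mem_of_gr_adj {h : List (Sym2 (Fin n))} {a b : Fin n} (hab : (Gr h).Adj a b) :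
    s(a, b) ∈ h := by
  induction h with
  | nil => exact absurd hab (by simp [Gr])
  | cons e h ih =>
    rcases adj_of_addIf_adj hab with h1 | h1
    · exact List.mem_cons_of_mem _ (ih h1)
    · rw [h1]; exact List.mem_cons_self

theorem pairCount_le (n : ℕ) : (pairCount n : ℝ) ≤ (n : ℝ) ^ 2 / 2 := by
  have h : pairCount n * 2 ≤ n * (n - 1) := Nat.div_mul_le_self _ _
  have h2 : n * (n - 1) ≤ n * n := Nat.mul_le_mul_left _ (Nat.sub_le _ _)
  have h3 : ((pairCount n * 2 : ℕ) : ℝ) ≤ ((n * n : ℕ) : ℝ) := by exact_mod_cast h.trans h2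
  push_cast at h3
  nlinarith

/-- Survival together with many offered edges from `P` is unlikely when the survival event `A`
is destroyed at rate at least `ρ`. -/
theorem pr_alive_le {T : ℕ} (hT : T < pairCount n) {A : List (Sym2 (Fin n)) → Prop}
    (hA : ∀ e h, A (e :: h) → A h) (P : Finset (Sym2 (Fin n))) {z : ℝ} (hz : 1 ≤ z)
    {ρ : List (Sym2 (Fin n)) → ℝ}
    (hρ : ∀ h, ValidHist h → h.length < T → A h →
      ρ h * ((n : ℝ) ^ 2 / 2) ≤ ((unused h).filter fun e => ¬ A (e :: h)).card)
    (m : ℕ) (ρ₀ : ℝ) :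
    Pr n (fun σ => ∃ t ≤ T, A (hist σ t) ∧ m ≤ (hist σ t).countP (· ∈ P) ∧
        ρ₀ ≤ ∑ s ∈ Finset.range t, ρ (hist σ s)) ≤
      Real.exp ((z - 1) * P.card * T / (pairCount n - T) - ρ₀) / z ^ m := by
  have hposT : (0 : ℝ) < pairCount n - T := by rw [sub_pos]; exact_mod_cast hT
  set g : ℝ := (z - 1) * P.card / (pairCount n - T) with hg
  have hg0 : 0 ≤ g := by
    have : 0 ≤ z - 1 := by linarith
    positivity
  have hz0 : 0 < z := by linarith
  let F : List (Sym2 (Fin n)) → ℝ := fun h => if A h then z ^ h.countP (· ∈ P) else 0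
  have hF : ∀ h, 0 ≤ F h := by
    intro h; simp only [F]; split_ifs <;> positivity
  have key := mul_pr_exists_exp_le (T := T) hT.le hF (fun h => ρ h - g) (fun _ => True) ?_
    (a := z ^ m * Real.exp (ρ₀ - g * T)) (by positivity)
  · have hnil : F [] ≤ 1 := by simp only [F]; split_ifs <;> simp
    have ha : (0 : ℝ) < z ^ m * Real.exp (ρ₀ - g * T) := by positivity
    have hexp : Real.exp ((z - 1) * P.card * T / (pairCount n - T) - ρ₀) / z ^ m =
        1 / (z ^ m * Real.exp (ρ₀ - g * T)) := by
      rw [one_div, mul_inv, ← Real.exp_neg, div_eq_mul_inv, mul_comm]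
      congr 2
      rw [hg]; ring
    rw [hexp, le_div_iff₀ ha, mul_comm]
    refine (mul_le_mul_of_nonneg_left (pr_mono ?_) ha.le).trans (key.trans hnil)
    rintro σ ⟨t, ht, h1, h2, h3⟩
    refine ⟨t, ht, fun _ _ => trivial, ?_⟩
    have hFt : F (hist σ t) = z ^ (hist σ t).countP (· ∈ P) := if_pos h1
    rw [hFt]
    refine mul_le_mul (pow_le_pow_right₀ hz h2) (Real.exp_le_exp.2 ?_) (Real.exp_pos _).le
      (by positivity)
    rw [Finset.sum_sub_distrib, Finset.sum_const, Finset.card_range, nsmul_eq_mul]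
    have : (t : ℝ) ≤ T := by exact_mod_cast ht
    nlinarith
  · intro h hv hlt _
    have hposh : (0 : ℝ) < pairCount n - h.length := by
      have : (h.length : ℝ) < T := by exact_mod_cast hlt
      linarith
    have hlen : (h.length : ℝ) < T := by exact_mod_cast hlt
    by_cases hAh : A h
    · have hFh : F h = z ^ h.countP (· ∈ P) := if_pos hAh
      have hFh0 : 0 ≤ F h := hF h
      set Kl := (unused h).filter fun e => ¬ A (e :: h) with hKl
      have h1 : ∀ e ∈ unused h, F (e :: h) ≤
          F h * (1 + (if e ∈ P then (z - 1) else 0) - (if ¬ A (e :: h) then 1 else 0)) := by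
        intro e _
        by_cases hAe : A (e :: h)
        · have : F (e :: h) = z ^ (e :: h).countP (· ∈ P) := if_pos hAe
          have h0 : (if ¬ A (e :: h) then (1 : ℝ) else 0) = 0 := if_neg (not_not.2 hAe)
          rw [this, h0, List.countP_cons, hFh]
          by_cases heP : e ∈ P
          · simp only [heP, decide_true, if_true, pow_succ]
            linarith
          · simp [heP]
        · have : F (e :: h) = 0 := if_neg hAe
          rw [this, if_pos hAe]
          refine mul_nonneg hFh0 ?_
          split_ifs <;> linarith
      have hcard : ((unused h).card : ℝ) = pairCount n - h.length := by
        rw [eq_sub_iff_add_eq]; exact_mod_cast card_unused_add hv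
      calc ∑ e ∈ unused h, F (e :: h) ≤ F h * ∑ e ∈ unused h,
            (1 + (if e ∈ P then (z - 1) else 0) - (if ¬ A (e :: h) then 1 else 0)) := by
            rw [Finset.mul_sum]; exact Finset.sum_le_sum h1
        _ ≤ F h * ((pairCount n - h.length) + (z - 1) * P.card - Kl.card) := by
            refine mul_le_mul_of_nonneg_left ?_ hFh0
            rw [Finset.sum_sub_distrib, Finset.sum_add_distrib, Finset.sum_boole,
              Finset.sum_const, nsmul_eq_mul, mul_one, hcard, ← Finset.sum_filter,
              Finset.sum_const, nsmul_eq_mul]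
            have h2 : (((unused h).filter (· ∈ P)).card : ℝ) ≤ P.card := by
              exact_mod_cast Finset.card_le_card fun e he => (Finset.mem_filter.1 he).2
            have h3 : 0 ≤ z - 1 := by linarith
            have h4 : (((unused h).filter (· ∈ P)).card : ℝ) * (z - 1) ≤ (z - 1) * P.card := by
              rw [mul_comm]; exact mul_le_mul_of_nonneg_left h2 h3
            linarith
        _ ≤ F h * ((pairCount n - h.length) * Real.exp (-(ρ h - g))) := by
            refine mul_le_mul_of_nonneg_left ?_ hFh0
            have h5 : ρ h ≤ Kl.card / (pairCount n - h.length) := by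
              by_cases hρ0 : ρ h ≤ 0
              · exact hρ0.trans (by positivity)
              · rw [le_div_iff₀ hposh]
                refine le_trans ?_ (hρ h hv hlt hAh)
                push Not at hρ0
                refine mul_le_mul_of_nonneg_left ?_ hρ0.le
                have := pairCount_le n
                have : (0 : ℝ) ≤ h.length := by positivity
                linarith
            have h6 : (z - 1) * P.card / (pairCount n - h.length) ≤ g := by
              have h3 : 0 ≤ z - 1 := by linarith
              rw [hg]
              gcongr
            have h7 : -(ρ h - g) + 1 ≤ Real.exp (-(ρ h - g)) := Real.add_one_le_exp _
            have h8 : (pairCount n - h.length) + (z - 1) * P.card - Kl.card =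
                (pairCount n - h.length) * (1 + (z - 1) * P.card / (pairCount n - h.length) -
                  Kl.card / (pairCount n - h.length)) := by
              field_simp
            rw [h8]
            refine mul_le_mul_of_nonneg_left ?_ hposh.le
            linarith
        _ = _ := by ring
    · have h2 : ∀ e, F (e :: h) = 0 := fun e => if_neg fun h' => hAh (hA e h h')
      rw [Finset.sum_eq_zero fun e _ => h2 e]
      have := hF h
      positivity

/-! #### Few steps with many co-missed pairs -/

theorem card_le_two_mul_card_image (s : Finset (Fin n × Fin n)) :
    s.card ≤ 2 * (s.image fun p => s(p.1, p.2)).card := by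
  refine Finset.card_le_mul_card_image s 2 fun e _ => ?_
  induction e with
  | _ a b =>
    refine (Finset.card_le_card (t := {(a, b), (b, a)}) ?_).trans Finset.card_le_two
    intro p hp
    rcases Sym2.eq_iff.1 (Finset.mem_filter.1 hp).2 with ⟨h1, h2⟩ | ⟨h1, h2⟩
    · simp [Prod.ext_iff, h1, h2]
    · simp [Prod.ext_iff, h1, h2]

/-- Ordered pairs whose edge has a property give many unused edges with that property. -/
theorem card_pairs_le {h : List (Sym2 (Fin n))} {s : Finset (Fin n × Fin n)}
    {p : Sym2 (Fin n) → Prop} (hs : ∀ q ∈ s, q.1 ≠ q.2 ∧ p s(q.1, q.2)) :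
    (s.card : ℝ) / 2 - h.length ≤ ((unused h).filter p).card := by
  have h1 := card_le_two_mul_card_image s
  have h2 : (s.image fun q => s(q.1, q.2)) ⊆ (unused h).filter p ∪ h.toFinset := by
    intro e he
    obtain ⟨q, hq, rfl⟩ := Finset.mem_image.1 he
    by_cases heh : s(q.1, q.2) ∈ h
    · exact Finset.mem_union_right _ (List.mem_toFinset.2 heh)
    · refine Finset.mem_union_left _ (Finset.mem_filter.2 ⟨mem_unused.2 ⟨?_, heh⟩, (hs q hq).2⟩)
      simpa using (hs q hq).1
  have h3 := (Finset.card_le_card h2).trans (Finset.card_union_le _ _)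
  have h4 := List.toFinset_card_le h
  have h5 : s.card ≤ 2 * (((unused h).filter p).card + h.length) := by omega
  have h6 : (s.card : ℝ) ≤ 2 * (((unused h).filter p).card + h.length) := by exact_mod_cast h5
  linarith

/-- At least a `κ`-fraction of the pairs is co-missed. -/
def ManyCoPairs (κ : ℝ) (h : List (Sym2 (Fin n))) : Prop :=
  κ * (n : ℝ) ^ 2 ≤ (coPairs (Gr h)).card

theorem two_mul_matchNum_le (G : SimpleGraph (Fin n)) : 2 * matchNum G ≤ n := by
  have := card_isolated_add_le G; omega

theorem pr_manyCoPairs_le {T : ℕ} (hT : T < pairCount n) {κ : ℝ} (hκ : 0 < κ)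
    (hTκ : (T : ℝ) ≤ κ * (n : ℝ) ^ 2 / 4) :
    Pr n (fun σ => 8 / κ * n ≤ ((Finset.range T).filter fun s =>
      ManyCoPairs κ (hist σ s)).card) ≤ Real.exp (-n) := by
  have key := mul_pr_exists_exp_le (T := T) hT.le
    (F := fun h => Real.exp (-(matchNum (Gr h) : ℝ))) (fun h => (Real.exp_pos _).le)
    (fun h => if ManyCoPairs κ h then κ / 4 else 0) (fun _ => True) ?_
    (a := Real.exp n) (Real.exp_pos _)
  · rw [Real.exp_neg, ← one_div, le_div_iff₀ (Real.exp_pos _), mul_comm]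
    refine (mul_le_mul_of_nonneg_left (pr_mono ?_) (Real.exp_pos _).le).trans
      (key.trans (Real.exp_le_one_iff.2 (by simp)))
    intro σ hσ
    refine ⟨T, le_rfl, fun _ _ => trivial, ?_⟩
    rw [← Real.exp_add, Real.exp_le_exp, ← Finset.sum_filter, Finset.sum_const, nsmul_eq_mul]
    have h1 : (matchNum (Gr (hist σ T)) : ℝ) ≤ n := by
      have := two_mul_matchNum_le (Gr (hist σ T))
      exact_mod_cast (by omega : matchNum (Gr (hist σ T)) ≤ n)
    have h2 := mul_le_mul_of_nonneg_right hσ (by positivity : 0 ≤ κ / 4)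
    have h3 : 8 / κ * n * (κ / 4) = 2 * n := by field_simp; ring
    linarith
  · intro h hv hlt _
    have hcard : ((unused h).card : ℝ) = pairCount n - h.length := by
      rw [eq_sub_iff_add_eq]; exact_mod_cast card_unused_add hv
    have hlen : (h.length : ℝ) < T := by exact_mod_cast hlt
    have hN : (T : ℝ) < pairCount n := by exact_mod_cast hT
    have hpos : (0 : ℝ) < pairCount n - h.length := by linarith
    have hup : ∀ e, Real.exp (-(matchNum (Gr (e :: h)) : ℝ)) ≤
        Real.exp (-(matchNum (Gr h) : ℝ)) := by
      intro e
      rw [Real.exp_le_exp, neg_le_neg_iff]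
      exact_mod_cast matchNum_mono (le_addIf (Gr h) e)
    split_ifs with hbad
    · let p : Sym2 (Fin n) → Prop := fun e => matchNum (Gr h) + 1 ≤ matchNum (Gr (e :: h))
      have hp : (pairCount n - h.length) * (κ / 2) ≤ (((unused h).filter p).card : ℝ) := by
        have h1 := card_pairs_le (h := h) (s := coPairs (Gr h)) (p := p) (fun q hq => by
          obtain ⟨h1, h2⟩ := (Finset.mem_filter.1 hq).2
          exact ⟨h1, matchNum_addIf_of_coMissed (isKonig_gr h) h1 h2⟩)
        have h2 := pairCount_le n
        have h3 : (0 : ℝ) ≤ h.length := by positivity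
        have h4 : κ * (n : ℝ) ^ 2 ≤ (coPairs (Gr h)).card := hbad
        have h5 : (pairCount n - h.length) * (κ / 2) ≤ ((n : ℝ) ^ 2 / 2) * (κ / 2) :=
          mul_le_mul_of_nonneg_right (by linarith) (by positivity)
        refine le_trans ?_ (h1.trans (le_of_eq (by congr)))
        linarith
      have he : Real.exp (-1) ≤ 1 / 2 := by
        rw [Real.exp_neg, ← one_div]
        have := Real.add_one_le_exp (1 : ℝ)
        exact one_div_le_one_div_of_le (by norm_num) (by linarith)
      calc ∑ e ∈ unused h, Real.exp (-(matchNum (Gr (e :: h)) : ℝ))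
          ≤ ∑ e ∈ unused h, Real.exp (-(matchNum (Gr h) : ℝ)) *
              (1 - (if p e then 1 / 2 else 0)) := by
            refine Finset.sum_le_sum fun e _ => ?_
            split_ifs with hpe
            · have : -(matchNum (Gr (e :: h)) : ℝ) ≤ -(matchNum (Gr h) : ℝ) + (-1) := by
                have : ((matchNum (Gr h) + 1 : ℕ) : ℝ) ≤ matchNum (Gr (e :: h)) := by
                  exact_mod_cast hpe
                push_cast at this
                linarith
              refine (Real.exp_le_exp.2 this).trans ?_
              rw [Real.exp_add]
              exact mul_le_mul_of_nonneg_left (by linarith) (Real.exp_pos _).le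
            · simpa using hup e
        _ = Real.exp (-(matchNum (Gr h) : ℝ)) *
              ((pairCount n - h.length) - ((unused h).filter p).card / 2) := by
            rw [← Finset.mul_sum, Finset.sum_sub_distrib, Finset.sum_const, nsmul_eq_mul,
              hcard, ← Finset.sum_filter, Finset.sum_const, nsmul_eq_mul]
            ring
        _ ≤ Real.exp (-(matchNum (Gr h) : ℝ)) *
              ((pairCount n - h.length) * Real.exp (-(κ / 4))) := by
            refine mul_le_mul_of_nonneg_left ?_ (Real.exp_pos _).le
            have := mul_le_mul_of_nonneg_left (Real.add_one_le_exp (-(κ / 4))) hpos.le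
            linarith
        _ = _ := by ring
    · refine (Finset.sum_le_sum fun e _ => hup e).trans ?_
      rw [Finset.sum_const, nsmul_eq_mul, hcard]
      simp

/-! #### Few steps with few uncovered vertices -/

/-- Fewer than `(1/2 - ε) n` vertices avoid all minimum covers. -/
def FewUncovered (ε : ℝ) (h : List (Sym2 (Fin n))) : Prop :=
  ((uncovered (Gr h)).card : ℝ) < (1 / 2 - ε) * n

theorem pr_fewUncovered_le {T : ℕ} (hT : T < pairCount n) {ε : ℝ} (hε : 0 < ε)
    (hTε : (T : ℝ) + ε * n / 2 ≤ ε ^ 2 * (n : ℝ) ^ 2 / 4) :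
    Pr n (fun σ => 2 / ε ^ 2 * n ≤ ((Finset.range T).filter fun s =>
      FewUncovered ε (hist σ s)).card) ≤ 2 ^ n * Real.exp (-n) := by
  let A : Finset (Fin n) → List (Sym2 (Fin n)) → Prop := fun S h =>
    ∀ x ∈ S, ∀ y ∈ S, ¬ (Gr h).Adj x y
  let ρ : List (Sym2 (Fin n)) → ℝ := fun h => if FewUncovered ε h then ε ^ 2 / 2 else 0
  have hone : ∀ S ∈ Finset.univ.filter fun S : Finset (Fin n) => (n : ℝ) / 2 ≤ S.card,
      Pr n (fun σ => ∃ t ≤ T, A S (hist σ t) ∧ 0 ≤ (hist σ t).countP (· ∈ (∅ : Finset _)) ∧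
        (n : ℝ) ≤ ∑ s ∈ Finset.range t, ρ (hist σ s)) ≤ Real.exp (-n) := by
    intro S hS
    have hS := (Finset.mem_filter.1 hS).2
    have := pr_alive_le hT (A := A S) (fun e h hA x hx y hy hadj => hA x hx y hy
      (le_addIf _ _ hadj)) ∅ (z := 1) le_rfl (ρ := ρ) ?_ 0 n
    · simpa using this
    · intro h hv hlt hA
      simp only [ρ]
      split_ifs with hbad
      · have hsd : ε * n ≤ (S \ uncovered (Gr h)).card := by
          have h1 := Finset.le_card_sdiff (uncovered (Gr h)) S
          have h2 : (S.card : ℝ) ≤ (S \ uncovered (Gr h)).card + (uncovered (Gr h)).card := by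
            exact_mod_cast (by omega : S.card ≤
              (S \ uncovered (Gr h)).card + (uncovered (Gr h)).card)
          have h3 : ((uncovered (Gr h)).card : ℝ) < (1 / 2 - ε) * n := hbad
          linarith
        have h1 := card_pairs_le (h := h) (s := (S \ uncovered (Gr h)).offDiag)
          (p := fun e => ¬ A S (e :: h)) (fun q hq => by
            obtain ⟨h1, h2, h3⟩ := Finset.mem_offDiag.1 hq
            refine ⟨h3, fun hcon => hcon q.1 (Finset.mem_sdiff.1 h1).1 q.2
              (Finset.mem_sdiff.1 h2).1 ?_⟩
            exact addIf_adj_of_notMem_uncovered (isKonig_gr h) h3 (Finset.mem_sdiff.1 h2).2)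
        refine le_trans ?_ (h1.trans (le_of_eq (by congr)))
        have h2 : (((S \ uncovered (Gr h)).offDiag.card : ℕ) : ℝ) =
            ((S \ uncovered (Gr h)).card : ℝ) * (S \ uncovered (Gr h)).card -
              (S \ uncovered (Gr h)).card := by
          rw [Finset.offDiag_card, Nat.cast_sub (Nat.le_mul_self _)]
          push_cast; ring
        rw [h2]
        have hlen : (h.length : ℝ) < T := by exact_mod_cast hlt
        have hcardpos : 1 ≤ ((S \ uncovered (Gr h)).card : ℝ) := by
          have hTpos : (0 : ℝ) < T := lt_of_le_of_lt (by positivity) hlen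
          have hn0 : n ≠ 0 := by
            rintro rfl
            simp at hTε
            linarith
          have : (0 : ℝ) < (S \ uncovered (Gr h)).card := lt_of_lt_of_le (by positivity) hsd
          exact_mod_cast this
        have hεn : 0 ≤ ε * n := by positivity
        nlinarith [mul_nonneg (sub_nonneg.2 hsd) (sub_nonneg.2 hcardpos),
          mul_nonneg (sub_nonneg.2 hsd) hεn]
      · simp
  have hunion := pr_exists_le (Finset.univ.filter fun S : Finset (Fin n) => (n : ℝ) / 2 ≤ S.card)
    (fun S σ => ∃ t ≤ T, A S (hist σ t) ∧ 0 ≤ (hist σ t).countP (· ∈ (∅ : Finset _)) ∧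
        (n : ℝ) ≤ ∑ s ∈ Finset.range t, ρ (hist σ s))
  refine le_trans (pr_mono ?_) (hunion.trans ((Finset.sum_le_sum hone).trans ?_))
  · intro σ hσ
    obtain ⟨C, hC⟩ := exists_isMinCover (Gr (hist σ T))
    refine ⟨Cᶜ, Finset.mem_filter.2 ⟨Finset.mem_univ _, ?_⟩, T, le_rfl, ?_, Nat.zero_le _, ?_⟩
    · have h1 := Finset.card_add_card_compl C
      rw [Fintype.card_fin, hC.2, ← isKonig_gr (hist σ T)] at h1
      have h2 := two_mul_matchNum_le (Gr (hist σ T))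
      have h3 : (n : ℝ) ≤ 2 * (Cᶜ.card : ℝ) := by
        exact_mod_cast (by omega : n ≤ 2 * Cᶜ.card)
      linarith
    · intro x hx y hy hadj
      rcases isVertexCover_iff.1 hC.1 x y hadj with h | h
      · exact (Finset.mem_compl.1 hx) h
      · exact (Finset.mem_compl.1 hy) h
    · simp only [ρ]
      rw [← Finset.sum_filter, Finset.sum_const, nsmul_eq_mul]
      have := mul_le_mul_of_nonneg_right hσ (by positivity : 0 ≤ ε ^ 2 / 2)
      refine le_trans (le_of_eq ?_) this
      field_simp
  · rw [Finset.sum_const, nsmul_eq_mul]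
    refine mul_le_mul_of_nonneg_right ?_ (Real.exp_pos _).le
    have := Finset.card_le_univ (Finset.univ.filter fun S : Finset (Fin n) =>
      (n : ℝ) / 2 ≤ S.card)
    rw [Fintype.card_finset, Fintype.card_fin] at this
    exact_mod_cast this

/-! #### Degrees -/

/-- The number of offered edges at `x`. -/
def offeredDeg (h : List (Sym2 (Fin n))) (x : Fin n) : ℕ := h.countP (x ∈ ·)

theorem pr_offeredDeg_le {T : ℕ} (hT : T < pairCount n) (m : ℕ) :
    Pr n (fun σ => ∃ x, ∃ t ≤ T, m ≤ offeredDeg (hist σ t) x) ≤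
      n * (Real.exp (2 * n * T / (pairCount n - T)) / Real.exp 1 ^ m) := by
  have hposT : (0 : ℝ) < pairCount n - T := by rw [sub_pos]; exact_mod_cast hT
  have hone : ∀ x ∈ (Finset.univ : Finset (Fin n)),
      Pr n (fun σ => ∃ t ≤ T, m ≤ offeredDeg (hist σ t) x) ≤
        Real.exp (2 * n * T / (pairCount n - T)) / Real.exp 1 ^ m := by
    intro x _
    have := pr_alive_le hT (A := fun _ => True) (fun _ _ _ => trivial)
      (Finset.univ.filter fun e : Sym2 (Fin n) => x ∈ e) (z := Real.exp 1)
      (Real.one_le_exp zero_le_one) (ρ := fun _ => 0) (fun h _ _ _ => by simp) m 0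
    refine le_trans (pr_mono ?_) (this.trans ?_)
    · rintro σ ⟨t, ht, h⟩
      refine ⟨t, ht, trivial, ?_, by simp⟩
      simpa [offeredDeg] using h
    · gcongr
      rw [sub_zero]
      have h1 : ((Finset.univ.filter fun e : Sym2 (Fin n) => x ∈ e).card : ℝ) ≤ n := by
        have : (Finset.univ.filter fun e : Sym2 (Fin n) => x ∈ e) ⊆
            Finset.univ.image fun y => s(x, y) := by
          intro e he
          obtain ⟨y, rfl⟩ := (Finset.mem_filter.1 he).2
          exact Finset.mem_image_of_mem _ (Finset.mem_univ _)
        have := (Finset.card_le_card this).trans Finset.card_image_le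
        rw [Finset.card_univ, Fintype.card_fin] at this
        exact_mod_cast this
      have h2 : Real.exp 1 - 1 ≤ 2 := by
        have := Real.exp_one_lt_d9; linarith
      gcongr
  have hunion := pr_exists_le Finset.univ (fun (x : Fin n) (σ : EdgeOrdering n) =>
    ∃ t ≤ T, m ≤ offeredDeg (hist σ t) x)
  refine le_trans (pr_mono ?_) (hunion.trans ((Finset.sum_le_sum hone).trans ?_))
  · rintro σ ⟨x, h⟩; exact ⟨x, Finset.mem_univ _, h⟩
  · rw [Finset.sum_const, nsmul_eq_mul, Finset.card_univ, Fintype.card_fin]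

end Estimates

/-! ### Sets of vertices whose neighbourhood stays small -/

section Escape

variable {n : ℕ}

/-- Up to time `H`, all neighbours of `X` lie in `W`. -/
def NoEsc (X W : Finset (Fin n)) (H : ℕ) (h : List (Sym2 (Fin n))) : Prop :=
  ∀ h', h' <:+ h → h'.length ≤ H → ∀ x ∈ X, ∀ y, (Gr h').Adj x y → y ∈ W

theorem NoEsc.of_cons {X W : Finset (Fin n)} {H : ℕ} {e : Sym2 (Fin n)}
    {h : List (Sym2 (Fin n))} (hh : NoEsc X W H (e :: h)) : NoEsc X W H h :=
  fun h' hs => hh h' (hs.trans (List.suffix_cons _ _))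

theorem noEsc_of_forall_adj {X W : Finset (Fin n)} {H : ℕ} {h : List (Sym2 (Fin n))}
    (hh : ∀ x ∈ X, ∀ y, (Gr h).Adj x y → y ∈ W) : NoEsc X W H h :=
  fun _ hs _ x hx y hxy => hh x hx y (gr_mono hs hxy)

/-- The edges between `X` and `Y`. -/
def between (X Y : Finset (Fin n)) : Finset (Sym2 (Fin n)) :=
  (X ×ˢ Y).image fun q => s(q.1, q.2)

theorem card_between_le (X Y : Finset (Fin n)) : (between X Y).card ≤ X.card * Y.card :=
  Finset.card_image_le.trans (Finset.card_product _ _).le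

theorem injOn_mk_of_disjoint {X Y : Finset (Fin n)} (hXY : Disjoint X Y) :
    Set.InjOn (fun q : Fin n × Fin n => s(q.1, q.2)) (X ×ˢ Y : Finset (Fin n × Fin n)) := by
  rintro ⟨a, b⟩ hab ⟨c, d⟩ hcd heq
  have hab := Finset.mem_product.1 hab
  have hcd := Finset.mem_product.1 hcd
  rcases Sym2.eq_iff.1 heq with ⟨h1, h2⟩ | ⟨h1, h2⟩
  · exact Prod.ext h1 h2
  · exact absurd hcd.2 (Finset.disjoint_left.1 hXY (h1 ▸ hab.1))

theorem card_between {X Y : Finset (Fin n)} (hXY : Disjoint X Y) :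
    (between X Y).card = X.card * Y.card := by
  rw [between, Finset.card_image_of_injOn (injOn_mk_of_disjoint hXY), Finset.card_product]

theorem card_le_countP {h : List (Sym2 (Fin n))} {P S : Finset (Sym2 (Fin n))}
    (hS : ∀ e ∈ S, e ∈ h ∧ e ∈ P) : S.card ≤ h.countP (· ∈ P) := by
  rw [List.countP_eq_length_filter]
  refine le_trans (Finset.card_le_card fun e he => ?_) (List.toFinset_card_le _)
  rw [List.mem_toFinset, List.mem_filter]
  exact ⟨(hS e he).1, by simpa using (hS e he).2⟩

/-- If all edges between `X` and `Y` would be accepted, most of them destroy `NoEsc`. -/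
theorem card_mul_card_le_of_accepted {X W Y : Finset (Fin n)} {H : ℕ}
    {h : List (Sym2 (Fin n))} (hH : h.length < H) (hXY : Disjoint X Y) (hYW : Disjoint Y W)
    (hacc : ∀ x ∈ X, ∀ y ∈ Y, (addIf (Gr h) s(x, y)).Adj x y) {D : ℝ}
    (hD : ∀ x, (offeredDeg h x : ℝ) ≤ D) :
    (X.card : ℝ) * (Y.card - D) ≤ ((unused h).filter fun e => ¬ NoEsc X W H (e :: h)).card := by
  have hsub : between X Y ⊆ ((unused h).filter fun e => ¬ NoEsc X W H (e :: h)) ∪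
      X.biUnion fun x => h.toFinset.filter fun e => x ∈ e := by
    intro e he
    obtain ⟨⟨x, y⟩, hq, rfl⟩ := Finset.mem_image.1 he
    obtain ⟨hx, hy⟩ := Finset.mem_product.1 hq
    by_cases heh : s(x, y) ∈ h
    · exact Finset.mem_union_right _ (Finset.mem_biUnion.2 ⟨x, hx, Finset.mem_filter.2
        ⟨List.mem_toFinset.2 heh, Sym2.mem_mk_left x y⟩⟩)
    · refine Finset.mem_union_left _ (Finset.mem_filter.2 ⟨mem_unused.2 ⟨?_, heh⟩, fun hno => ?_⟩)
      · simpa using fun hxy : x = y => Finset.disjoint_left.1 hXY hx (hxy ▸ hy)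
      · exact Finset.disjoint_left.1 hYW hy
          (hno _ List.suffix_rfl (by simpa using hH) x hx y (hacc x hx y hy))
  have h1 := (Finset.card_le_card hsub).trans (Finset.card_union_le _ _)
  have h2 : ((X.biUnion fun x => h.toFinset.filter fun e => x ∈ e).card : ℝ) ≤ X.card * D := by
    have h3 : (X.biUnion fun x => h.toFinset.filter fun e => x ∈ e).card ≤
        ∑ x ∈ X, offeredDeg h x := by
      refine Finset.card_biUnion_le.trans (Finset.sum_le_sum fun x _ => ?_)
      have := card_le_countP (h := h) (P := Finset.univ.filter fun e => x ∈ e)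
        (S := h.toFinset.filter fun e => x ∈ e) (fun e he => by
          obtain ⟨h1, h2⟩ := Finset.mem_filter.1 he
          exact ⟨List.mem_toFinset.1 h1, by simpa using h2⟩)
      simpa [offeredDeg] using this
    calc _ ≤ ((∑ x ∈ X, offeredDeg h x : ℕ) : ℝ) := by exact_mod_cast h3
      _ ≤ ∑ x ∈ X, D := by push_cast; exact Finset.sum_le_sum fun x _ => hD x
      _ = X.card * D := by rw [Finset.sum_const, nsmul_eq_mul]
  rw [card_between hXY] at h1
  have h4 : (X.card : ℝ) * Y.card ≤
      ((unused h).filter fun e => ¬ NoEsc X W H (e :: h)).card +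
        (X.biUnion fun x => h.toFinset.filter fun e => x ∈ e).card := by exact_mod_cast h1
  linarith

/-- The maximum matching is nearly perfect and no vertex has been offered too many edges. -/
def Nice (D : ℝ) (h : List (Sym2 (Fin n))) : Prop :=
  (n : ℝ) - 2 * matchNum (Gr h) ≤ 2 / 1000 * n ∧ ∀ x, (offeredDeg h x : ℝ) ≤ D

theorem Nice.mul_le_card {D : ℝ} {h : List (Sym2 (Fin n))} (hN : Nice D h)
    (hD : D ≤ 6 / 1000 * n) {X W : Finset (Fin n)} (hXW : (X.card : ℝ) + W.card ≤ 3 / 1000 * n)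
    {H : ℕ} (hH : h.length < H) :
    (98 / 100 * X.card / n) * ((n : ℝ) ^ 2 / 2) ≤
      ((unused h).filter fun e => ¬ NoEsc X W H (e :: h)).card := by
  set Y := ((uncovered (Gr h) ∪ X) ∪ W)ᶜ with hY
  have hXY : Disjoint X Y := by
    rw [Finset.disjoint_left]; intro x hx hy
    simp [hY, hx] at hy
  have hYW : Disjoint Y W := by
    rw [Finset.disjoint_left]; intro x hx hy
    simp [hY, hy] at hx
  have hmain := card_mul_card_le_of_accepted hH hXY hYW (fun x hx y hy => by
    refine addIf_adj_of_notMem_uncovered (isKonig_gr h) ?_ ?_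
    · rintro rfl; exact Finset.disjoint_left.1 hXY hx hy
    · intro hu; simp [hY, hu] at hy) hN.2
  have hYcard : (matchNum (Gr h) : ℝ) - 3 / 1000 * n ≤ Y.card := by
    have h1 := Finset.card_add_card_compl ((uncovered (Gr h) ∪ X) ∪ W)
    rw [Fintype.card_fin, ← hY] at h1
    have h2 := Finset.card_union_le (uncovered (Gr h) ∪ X) W
    have h3 := Finset.card_union_le (uncovered (Gr h)) X
    have h4 := card_uncovered_add_le (isKonig_gr h)
    have h5 : (matchNum (Gr h) : ℝ) ≤ X.card + W.card + Y.card := by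
      exact_mod_cast (by omega : matchNum (Gr h) ≤ X.card + W.card + Y.card)
    linarith
  refine le_trans ?_ hmain
  have h1 := hN.1
  have hX : (0 : ℝ) ≤ X.card := by positivity
  have h2 : 49 / 100 * (n : ℝ) ≤ Y.card - D := by linarith
  refine le_trans (le_of_eq ?_) (mul_le_mul_of_nonneg_left h2 hX)
  rcases eq_or_ne (n : ℝ) 0 with h0 | h0
  · rw [h0]; simp
  · field_simp; ring

theorem pr_noEsc_le {T : ℕ} (hT : T < pairCount n) {D : ℝ} (hD : D ≤ 6 / 1000 * n)
    {X W : Finset (Fin n)} (hXW : (X.card : ℝ) + W.card ≤ 3 / 1000 * n) (H : ℕ) {z : ℝ}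
    (hz : 1 ≤ z) (m : ℕ) (ρ₀ : ℝ) :
    Pr n (fun σ => ∃ t ≤ T, NoEsc X W H (hist σ t) ∧ m ≤ (hist σ t).countP (· ∈ between X W) ∧
        ρ₀ ≤ ∑ s ∈ Finset.range t, if (hist σ s).length < H ∧ Nice D (hist σ s) then
          98 / 100 * (X.card : ℝ) / n else 0) ≤
      Real.exp ((z - 1) * (X.card * W.card) * T / (pairCount n - T) - ρ₀) / z ^ m := by
  have hposT : (0 : ℝ) < pairCount n - T := by rw [sub_pos]; exact_mod_cast hT
  refine (pr_alive_le hT (A := NoEsc X W H) (fun e h => NoEsc.of_cons) (between X W) hz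
    (ρ := fun h => if h.length < H ∧ Nice D h then 98 / 100 * (X.card : ℝ) / n else 0)
    (fun h _ _ _ => ?_) m ρ₀).trans ?_
  · split_ifs with hc
    · convert hc.2.mul_le_card hD hXW hc.1
    · simp
  · have h1 : ((between X W).card : ℝ) ≤ X.card * W.card := by
      exact_mod_cast card_between_le X W
    have h2 : 0 ≤ z - 1 := by linarith
    gcongr

/-- Rate at which a pair of vertices with common neighbour `w` ceases to be a cherry. -/
def cherryRate (D : ℝ) (T₀ : ℕ) (x x' w : Fin n) (h : List (Sym2 (Fin n))) : ℝ :=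
  if h.length < T₀ then (if Nice D h then 98 / 100 * 2 / n else 0)
  else if Nice D h ∧ IsCherry (Gr h) x x' w then
    4 / n * (1 - (rigid (Gr h)).card / n - 1 / 100) else 0

theorem IsCherry.mul_le_card {h : List (Sym2 (Fin n))} {x x' w : Fin n}
    (hc : IsCherry (Gr h) x x' w) {D : ℝ} (hN : Nice D h) (hD : D ≤ 6 / 1000 * n)
    (hn : 1000 ≤ n) {T : ℕ} (hT : h.length < T) :
    4 / n * (1 - (rigid (Gr h)).card / n - 1 / 100) * ((n : ℝ) ^ 2 / 2) ≤
      ((unused h).filter fun e => ¬ NoEsc {x, x'} {w} T (e :: h)).card := by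
  set Y := (rigid (Gr h) ∪ {x, x', w})ᶜ with hY
  have hmem : ∀ y ∈ Y, y ∉ rigid (Gr h) ∧ y ≠ x ∧ y ≠ x' ∧ y ≠ w := by
    intro y hy
    have hy' : ¬ y = x ∧ ¬ y = x' ∧ ¬ y = w ∧ y ∉ rigid (Gr h) := by
      simpa [hY, not_or] using hy
    tauto
  have hXY : Disjoint {x, x'} Y := by
    rw [Finset.disjoint_left]; intro y hy hy'
    have := hmem y hy'
    simp at hy
    tauto
  have hYW : Disjoint Y {w} := by
    rw [Finset.disjoint_left]; intro y hy hy'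
    exact (hmem y hy).2.2.2 (Finset.mem_singleton.1 hy')
  have hmain := card_mul_card_le_of_accepted hT hXY hYW (fun a ha y hy => by
    obtain ⟨h1, h2, h3, -⟩ := hmem y hy
    rcases Finset.mem_insert.1 ha with rfl | ha
    · exact hc.addIf_adj (isKonig_gr h) h1 h2 h3
    · rw [Finset.mem_singleton.1 ha]
      exact hc.symm.addIf_adj (isKonig_gr h) h1 h3 h2) hN.2
  have hYcard : (n : ℝ) - (rigid (Gr h)).card - 3 ≤ Y.card := by
    have h1 := Finset.card_add_card_compl (rigid (Gr h) ∪ {x, x', w})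
    rw [Fintype.card_fin, ← hY] at h1
    have h2 := Finset.card_union_le (rigid (Gr h)) {x, x', w}
    have h3 : ({x, x', w} : Finset (Fin n)).card ≤ 3 := Finset.card_le_three
    have h5 : (n : ℝ) ≤ (rigid (Gr h)).card + 3 + Y.card := by
      exact_mod_cast (by omega : n ≤ (rigid (Gr h)).card + 3 + Y.card)
    linarith
  refine le_trans ?_ hmain
  have hn' : (1000 : ℝ) ≤ n := by exact_mod_cast hn
  have h0 : (n : ℝ) ≠ 0 := by positivity
  rw [Finset.card_pair hc.1]
  have : 4 / n * (1 - (rigid (Gr h)).card / n - 1 / 100) * ((n : ℝ) ^ 2 / 2) =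
      2 * (n - (rigid (Gr h)).card - n / 100) := by
    field_simp; ring
  rw [this]
  push_cast
  linarith

theorem pr_cherry_le {T : ℕ} (hT : T < pairCount n) {D : ℝ} (hD : D ≤ 6 / 1000 * n)
    (hn : 1000 ≤ n) {T₀ : ℕ} {x x' w : Fin n} {z : ℝ} (hz : 1 ≤ z) (ρ₀ : ℝ) :
    Pr n (fun σ => ∃ t ≤ T, IsCherry (Gr (hist σ t)) x x' w ∧
        ρ₀ ≤ ∑ s ∈ Finset.range t, cherryRate D T₀ x x' w (hist σ s)) ≤
      Real.exp ((z - 1) * 2 * T / (pairCount n - T) - ρ₀) / z ^ 2 := by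
  have hposT : (0 : ℝ) < pairCount n - T := by rw [sub_pos]; exact_mod_cast hT
  have hn' : (1000 : ℝ) ≤ n := by exact_mod_cast hn
  by_cases hxx : x = x'
  · refine le_trans (pr_mono (B := fun _ => False) ?_) ?_
    · rintro σ ⟨t, -, h, -⟩; exact h.1 hxx
    · simp only [Pr, Nat.card_of_isEmpty, Nat.cast_zero, zero_div]; positivity
  have hX2 : ({x, x'} : Finset (Fin n)).card = 2 := Finset.card_pair hxx
  refine le_trans (pr_mono ?_) ((pr_alive_le hT (A := NoEsc {x, x'} {w} T)
    (fun e h => NoEsc.of_cons) (between {x, x'} {w}) hz (ρ := cherryRate D T₀ x x' w)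
    (fun h _ hlt _ => ?_) 2 ρ₀).trans ?_)
  · rintro σ ⟨t, ht, hc, hsum⟩
    refine ⟨t, ht, noEsc_of_forall_adj ?_, ?_, hsum⟩
    · intro a ha y hy
      rw [Finset.mem_singleton]
      rcases Finset.mem_insert.1 ha with rfl | ha
      · exact (hc.2.1 y).1 hy
      · rw [Finset.mem_singleton.1 ha] at hy; exact (hc.2.2 y).1 hy
    · have hdis : Disjoint ({x, x'} : Finset (Fin n)) {w} := by
        rw [Finset.disjoint_singleton_right]
        intro hw
        rcases Finset.mem_insert.1 hw with rfl | hw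
        · exact (Gr (hist σ t)).irrefl ((hc.2.1 w).2 rfl)
        · rw [Finset.mem_singleton.1 hw] at hc
          exact (Gr (hist σ t)).irrefl ((hc.2.2 x').2 rfl)
      have := card_le_countP (h := hist σ t) (P := between {x, x'} {w})
        (S := between {x, x'} {w}) (fun e he => ⟨?_, he⟩)
      · rw [card_between hdis, hX2, Finset.card_singleton] at this
        exact this
      · obtain ⟨⟨a, b⟩, hq, rfl⟩ := Finset.mem_image.1 he
        obtain ⟨ha, hb⟩ := Finset.mem_product.1 hq
        rw [Finset.mem_singleton] at hb
        refine mem_of_gr_adj ?_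
        simp only [Finset.mem_insert, Finset.mem_singleton] at ha
        rcases ha with ha | ha
        · rw [ha]; exact (hc.2.1 b).2 hb
        · rw [ha]; exact (hc.2.2 b).2 hb
  · unfold cherryRate
    split_ifs with h1 h2 h3
    · have := h2.mul_le_card hD (X := {x, x'}) (W := {w}) (by
        rw [hX2, Finset.card_singleton]; push_cast; linarith) hlt
      rw [hX2] at this
      push_cast at this
      convert this
    · simp
    · convert h3.2.mul_le_card h3.1 hD hn hlt
    · simp
  · have h1 : ((between {x, x'} {w}).card : ℝ) ≤ 2 := by
      have := card_between_le {x, x'} {w}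
      rw [hX2, Finset.card_singleton] at this
      exact_mod_cast this
    have h2 : 0 ≤ z - 1 := by linarith
    gcongr

end Escape

/-! ### The number of isolated vertices -/

section IsolatedCount

variable {n : ℕ}

/-- The number of isolated vertices. -/
def isoCount (h : List (Sym2 (Fin n))) : ℕ := (isolated (Gr h)).card

/-- The number of rigid vertices. -/
def rigidCount (h : List (Sym2 (Fin n))) : ℕ := (rigid (Gr h)).card

theorem isoCount_nil : isoCount ([] : List (Sym2 (Fin n))) = n := by
  simp [isoCount, isolated, Gr]

theorem isolated_anti {G G' : SimpleGraph (Fin n)} (h : G ≤ G') : isolated G' ⊆ isolated G := by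
  intro v hv
  rw [mem_isolated] at hv ⊢
  exact fun w hw => hv w (h hw)

theorem isoCount_anti {h' h : List (Sym2 (Fin n))} (hs : h' <:+ h) : isoCount h ≤ isoCount h' :=
  Finset.card_le_card (isolated_anti (gr_mono hs))

theorem mem_isolated_cons {h : List (Sym2 (Fin n))} {e : Sym2 (Fin n)} {v : Fin n}
    (hv : v ∈ isolated (Gr h)) (hve : v ∉ e) : v ∈ isolated (Gr (e :: h)) := by
  rw [mem_isolated] at hv ⊢
  intro w hw
  rcases adj_of_addIf_adj hw with h1 | h1
  · exact hv w h1
  · exact hve (h1 ▸ Sym2.mem_mk_left v w)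

theorem isoCount_le_cons_add_two (e : Sym2 (Fin n)) (h : List (Sym2 (Fin n))) :
    isoCount h ≤ isoCount (e :: h) + 2 := by
  induction e with
  | _ a b =>
    have : isolated (Gr h) ⊆ isolated (Gr (s(a, b) :: h)) ∪ {a, b} := by
      intro v hv
      by_cases hve : v ∈ s(a, b)
      · rw [Finset.mem_union]; right; simpa using hve
      · exact Finset.mem_union_left _ (mem_isolated_cons hv hve)
    have h1 := (Finset.card_le_card this).trans (Finset.card_union_le _ _)
    have h2 : ({a, b} : Finset (Fin n)).card ≤ 2 := Finset.card_le_two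
    unfold isoCount
    omega

theorem disjoint_isolated_rigid (G : SimpleGraph (Fin n)) : Disjoint (isolated G) (rigid G) := by
  rw [Finset.disjoint_left]
  intro v h1 h2
  exact (Finset.mem_sdiff.1 h2).2 (isolated_subset_missable G h1)

theorem isoCount_add_rigidCount_le (h : List (Sym2 (Fin n))) :
    isoCount h + rigidCount h ≤ n := by
  have := Finset.card_le_univ (isolated (Gr h) ∪ rigid (Gr h))
  rw [Finset.card_union_of_disjoint (disjoint_isolated_rigid _), Fintype.card_fin] at this
  exact this

/-- One-step expectation of a function of the number of isolated vertices. -/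
theorem sum_isoCount_le {h : List (Sym2 (Fin n))} (hv : ValidHist h) {f : ℕ → ℝ}
    (h1 : f (isoCount h) ≤ f (isoCount h - 1)) (h2 : f (isoCount h - 1) ≤ f (isoCount h - 2)) :
    ∑ e ∈ unused h, f (isoCount (e :: h)) ≤
      (pairCount n - h.length) * f (isoCount h) +
      isoCount h * (n - rigidCount h - isoCount h) * (f (isoCount h - 1) - f (isoCount h)) +
      isoCount h * (isoCount h + 1) / 2 * (f (isoCount h - 2) - f (isoCount h)) := by
  set k := isoCount h with hk
  set I := isolated (Gr h) with hI
  set E₁ := between I (I ∪ rigid (Gr h))ᶜ with hE₁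
  set E₂ := I.sym2 with hE₂
  have hcard : ((unused h).card : ℝ) = pairCount n - h.length := by
    rw [eq_sub_iff_add_eq]; exact_mod_cast card_unused_add hv
  have hpt : ∀ e ∈ unused h, f (isoCount (e :: h)) ≤ f k +
      (if e ∈ E₁ then f (k - 1) - f k else 0) + (if e ∈ E₂ then f (k - 2) - f k else 0) := by
    intro e _
    have hle : isoCount (e :: h) ≤ k := isoCount_anti (List.suffix_cons _ _)
    have hge : k ≤ isoCount (e :: h) + 2 := isoCount_le_cons_add_two e h
    by_cases he2 : e ∈ E₂
    · have h3 : f (isoCount (e :: h)) ≤ f (k - 2) := by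
        obtain h4 | h4 | h4 : isoCount (e :: h) = k ∨ isoCount (e :: h) = k - 1 ∨
          isoCount (e :: h) = k - 2 := by omega
        · rw [h4]; linarith
        · rw [h4]; linarith
        · rw [h4]
      rw [if_pos he2]
      split_ifs <;> linarith
    rw [if_neg he2]
    by_cases he1 : e ∈ E₁
    · rw [if_pos he1]
      have h3 : k ≤ isoCount (e :: h) + 1 := by
        obtain ⟨⟨u, y⟩, hq, rfl⟩ := Finset.mem_image.1 he1
        obtain ⟨hu, hy⟩ := Finset.mem_product.1 hq
        have hyI : y ∉ I := fun hyI => (Finset.mem_compl.1 hy) (Finset.mem_union_left _ hyI)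
        have : I ⊆ insert u (isolated (Gr (s(u, y) :: h))) := by
          intro v hv
          by_cases hvu : v = u
          · exact Finset.mem_insert.2 (Or.inl hvu)
          · refine Finset.mem_insert_of_mem (mem_isolated_cons hv ?_)
            rw [Sym2.mem_iff]
            rintro (h5 | h5)
            · exact hvu h5
            · exact hyI (h5 ▸ hv)
        exact (Finset.card_le_card this).trans (Finset.card_insert_le _ _)
      obtain h4 | h4 : isoCount (e :: h) = k ∨ isoCount (e :: h) = k - 1 := by omega
      · rw [h4]; linarith
      · rw [h4]; linarith
    · rw [if_neg he1]
      suffices isoCount (e :: h) = k by rw [this]; linarith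
      have hrej : ∀ u y, s(u, y) = e → u ∈ I → Gr (e :: h) = Gr h := by
        rintro u y rfl hu
        have hyI : y ∉ I := fun hyI => he2 (Finset.mk_mem_sym2_iff.2 ⟨hu, hyI⟩)
        have hyr : y ∈ rigid (Gr h) := by
          by_contra hyr
          refine he1 (Finset.mem_image.2 ⟨(u, y), Finset.mem_product.2 ⟨hu, ?_⟩, rfl⟩)
          simp [hyI, hyr]
        exact addIf_eq_of_rigid (isKonig_gr h) hu hyr
      refine le_antisymm hle ?_
      by_cases hex : ∃ u ∈ I, u ∈ e
      · obtain ⟨u, hu, y, hy⟩ := hex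
        rw [isoCount, hrej u y hy.symm hu]
        exact le_rfl
      · push Not at hex
        exact Finset.card_le_card fun v hv => mem_isolated_cons hv (hex v hv)
  have hc1 : (((unused h).filter (· ∈ E₁)).card : ℝ) ≤ k * (n - rigidCount h - k) := by
    have h3 : ((unused h).filter (· ∈ E₁)).card ≤ k * (I ∪ rigid (Gr h))ᶜ.card :=
      (Finset.card_le_card fun e he => (Finset.mem_filter.1 he).2).trans (card_between_le _ _)
    have h4 := Finset.card_add_card_compl (I ∪ rigid (Gr h))
    rw [Finset.card_union_of_disjoint (disjoint_isolated_rigid _), Fintype.card_fin] at h4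
    have h5 : ((I ∪ rigid (Gr h))ᶜ.card : ℝ) = n - rigidCount h - k := by
      have : ((k + rigidCount h + (I ∪ rigid (Gr h))ᶜ.card : ℕ) : ℝ) = n := by
        exact_mod_cast h4
      push_cast at this
      linarith
    rw [← h5]
    exact_mod_cast h3
  have hc2 : (((unused h).filter (· ∈ E₂)).card : ℝ) ≤ k * (k + 1) / 2 := by
    have h3 : ((unused h).filter (· ∈ E₂)).card ≤ E₂.card :=
      Finset.card_le_card fun e he => (Finset.mem_filter.1 he).2
    rw [hE₂, Finset.card_sym2] at h3
    have h4 : ((k + 1).choose 2 : ℝ) = k * (k + 1) / 2 := by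
      rw [Nat.cast_choose_two]; push_cast; ring
    rw [← h4]
    exact_mod_cast h3
  refine (Finset.sum_le_sum hpt).trans ?_
  rw [Finset.sum_add_distrib, Finset.sum_add_distrib, Finset.sum_const, nsmul_eq_mul, hcard,
    ← Finset.sum_filter, Finset.sum_const, nsmul_eq_mul, ← Finset.sum_filter, Finset.sum_const,
    nsmul_eq_mul]
  have h3 := mul_le_mul_of_nonneg_right hc1 (sub_nonneg.2 h1)
  have h4 := mul_le_mul_of_nonneg_right hc2 (sub_nonneg.2 (h1.trans h2))
  linarith

theorem sum_isoCount_le_exp {h : List (Sym2 (Fin n))} (hv : ValidHist h) (hn : 0 < n)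
    (hM : 999 / 2000 * (n : ℝ) ^ 2 ≤ pairCount n - h.length) {f : ℕ → ℝ} {a b R : ℝ}
    (h0 : 0 ≤ f (isoCount h)) (h1 : f (isoCount h) ≤ f (isoCount h - 1))
    (h2 : f (isoCount h - 1) ≤ f (isoCount h - 2))
    (ha : f (isoCount h - 1) ≤ f (isoCount h) * (1 + a))
    (hb : f (isoCount h - 2) ≤ f (isoCount h) * (1 + b)) (hR0 : 0 ≤ R)
    (hR : isoCount h * (n - rigidCount h - isoCount h) * a +
      isoCount h * (isoCount h + 1) / 2 * b ≤ R * n * (999 / 2000)) :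
    ∑ e ∈ unused h, f (isoCount (e :: h)) ≤
      (pairCount n - h.length) * (Real.exp (-(-(R / n))) * f (isoCount h)) := by
  refine (sum_isoCount_le hv h1 h2).trans ?_
  set k := isoCount h
  have hn' : (0 : ℝ) < n := by exact_mod_cast hn
  have hk0 : (0 : ℝ) ≤ k := by positivity
  have hj : (0 : ℝ) ≤ n - rigidCount h - k := by
    have : ((k + rigidCount h : ℕ) : ℝ) ≤ n := by exact_mod_cast isoCount_add_rigidCount_le h
    push_cast at this
    linarith
  have hM0 : (0 : ℝ) < pairCount n - h.length := lt_of_lt_of_le (by positivity) hM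
  have e1 : k * (n - rigidCount h - k) * (f (k - 1) - f k) ≤
      k * (n - rigidCount h - k) * (f k * a) :=
    mul_le_mul_of_nonneg_left (by linarith) (mul_nonneg hk0 hj)
  have e2 : (k : ℝ) * (k + 1) / 2 * (f (k - 2) - f k) ≤ k * (k + 1) / 2 * (f k * b) :=
    mul_le_mul_of_nonneg_left (by linarith) (by positivity)
  have e3 : R * n * (999 / 2000) ≤ (pairCount n - h.length) * (R / n) := by
    have := mul_le_mul_of_nonneg_right hM (by positivity : 0 ≤ R / n)
    refine le_trans (le_of_eq ?_) this
    field_simp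
  have e4 := mul_le_mul_of_nonneg_right (hR.trans e3) h0
  have e5 := mul_le_mul_of_nonneg_left (Real.add_one_le_exp (R / n)) (mul_nonneg hM0.le h0)
  rw [neg_neg]
  nlinarith [e1, e2, e4, e5]

theorem sum_inv_isoCount_le {h : List (Sym2 (Fin n))} (hv : ValidHist h) (hn : 10000 ≤ n)
    (hM : 999 / 2000 * (n : ℝ) ^ 2 ≤ pairCount n - h.length) (hk : 2000 ≤ isoCount h)
    {c : ℝ} (hc : 0 ≤ c) :
    ∑ e ∈ unused h, c / (isoCount (e :: h) : ℝ) ≤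
      (pairCount n - h.length) * (Real.exp (-(-((2 * (1 - rigidCount h / n) + 5 / 1000) / n))) *
        (c / (isoCount h : ℝ))) := by
  have hn' : (10000 : ℝ) ≤ n := by exact_mod_cast hn
  have hk' : (2000 : ℝ) ≤ isoCount h := by exact_mod_cast hk
  have hsum : (isoCount h : ℝ) + rigidCount h ≤ n := by
    exact_mod_cast isoCount_add_rigidCount_le h
  have hj0 : (0 : ℝ) ≤ rigidCount h := by positivity
  have hc1 : ((isoCount h - 1 : ℕ) : ℝ) = isoCount h - 1 := by
    rw [Nat.cast_sub (by omega)]; simp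
  have hc2 : ((isoCount h - 2 : ℕ) : ℝ) = isoCount h - 2 := by
    rw [Nat.cast_sub (by omega)]; simp
  refine sum_isoCount_le_exp (f := fun k => c / (k : ℝ)) (a := 1 / (isoCount h - 1))
    (b := 2 / (isoCount h - 2)) hv (by omega) hM (by positivity) ?_ ?_ ?_ ?_ ?_ ?_
  · rw [hc1]
    exact div_le_div_of_nonneg_left hc (by linarith) (by linarith)
  · rw [hc1, hc2]
    exact div_le_div_of_nonneg_left hc (by linarith) (by linarith)
  · rw [hc1]
    have : (isoCount h : ℝ) - 1 ≠ 0 := by linarith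
    refine le_of_eq ?_
    field_simp
    ring
  · rw [hc2]
    have : (isoCount h : ℝ) - 2 ≠ 0 := by linarith
    refine le_of_eq ?_
    field_simp
    ring
  · have : (rigidCount h : ℝ) / n ≤ 1 := by
      rw [div_le_one (by linarith)]; linarith
    linarith
  · generalize (isoCount h : ℝ) = k at *
    generalize (rigidCount h : ℝ) = j at *
    have e1 : (2 * (1 - j / n) + 5 / 1000) * n * (999 / 2000) =
        999 / 1000 * (n - j) + 999 / 400000 * n := by
      field_simp; ring
    rw [e1]
    have e2 : k * (n - j - k) * (1 / (k - 1)) ≤ (n - j - k) + (n - j - k) / 1999 := by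
      have : k * (1 / (k - 1)) ≤ 1 + 1 / 1999 := by
        rw [mul_one_div, div_le_iff₀ (by linarith)]; linarith
      have := mul_le_mul_of_nonneg_left this (by linarith : 0 ≤ n - j - k)
      linarith
    have e3 : k * (k + 1) / 2 * (2 / (k - 2)) ≤ k + 4 := by
      have : k * (k + 1) / 2 * (2 / (k - 2)) = k * (k + 1) / (k - 2) := by
        field_simp
      rw [this, div_le_iff₀ (by linarith)]; nlinarith
    have e4 : (n - j - k) / 1999 ≤ (n - j) / 1999 := by
      refine div_le_div_of_nonneg_right ?_ (by norm_num); linarith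
    linarith

end IsolatedCount

section Survival

variable {n : ℕ}

/-- The parity-dependent potential. -/
def parityPotential (k : ℕ) : ℝ := if Even k then 1 / (3 * k + 1) else 1 / (3 * k)

theorem parityPotential_nonneg (k : ℕ) : 0 ≤ parityPotential k := by
  unfold parityPotential; split_ifs <;> positivity

theorem parityPotential_le {k : ℕ} (hk : 1 ≤ k) : parityPotential k ≤ 1 / 3 / k := by
  have hk' : (1 : ℝ) ≤ k := by exact_mod_cast hk
  unfold parityPotential
  split_ifs
  · rw [div_div]
    exact one_div_le_one_div_of_le (by positivity) (by linarith)
  · rw [div_div]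

theorem le_parityPotential {k : ℕ} (hk : 1 ≤ k) : 1 / (3 * (k : ℝ) + 1) ≤ parityPotential k := by
  have hk' : (1 : ℝ) ≤ k := by exact_mod_cast hk
  unfold parityPotential
  split_ifs
  · exact le_rfl
  · exact one_div_le_one_div_of_le (by positivity) (by linarith)

/-- The number of isolated vertices is small, and if it is even then about half of the vertices
are rigid. -/
def GoodStep (h : List (Sym2 (Fin n))) : Prop :=
  (isoCount h : ℝ) ≤ 2 / 1000 * n ∧
    (Even (isoCount h) → (1 / 2 - 4 / 1000) * (n : ℝ) ≤ rigidCount h)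

theorem sum_parityPotential_le {h : List (Sym2 (Fin n))} (hv : ValidHist h) (hn : 10000 ≤ n)
    (hM : 999 / 2000 * (n : ℝ) ^ 2 ≤ pairCount n - h.length) (hk : 2000 ≤ isoCount h) :
    ∑ e ∈ unused h, parityPotential (isoCount (e :: h)) ≤
      (pairCount n - h.length) * (Real.exp (-(-((if GoodStep h then 136 / 100 else 3) / n))) *
        parityPotential (isoCount h)) := by
  have hn' : (10000 : ℝ) ≤ n := by exact_mod_cast hn
  have hk' : (2000 : ℝ) ≤ isoCount h := by exact_mod_cast hk
  have hsum : (isoCount h : ℝ) + rigidCount h ≤ n := by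
    exact_mod_cast isoCount_add_rigidCount_le h
  have hj0 : (0 : ℝ) ≤ rigidCount h := by positivity
  have hc1 : ((isoCount h - 1 : ℕ) : ℝ) = isoCount h - 1 := by
    rw [Nat.cast_sub (by omega)]; simp
  have hc2 : ((isoCount h - 2 : ℕ) : ℝ) = isoCount h - 2 := by
    rw [Nat.cast_sub (by omega)]; simp
  have hR0 : (0 : ℝ) ≤ if GoodStep h then 136 / 100 else 3 := by split_ifs <;> norm_num
  by_cases hev : Even (isoCount h)
  · have f0 : parityPotential (isoCount h) = 1 / (3 * (isoCount h : ℝ) + 1) := if_pos hev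
    have f1 : parityPotential (isoCount h - 1) = 1 / (3 * ((isoCount h : ℝ) - 1)) := by
      rw [← hc1]
      refine if_neg ?_
      rw [Nat.even_sub (by omega)]; simp [hev]
    have f2 : parityPotential (isoCount h - 2) = 1 / (3 * ((isoCount h : ℝ) - 2) + 1) := by
      rw [← hc2]
      refine if_pos ?_
      rw [Nat.even_sub (by omega)]; simp [hev]
    refine sum_isoCount_le_exp (f := parityPotential) (a := 4 / (3 * isoCount h - 3))
      (b := 6 / (3 * isoCount h - 5)) hv (by omega) hM (parityPotential_nonneg _) ?_ ?_ ?_ ?_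
      hR0 ?_
    · rw [f0, f1]
      exact one_div_le_one_div_of_le (by linarith) (by linarith)
    · rw [f1, f2]
      exact one_div_le_one_div_of_le (by linarith) (by linarith)
    · rw [f0, f1]
      have e1 : 3 * (isoCount h : ℝ) - 3 ≠ 0 := by linarith
      have e2 : (isoCount h : ℝ) - 1 ≠ 0 := by linarith
      refine le_of_eq ?_
      field_simp
      ring
    · rw [f0, f2]
      have e1 : 3 * (isoCount h : ℝ) - 5 ≠ 0 := by linarith
      have e2 : 3 * ((isoCount h : ℝ) - 2) + 1 = 3 * isoCount h - 5 := by ring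
      rw [e2]
      refine le_of_eq ?_
      field_simp
      ring
    · have hgood : GoodStep h → (isoCount h : ℝ) ≤ 2 / 1000 * n ∧
        (1 / 2 - 4 / 1000) * (n : ℝ) ≤ rigidCount h := fun hg => ⟨hg.1, hg.2 hev⟩
      generalize (isoCount h : ℝ) = k at *
      generalize (rigidCount h : ℝ) = j at *
      have e2 : k * (n - j - k) * (4 / (3 * k - 3)) ≤ 4 / 3 * (2000 / 1999) * (n - j - k) := by
        have : k * (4 / (3 * k - 3)) ≤ 4 / 3 * (2000 / 1999) := by
          rw [mul_div_assoc', div_le_iff₀ (by linarith)]; linarith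
        have := mul_le_mul_of_nonneg_left this (by linarith : 0 ≤ n - j - k)
        linarith
      have e3 : k * (k + 1) / 2 * (6 / (3 * k - 5)) ≤ k + 4 := by
        have : k * (k + 1) / 2 * (6 / (3 * k - 5)) = 3 * k * (k + 1) / (3 * k - 5) := by
          field_simp; ring
        rw [this, div_le_iff₀ (by linarith)]; nlinarith
      split_ifs with hg
      · have := hgood hg
        linarith
      · linarith
  · have f0 : parityPotential (isoCount h) = 1 / (3 * (isoCount h : ℝ)) := if_neg hev
    have f1 : parityPotential (isoCount h - 1) = 1 / (3 * ((isoCount h : ℝ) - 1) + 1) := by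
      rw [← hc1]
      refine if_pos ?_
      rw [Nat.even_sub (by omega)]; simp [hev]
    have f2 : parityPotential (isoCount h - 2) = 1 / (3 * ((isoCount h : ℝ) - 2)) := by
      rw [← hc2]
      refine if_neg ?_
      rw [Nat.even_sub (by omega)]; simp [hev]
    refine sum_isoCount_le_exp (f := parityPotential) (a := 2 / (3 * isoCount h - 2))
      (b := 2 / (isoCount h - 2)) hv (by omega) hM (parityPotential_nonneg _) ?_ ?_ ?_ ?_
      hR0 ?_
    · rw [f0, f1]
      exact one_div_le_one_div_of_le (by linarith) (by linarith)
    · rw [f1, f2]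
      exact one_div_le_one_div_of_le (by linarith) (by linarith)
    · rw [f0, f1]
      have e1 : 3 * (isoCount h : ℝ) - 2 ≠ 0 := by linarith
      have e2 : 3 * ((isoCount h : ℝ) - 1) + 1 = 3 * isoCount h - 2 := by ring
      rw [e2]
      refine le_of_eq ?_
      field_simp
      ring
    · rw [f0, f2]
      have e1 : (isoCount h : ℝ) - 2 ≠ 0 := by linarith
      refine le_of_eq ?_
      field_simp
      ring
    · have hgood : GoodStep h → (isoCount h : ℝ) ≤ 2 / 1000 * n := fun hg => hg.1
      generalize (isoCount h : ℝ) = k at *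
      generalize (rigidCount h : ℝ) = j at *
      have e2 : k * (n - j - k) * (2 / (3 * k - 2)) ≤ 2 / 3 * (2000 / 1999) * (n - j - k) := by
        have : k * (2 / (3 * k - 2)) ≤ 2 / 3 * (2000 / 1999) := by
          rw [mul_div_assoc', div_le_iff₀ (by linarith)]; linarith
        have := mul_le_mul_of_nonneg_left this (by linarith : 0 ≤ n - j - k)
        linarith
      have e3 : k * (k + 1) / 2 * (2 / (k - 2)) ≤ k + 4 := by
        have : k * (k + 1) / 2 * (2 / (k - 2)) = k * (k + 1) / (k - 2) := by
          field_simp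
        rw [this, div_le_iff₀ (by linarith)]; nlinarith
      split_ifs with hg
      · have := hgood hg
        linarith
      · linarith

/-- Some graph of the process after time `T₀` had no cherry. -/
def CherryFreeSeen (T₀ : ℕ) (h : List (Sym2 (Fin n))) : Prop :=
  ∃ h', h' <:+ h ∧ T₀ ≤ h'.length ∧ ∀ x x' w, ¬ IsCherry (Gr h') x x' w

/-- Upper bound for `n` times the rate at which the logarithm of the number of isolated vertices
decreases. -/
def decayRate (T₀ : ℕ) (h : List (Sym2 (Fin n))) : ℝ :=
  if CherryFreeSeen T₀ h then (if GoodStep h then 136 / 100 else 3)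
  else 2 * (1 - rigidCount h / n) + 5 / 1000

theorem decayRate_nonneg (T₀ : ℕ) (h : List (Sym2 (Fin n))) : 0 ≤ decayRate T₀ h := by
  have : (rigidCount h : ℝ) / n ≤ 1 := by
    refine div_le_one_of_le₀ ?_ (by positivity)
    exact_mod_cast (Nat.le_add_left _ _).trans (isoCount_add_rigidCount_le h)
  unfold decayRate
  split_ifs
  · norm_num
  · norm_num
  · linarith

/-- The isolated vertices do not disappear if the accumulated decay rate is small. -/
theorem pr_isoCount_lt_le {T : ℕ} (hn : 10000 ≤ n)
    (hT : 999 / 2000 * (n : ℝ) ^ 2 ≤ pairCount n - T) (T₀ : ℕ) (B : ℝ) :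
    Pr n (fun σ => isoCount (hist σ T) < 2000 ∧
        ∑ s ∈ Finset.range T, decayRate T₀ (hist σ s) ≤ B * n) ≤
      6001 / (3 * n) * Real.exp B := by
  have hn' : (10000 : ℝ) ≤ n := by exact_mod_cast hn
  have hTN : (T : ℝ) < pairCount n := by
    have : 0 < 999 / 2000 * (n : ℝ) ^ 2 := by positivity
    linarith
  have hTN' : T < pairCount n := by exact_mod_cast hTN
  let F : List (Sym2 (Fin n)) → ℝ := fun h =>
    if CherryFreeSeen T₀ h then parityPotential (isoCount h) else 1 / 3 / (isoCount h : ℝ)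
  have hF : ∀ h, 0 ≤ F h := by
    intro h; simp only [F]; split_ifs
    · exact parityPotential_nonneg _
    · positivity
  have key := mul_pr_exists_exp_le (T := T) hTN'.le hF (fun h => -(decayRate T₀ h / n))
    (fun h => 2000 ≤ isoCount h) ?_ (a := 1 / 6001 * Real.exp (-B)) (by positivity)
  · have hnil : F [] ≤ 1 / (3 * n) := by
      have : (1 : ℝ) / (3 * n) = 1 / 3 / (isoCount ([] : List (Sym2 (Fin n))) : ℝ) := by
        rw [isoCount_nil, div_div]
      rw [this]
      simp only [F]; split_ifs
      · exact parityPotential_le (by rw [isoCount_nil]; omega)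
      · exact le_rfl
    have ha : (6001 : ℝ) / (3 * n) * Real.exp B =
        (1 / (3 * n)) / (1 / 6001 * Real.exp (-B)) := by
      rw [Real.exp_neg]; field_simp
    rw [ha, le_div_iff₀ (by positivity), mul_comm]
    refine (mul_le_mul_of_nonneg_left (pr_mono ?_) (by positivity)).trans (key.trans hnil)
    rintro σ ⟨h1, h2⟩
    have hex : ∃ t, isoCount (hist σ t) < 2000 := ⟨T, h1⟩
    set t := Nat.find hex with ht
    have htT : t ≤ T := Nat.find_min' hex h1
    have hbefore : ∀ s < t, 2000 ≤ isoCount (hist σ s) := fun s hs =>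
      not_lt.1 (Nat.find_min hex hs)
    refine ⟨t, htT, hbefore, ?_⟩
    have hlt : isoCount (hist σ t) < 2000 := Nat.find_spec hex
    have hpos : 1 ≤ isoCount (hist σ t) := by
      rcases Nat.eq_zero_or_pos t with h0 | h0
      · rw [h0] at hlt; change isoCount [] < 2000 at hlt; rw [isoCount_nil] at hlt; omega
      · obtain ⟨s, hs⟩ : ∃ s, t = s + 1 := ⟨t - 1, by omega⟩
        have hsN : s < pairCount n := by omega
        rw [hs, hist_succ σ hsN] at hlt ⊢
        have h3 := isoCount_le_cons_add_two (σ.1 ⟨s, hsN⟩) (hist σ s)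
        have h4 := hbefore s (by omega)
        omega
    have hFt : 1 / 6001 ≤ F (hist σ t) := by
      have h5 : (isoCount (hist σ t) : ℝ) ≤ 2000 := by exact_mod_cast hlt.le
      have h6 : (1 : ℝ) ≤ isoCount (hist σ t) := by exact_mod_cast hpos
      have h7 : (1 : ℝ) / 6001 ≤ 1 / (3 * (isoCount (hist σ t) : ℝ) + 1) :=
        one_div_le_one_div_of_le (by positivity) (by linarith)
      refine h7.trans ((le_parityPotential hpos).trans ?_)
      simp only [F]; split_ifs
      · exact le_rfl
      · exact parityPotential_le hpos
    refine mul_le_mul hFt (Real.exp_le_exp.2 ?_) (Real.exp_pos _).le (hF _)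
    rw [Finset.sum_neg_distrib, neg_le_neg_iff, ← Finset.sum_div, div_le_iff₀ (by linarith)]
    refine le_trans (Finset.sum_le_sum_of_subset_of_nonneg (Finset.range_mono htT)
      fun _ _ _ => decayRate_nonneg _ _) h2
  · intro h hv hlt hk
    have hM : 999 / 2000 * (n : ℝ) ^ 2 ≤ pairCount n - h.length := by
      have : (h.length : ℝ) < T := by exact_mod_cast hlt
      linarith
    by_cases hcf : CherryFreeSeen T₀ h
    · have hcf' : ∀ e, CherryFreeSeen T₀ (e :: h) := fun e => by
        obtain ⟨h', hs, hr⟩ := hcf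
        exact ⟨h', hs.trans (List.suffix_cons _ _), hr⟩
      have hr : decayRate T₀ h = if GoodStep h then 136 / 100 else 3 := if_pos hcf
      have hFe : ∀ e, F (e :: h) = parityPotential (isoCount (e :: h)) := fun e =>
        if_pos (hcf' e)
      have hFh : F h = parityPotential (isoCount h) := if_pos hcf
      rw [Finset.sum_congr rfl fun e _ => hFe e, hFh, hr]
      exact sum_parityPotential_le hv hn hM hk
    · have hr : decayRate T₀ h = 2 * (1 - rigidCount h / n) + 5 / 1000 := if_neg hcf
      have hFh : F h = 1 / 3 / (isoCount h : ℝ) := if_neg hcf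
      rw [hFh, hr]
      refine (Finset.sum_le_sum fun e _ => ?_).trans
        (sum_inv_isoCount_le hv hn hM hk (c := 1 / 3) (by norm_num))
      simp only [F]; split_ifs
      · exact parityPotential_le (by have := isoCount_le_cons_add_two e h; omega)
      · exact le_rfl

/-- If there are at least `K` isolated vertices at time `T₀`, some of them survive until `T`. -/
theorem pr_isoCount_lt_of_le {T T₀ : ℕ} (hn : 10000 ≤ n)
    (hT : 999 / 2000 * (n : ℝ) ^ 2 ≤ pairCount n - T) (hT₀ : T₀ ≤ T) {K : ℝ} (hK : 2000 ≤ K) :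
    Pr n (fun σ => isoCount (hist σ T) < 2000 ∧ K ≤ isoCount (hist σ T₀)) ≤
      2000 / K * Real.exp (2005 / 1000 / n * (T - T₀)) := by
  have hn' : (10000 : ℝ) ≤ n := by exact_mod_cast hn
  have hTN : (T : ℝ) < pairCount n := by
    have : 0 < 999 / 2000 * (n : ℝ) ^ 2 := by positivity
    linarith
  have hTN' : T < pairCount n := by exact_mod_cast hTN
  let F : List (Sym2 (Fin n)) → ℝ := fun h =>
    if h.length < T₀ then 1 / K
    else if K ≤ isoCount (h.drop (h.length - T₀)) then 1 / (isoCount h : ℝ) else 0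
  have hF : ∀ h, 0 ≤ F h := by
    intro h; simp only [F]; split_ifs <;> positivity
  have hFK : ∀ h, h.length ≤ T₀ → F h ≤ 1 / K := by
    intro h hh
    simp only [F]; split_ifs with h1 h2
    · exact le_rfl
    · rw [show h.length - T₀ = 0 by omega, List.drop_zero] at h2
      exact one_div_le_one_div_of_le (by linarith) h2
    · positivity
  have key := mul_pr_exists_exp_le (T := T) hTN'.le hF
    (fun h => if h.length < T₀ then 0 else -(2005 / 1000 / n))
    (fun h => T₀ ≤ h.length → 2000 ≤ isoCount h) ?_
    (a := 1 / 2000 * Real.exp (-(2005 / 1000 / n * (T - T₀)))) (by positivity)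
  · have ha : 2000 / K * Real.exp (2005 / 1000 / n * (T - T₀)) =
        (1 / K) / (1 / 2000 * Real.exp (-(2005 / 1000 / n * (T - T₀)))) := by
      rw [Real.exp_neg]; field_simp
    rw [ha, le_div_iff₀ (by positivity), mul_comm]
    refine (mul_le_mul_of_nonneg_left (pr_mono ?_) (by positivity)).trans
      (key.trans (hFK [] (by simp)))
    rintro σ ⟨h1, h2⟩
    have hex : ∃ t, T₀ ≤ t ∧ isoCount (hist σ t) < 2000 := ⟨T, hT₀, h1⟩
    set t := Nat.find hex with ht
    have htT : t ≤ T := Nat.find_min' hex ⟨hT₀, h1⟩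
    obtain ⟨htT₀, hlt⟩ : T₀ ≤ t ∧ isoCount (hist σ t) < 2000 := Nat.find_spec hex
    have hbefore : ∀ s < t, T₀ ≤ s → 2000 ≤ isoCount (hist σ s) := fun s hs hs' =>
      not_lt.1 fun h => Nat.find_min hex hs ⟨hs', h⟩
    have hlen : ∀ s ≤ T, (hist σ s).length = s := fun s hs => length_hist σ (by omega)
    refine ⟨t, htT, fun s hs hs' => hbefore s hs (by rwa [hlen s (by omega)] at hs'), ?_⟩
    have hpos : 1 ≤ isoCount (hist σ t) := by
      rcases htT₀.eq_or_lt with h0 | h0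
      · rw [← h0] at hlt
        have : (isoCount (hist σ T₀) : ℝ) < 2000 := by exact_mod_cast hlt
        linarith
      · obtain ⟨s, hs⟩ : ∃ s, t = s + 1 := ⟨t - 1, by omega⟩
        have hsN : s < pairCount n := by omega
        rw [hs, hist_succ σ hsN] at hlt ⊢
        have h3 := isoCount_le_cons_add_two (σ.1 ⟨s, hsN⟩) (hist σ s)
        have h4 := hbefore s (by omega) (by omega)
        omega
    have hdrop : (hist σ t).drop ((hist σ t).length - T₀) = hist σ T₀ := by
      have h3 := List.suffix_iff_eq_drop.1 (hist_suffix σ htT₀)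
      rw [hlen T₀ hT₀] at h3
      exact h3.symm
    have hFt : F (hist σ t) = 1 / (isoCount (hist σ t) : ℝ) := by
      have h3 : ¬ (hist σ t).length < T₀ := by rw [hlen t htT]; omega
      simp only [F]
      rw [if_neg h3, hdrop]
      exact if_pos h2
    rw [hFt]
    refine mul_le_mul (one_div_le_one_div_of_le (by exact_mod_cast hpos)
      (by exact_mod_cast hlt.le)) (Real.exp_le_exp.2 ?_) (Real.exp_pos _).le (by positivity)
    have hsum : ∑ s ∈ Finset.range t, (if (hist σ s).length < T₀ then (0 : ℝ) else
        -(2005 / 1000 / n)) = ∑ s ∈ Finset.range t, if T₀ ≤ s then -(2005 / 1000 / (n : ℝ)) else 0 := by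
      refine Finset.sum_congr rfl fun s hs => ?_
      rw [hlen s (by rw [Finset.mem_range] at hs; omega)]
      by_cases h3 : s < T₀
      · rw [if_pos h3, if_neg (by omega)]
      · rw [if_neg h3, if_pos (by omega)]
    rw [hsum, ← Finset.sum_filter, Finset.sum_const, nsmul_eq_mul]
    have hcard : (((Finset.range t).filter fun s => T₀ ≤ s).card : ℝ) ≤ T - T₀ := by
      have h3 : (Finset.range t).filter (fun s => T₀ ≤ s) ⊆ Finset.Ico T₀ T := by
        intro s hs
        rw [Finset.mem_filter, Finset.mem_range] at hs
        rw [Finset.mem_Ico]; omega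
      have h4 := Finset.card_le_card h3
      rw [Nat.card_Ico] at h4
      rw [← Nat.cast_sub hT₀]
      exact_mod_cast h4
    have h5 : (0 : ℝ) ≤ 2005 / 1000 / n := by positivity
    nlinarith
  · intro h hv hlt hact
    have hM : 999 / 2000 * (n : ℝ) ^ 2 ≤ pairCount n - h.length := by
      have : (h.length : ℝ) < T := by exact_mod_cast hlt
      linarith
    have hcard : ((unused h).card : ℝ) = pairCount n - h.length := by
      rw [eq_sub_iff_add_eq]; exact_mod_cast card_unused_add hv
    by_cases hh : h.length < T₀
    · have hFh : F h = 1 / K := if_pos hh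
      rw [if_pos hh, hFh]
      refine (Finset.sum_le_sum fun e _ => hFK (e :: h) hh).trans ?_
      rw [Finset.sum_const, nsmul_eq_mul, hcard]
      simp
    · rw [if_neg hh]
      have hk := hact (not_lt.1 hh)
      have hdrop : ∀ e, (e :: h).drop ((e :: h).length - T₀) = h.drop (h.length - T₀) := by
        intro e
        rw [List.length_cons, show h.length + 1 - T₀ = (h.length - T₀) + 1 by omega,
          List.drop_succ_cons]
      by_cases hKk : K ≤ isoCount (h.drop (h.length - T₀))
      · have hFh : F h = 1 / (isoCount h : ℝ) := by
          simp only [F]; rw [if_neg hh]; exact if_pos hKk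
        have hFe : ∀ e, F (e :: h) = 1 / (isoCount (e :: h) : ℝ) := by
          intro e
          have h3 : ¬ (e :: h).length < T₀ := by rw [List.length_cons]; omega
          simp only [F]; rw [if_neg h3, hdrop]; exact if_pos hKk
        rw [Finset.sum_congr rfl fun e _ => hFe e, hFh]
        refine (sum_inv_isoCount_le hv hn hM hk zero_le_one).trans ?_
        have hM0 : (0 : ℝ) ≤ pairCount n - h.length := le_trans (by positivity) hM
        have h4 : (0 : ℝ) ≤ rigidCount h / n := by positivity
        gcongr
        linarith
      · have hFe : ∀ e, F (e :: h) = 0 := by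
          intro e
          have h3 : ¬ (e :: h).length < T₀ := by rw [List.length_cons]; omega
          simp only [F]; rw [if_neg h3, hdrop]; exact if_neg hKk
        rw [Finset.sum_eq_zero fun e _ => hFe e]
        have hM0 : (0 : ℝ) ≤ pairCount n - h.length := le_trans (by positivity) hM
        have := hF h
        positivity

end Survival

/-! ### Traps, pendant vertices and cherries -/

section Traps

variable {n : ℕ}

/-- All neighbours of `X` lie in `W`, and every vertex of `W` has two neighbours in `X`. -/
def IsTrap (G : SimpleGraph (Fin n)) (X W : Finset (Fin n)) : Prop :=
  Disjoint X W ∧ (∀ x ∈ X, ∀ y, G.Adj x y → y ∈ W) ∧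
    ∀ w ∈ W, 2 ≤ (X.filter fun x => G.Adj x w).card

/-- The accumulated rate at which neighbours outside `W` appear. -/
def niceClock (D : ℝ) (H : ℕ) (a : ℝ) (σ : EdgeOrdering n) (t : ℕ) : ℝ :=
  ∑ s ∈ Finset.range t, if (hist σ s).length < H ∧ Nice D (hist σ s) then
    98 / 100 * a / (n : ℝ) else 0

theorem IsTrap.two_mul_card_le {h : List (Sym2 (Fin n))} {X W : Finset (Fin n)}
    (ht : IsTrap (Gr h) X W) : 2 * W.card ≤ h.countP (· ∈ between X W) := by
  set Q := (X ×ˢ W).filter fun q => (Gr h).Adj q.1 q.2 with hQ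
  have h1 : (Q.image fun q => s(q.1, q.2)).card = Q.card :=
    Finset.card_image_of_injOn ((injOn_mk_of_disjoint ht.1).mono
      (by exact_mod_cast Finset.filter_subset _ _))
  have h2 : 2 * W.card ≤ Q.card := by
    have h3 : Q.card = ∑ w ∈ W, (X.filter fun x => (Gr h).Adj x w).card := by
      rw [hQ, Finset.card_filter, Finset.sum_product_right]
      refine Finset.sum_congr rfl fun w _ => ?_
      rw [Finset.card_filter]
    rw [h3, mul_comm, ← smul_eq_mul, ← Finset.sum_const]
    exact Finset.sum_le_sum fun w hw => ht.2.2 w hw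
  refine h2.trans (h1.symm.le.trans (card_le_countP fun e he => ?_))
  obtain ⟨q, hq, rfl⟩ := Finset.mem_image.1 he
  obtain ⟨h3, h4⟩ := Finset.mem_filter.1 hq
  exact ⟨mem_of_gr_adj h4, Finset.mem_image_of_mem _ h3⟩

theorem choose_mul_choose_mul_le {n r : ℕ} (hn : 0 < n) {ℓ z : ℝ} (hℓ : 0 < ℓ)
    (hz : n / ((r + 1) * ℓ) ≤ z) :
    (n.choose (r + 1) : ℝ) * n.choose r * (1 / z ^ (2 * r)) ≤
      n * Real.exp (2 * (r + 1)) * ℓ ^ (2 * r) := by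
  have hn' : (0 : ℝ) < n := by exact_mod_cast hn
  have hr1 : (0 : ℝ) < r + 1 := by positivity
  have hz0 : 0 < n / ((r + 1) * ℓ) := by positivity
  have e1 : 1 / z ^ (2 * r) ≤ ((r + 1) * ℓ / n) ^ (2 * r) := by
    have e0 : ((r + 1) * ℓ / n) ^ (2 * r) = 1 / (n / ((r + 1) * ℓ)) ^ (2 * r) := by
      rw [div_pow, div_pow, one_div_div]
    rw [e0]
    exact one_div_le_one_div_of_le (by positivity) (pow_le_pow_left₀ hz0.le hz _)
  have hzpos : 0 < z := hz0.trans_le hz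
  have e2 : (n.choose (r + 1) : ℝ) ≤ n ^ (r + 1) / (r + 1).factorial := Nat.choose_le_pow_div _ _
  have e3 : (n.choose r : ℝ) ≤ n ^ r / r.factorial := Nat.choose_le_pow_div _ _
  have e4 : ((r : ℝ) + 1) ^ (r + 1) / (r + 1).factorial ≤ Real.exp (r + 1) :=
    Real.pow_div_factorial_le_exp _ hr1.le _
  have e5 : ((r : ℝ) + 1) ^ r / r.factorial ≤ Real.exp (r + 1) :=
    Real.pow_div_factorial_le_exp _ hr1.le _
  calc (n.choose (r + 1) : ℝ) * n.choose r * (1 / z ^ (2 * r))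
      ≤ (n ^ (r + 1) / (r + 1).factorial) * (n ^ r / r.factorial) *
          ((r + 1) * ℓ / n) ^ (2 * r) := by gcongr
    _ = n * ((((r : ℝ) + 1) ^ (r + 1) / (r + 1).factorial) *
          (((r : ℝ) + 1) ^ r / r.factorial)) * ℓ ^ (2 * r) / (r + 1) := by
        rw [div_pow, mul_pow]
        field_simp
        ring
    _ ≤ n * ((((r : ℝ) + 1) ^ (r + 1) / (r + 1).factorial) *
          (((r : ℝ) + 1) ^ r / r.factorial)) * ℓ ^ (2 * r) :=
        div_le_self (by positivity) (by linarith [(by positivity : (0 : ℝ) ≤ r)])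
    _ ≤ n * (Real.exp (r + 1) * Real.exp (r + 1)) * ℓ ^ (2 * r) := by gcongr
    _ = _ := by rw [← Real.exp_add]; congr 3; ring

theorem pr_trap_card_le {T : ℕ} (hT : T < pairCount n) {D : ℝ} (hD : D ≤ 6 / 1000 * n)
    {ℓ : ℝ} (hℓ : 0 < ℓ) (hTℓ : (T : ℝ) / (pairCount n - T) ≤ 104 / 100 * ℓ / n) {r : ℕ}
    (hr : (r : ℝ) + 1 ≤ n / 1000) (H : ℕ) (β : ℝ) :
    Pr n (fun σ => ∃ X ∈ Finset.univ.powersetCard (r + 1), ∃ W ∈ Finset.univ.powersetCard r,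
        ∃ t ≤ T, IsTrap (Gr (hist σ t)) X W ∧ β * (r + 1) ≤ niceClock D H (r + 1) σ t) ≤
      n * Real.exp (2 - β) * (Real.exp (304 / 100 - β) * ℓ ^ 2) ^ r := by
  have hn' : (0 : ℝ) < n := by
    have : (0 : ℝ) ≤ r := by positivity
    linarith
  have hn : 0 < n := by exact_mod_cast hn'
  set z : ℝ := 1 + n / ((r + 1) * ℓ) with hz
  have hz1 : 1 ≤ z := by
    have : 0 < n / ((r + 1) * ℓ) := by positivity
    linarith
  have hone : ∀ X ∈ (Finset.univ : Finset (Fin n)).powersetCard (r + 1),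
      ∀ W ∈ (Finset.univ : Finset (Fin n)).powersetCard r,
      Pr n (fun σ => ∃ t ≤ T, IsTrap (Gr (hist σ t)) X W ∧
        β * (r + 1) ≤ niceClock D H (r + 1) σ t) ≤
      Real.exp (104 / 100 * r - β * (r + 1)) * (1 / z ^ (2 * r)) := by
    intro X hX W hW
    have hX := (Finset.mem_powersetCard.1 hX).2
    have hW := (Finset.mem_powersetCard.1 hW).2
    have := pr_noEsc_le hT hD (X := X) (W := W) (by rw [hX, hW]; push_cast; linarith) H hz1
      (2 * r) (β * (r + 1))
    refine le_trans (pr_mono ?_) (this.trans ?_)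
    · rintro σ ⟨t, ht, h1, h2⟩
      refine ⟨t, ht, noEsc_of_forall_adj h1.2.1, ?_, ?_⟩
      · have := h1.two_mul_card_le
        rwa [hW] at this
      · rw [hX]; push_cast; exact h2
    · rw [mul_one_div]
      gcongr
      rw [hX, hW, hz]
      have e : (1 + n / ((r + 1) * ℓ) - 1) * (((r + 1 : ℕ) : ℝ) * r) * T / (pairCount n - T) =
          (n / ℓ * r) * (T / (pairCount n - T)) := by
        push_cast
        have : (r : ℝ) + 1 ≠ 0 := by positivity
        rw [add_sub_cancel_left, mul_div_assoc]
        congr 1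
        field_simp
      rw [e]
      refine (mul_le_mul_of_nonneg_left hTℓ (by positivity)).trans (le_of_eq ?_)
      field_simp
  refine (pr_exists_le _ _).trans ((Finset.sum_le_sum fun X hX => (pr_exists_le _ _).trans
    (Finset.sum_le_sum fun W hW => hone X hX W hW)).trans ?_)
  rw [Finset.sum_const, Finset.sum_const, Finset.card_powersetCard, Finset.card_powersetCard,
    Finset.card_univ, Fintype.card_fin, nsmul_eq_mul, nsmul_eq_mul]
  have h1 := choose_mul_choose_mul_le (n := n) (r := r) hn hℓ (z := z) (by linarith)
  calc (n.choose (r + 1) : ℝ) * (n.choose r *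
        (Real.exp (104 / 100 * r - β * (r + 1)) * (1 / z ^ (2 * r))))
      = Real.exp (104 / 100 * r - β * (r + 1)) *
        ((n.choose (r + 1) : ℝ) * n.choose r * (1 / z ^ (2 * r))) := by ring
    _ ≤ Real.exp (104 / 100 * r - β * (r + 1)) *
        (n * Real.exp (2 * (r + 1)) * ℓ ^ (2 * r)) := by gcongr
    _ = _ := by
        rw [mul_pow, ← Real.exp_nat_mul, ← pow_mul]
        have : Real.exp (104 / 100 * r - β * (r + 1)) * Real.exp (2 * (r + 1)) =
            Real.exp (2 - β) * Real.exp (r * (304 / 100 - β)) := by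
          rw [← Real.exp_add, ← Real.exp_add]; congr 1; ring
        linear_combination (n * ℓ ^ (2 * r)) * this

theorem pr_trap_le {T : ℕ} (hT : T < pairCount n) {D : ℝ} (hD : D ≤ 6 / 1000 * n)
    {ℓ : ℝ} (hℓ : 0 < ℓ) (hTℓ : (T : ℝ) / (pairCount n - T) ≤ 104 / 100 * ℓ / n) (H : ℕ)
    {β : ℝ} (hβ : Real.exp (304 / 100 - β) * ℓ ^ 2 ≤ 1 / 2) :
    Pr n (fun σ => ∃ X W : Finset (Fin n), X.card = W.card + 1 ∧ 2 ≤ W.card ∧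
        (X.card : ℝ) ≤ n / 1000 ∧ ∃ t ≤ T, IsTrap (Gr (hist σ t)) X W ∧
          β * X.card ≤ niceClock D H X.card σ t) ≤
      2 * (n * Real.exp (2 - β) * (Real.exp (304 / 100 - β) * ℓ ^ 2) ^ 2) := by
  set a := Real.exp (304 / 100 - β) * ℓ ^ 2 with ha
  have ha0 : 0 ≤ a := by positivity
  let A : ℕ → EdgeOrdering n → Prop := fun i σ => ((i + 2 : ℕ) : ℝ) + 1 ≤ n / 1000 ∧
    ∃ X ∈ Finset.univ.powersetCard (i + 2 + 1), ∃ W ∈ Finset.univ.powersetCard (i + 2),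
      ∃ t ≤ T, IsTrap (Gr (hist σ t)) X W ∧
        β * (((i + 2 : ℕ) : ℝ) + 1) ≤ niceClock D H (((i + 2 : ℕ) : ℝ) + 1) σ t
  have hA : ∀ i ∈ Finset.range n, Pr n (A i) ≤ n * Real.exp (2 - β) * a ^ 2 * a ^ i := by
    intro i _
    by_cases hi : ((i + 2 : ℕ) : ℝ) + 1 ≤ n / 1000
    · refine (pr_mono fun σ hσ => hσ.2).trans ((pr_trap_card_le hT hD hℓ hTℓ hi H β).trans ?_)
      rw [← ha, pow_add]
      exact le_of_eq (by ring)
    · refine le_trans (pr_mono (B := fun _ => False) fun σ hσ => hi hσ.1) ?_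
      simp only [Pr, Nat.card_of_isEmpty, Nat.cast_zero, zero_div]; positivity
  refine le_trans (pr_mono ?_) ((pr_exists_le (Finset.range n) A).trans
    ((Finset.sum_le_sum hA).trans ?_))
  · rintro σ ⟨X, W, h1, h2, h3, t, ht, h4, h5⟩
    obtain ⟨i, hi⟩ : ∃ i, W.card = i + 2 := ⟨W.card - 2, by omega⟩
    have hWn : W.card ≤ n := by simpa using Finset.card_le_univ W
    have hXc : (X.card : ℝ) = ((i + 2 : ℕ) : ℝ) + 1 := by rw [h1, hi]; push_cast; ring
    rw [hXc] at h3 h5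
    refine ⟨i, Finset.mem_range.2 (by omega), h3, X,
      Finset.mem_powersetCard.2 ⟨Finset.subset_univ _, by omega⟩, W,
      Finset.mem_powersetCard.2 ⟨Finset.subset_univ _, hi⟩, t, ht, h4, h5⟩
  · rw [← Finset.mul_sum]
    have hgeom : ∑ i ∈ Finset.range n, a ^ i ≤ 2 := by
      have h1 := geom_sum_mul_neg a n
      have h2 : 0 ≤ a ^ n := by positivity
      have h3 : 0 ≤ ∑ i ∈ Finset.range n, a ^ i := by positivity
      nlinarith
    have : 0 ≤ n * Real.exp (2 - β) * a ^ 2 := by positivity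
    nlinarith

/-- The pendant vertices. -/
def pendants (G : SimpleGraph (Fin n)) : Finset (Fin n) :=
  Finset.univ.filter fun x => ∃ w, IsPendant G x w

theorem pr_pendants_le {T : ℕ} (hT : T < pairCount n) {D : ℝ} (hD : D ≤ 6 / 1000 * n)
    (hn : 1000 ≤ n) {z : ℝ} (hz : 1 ≤ z) (H : ℕ) (ρ₀ : ℝ) {T₀ : ℕ} (hT₀ : T₀ ≤ T) {p : ℝ}
    (hp : 0 < p) :
    Pr n (fun σ => ρ₀ ≤ niceClock D H 1 σ T₀ ∧ p ≤ (pendants (Gr (hist σ T₀))).card) ≤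
      n ^ 2 * (Real.exp (z * T / (pairCount n - T) - ρ₀) / z) / p := by
  have hposT : (0 : ℝ) < pairCount n - T := by rw [sub_pos]; exact_mod_cast hT
  have hn' : (1000 : ℝ) ≤ n := by exact_mod_cast hn
  let A : Fin n × Fin n → EdgeOrdering n → Prop := fun q σ =>
    IsPendant (Gr (hist σ T₀)) q.1 q.2 ∧ ρ₀ ≤ niceClock D H 1 σ T₀
  have hA : ∀ q, Pr n (A q) ≤ Real.exp (z * T / (pairCount n - T) - ρ₀) / z := by
    rintro ⟨x, w⟩
    have := pr_noEsc_le hT hD (X := {x}) (W := {w}) (by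
      rw [Finset.card_singleton, Finset.card_singleton]; push_cast; linarith) H hz 1 ρ₀
    refine le_trans (pr_mono ?_) (this.trans ?_)
    · rintro σ ⟨h1, h2⟩
      refine ⟨T₀, hT₀, noEsc_of_forall_adj ?_, ?_, ?_⟩
      · intro a ha y hy
        rw [Finset.mem_singleton.1 ha] at hy
        exact Finset.mem_singleton.2 ((h1 y).1 hy)
      · have := card_le_countP (h := hist σ T₀) (P := between {x} {w}) (S := {s(x, w)})
          (fun e he => by
            rw [Finset.mem_singleton.1 he]
            exact ⟨mem_of_gr_adj ((h1 w).2 rfl), Finset.mem_image.2 ⟨(x, w), by simp, rfl⟩⟩)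
        simpa using this
      · simpa [niceClock] using h2
    · rw [Finset.card_singleton, Finset.card_singleton, pow_one]
      push_cast
      rw [mul_one, mul_one]
      gcongr
      linarith
  have hmk := mul_pr_card_le (a := p) A
  have hsum : ∑ q, Pr n (A q) ≤ n ^ 2 * (Real.exp (z * T / (pairCount n - T) - ρ₀) / z) := by
    refine (Finset.sum_le_sum fun q _ => hA q).trans (le_of_eq ?_)
    rw [Finset.sum_const, nsmul_eq_mul, Finset.card_univ, Fintype.card_prod, Fintype.card_fin]
    push_cast; ring
  rw [le_div_iff₀ hp, mul_comm]
  refine (mul_le_mul_of_nonneg_left (pr_mono ?_) hp.le).trans (hmk.trans hsum)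
  rintro σ ⟨h1, h2⟩
  refine h2.trans ?_
  have : pendants (Gr (hist σ T₀)) ⊆ (Finset.univ.filter fun q => A q σ).image Prod.fst := by
    intro x hx
    obtain ⟨w, hw⟩ := (Finset.mem_filter.1 hx).2
    exact Finset.mem_image.2 ⟨(x, w), Finset.mem_filter.2 ⟨Finset.mem_univ _, hw, h1⟩, rfl⟩
  have h3 := (Finset.card_le_card this).trans Finset.card_image_le
  exact (Nat.cast_le.2 h3).trans (le_of_eq (by congr))

/-- The edges between isolated vertices and neighbours of pendant vertices. -/
def cherryEdges (h : List (Sym2 (Fin n))) : Finset (Sym2 (Fin n)) :=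
  (isolated (Gr h) ×ˢ pendants (Gr h)).biUnion fun q =>
    (Finset.univ.filter fun w => IsPendant (Gr h) q.2 w).image fun w => s(q.1, w)

theorem card_cherryEdges_le (h : List (Sym2 (Fin n))) :
    (cherryEdges h).card ≤ isoCount h * (pendants (Gr h)).card := by
  have : ∀ q ∈ isolated (Gr h) ×ˢ pendants (Gr h),
      ((Finset.univ.filter fun w => IsPendant (Gr h) q.2 w).image fun w => s(q.1, w)).card ≤ 1 := by
    intro q _
    refine Finset.card_image_le.trans (Finset.card_le_one.2 fun w hw w' hw' => ?_)
    have h1 := (Finset.mem_filter.1 hw).2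
    have h2 := (Finset.mem_filter.1 hw').2
    exact (h2 w).1 ((h1 w).2 rfl)
  refine (Finset.card_biUnion_le_card_mul _ _ 1 this).trans (le_of_eq ?_)
  rw [mul_one, Finset.card_product]; rfl

/-- A new cherry can only be created by one of the `cherryEdges`. -/
theorem IsCherry.of_cons {h : List (Sym2 (Fin n))} {e : Sym2 (Fin n)} {x x' w : Fin n}
    (hc : IsCherry (Gr (e :: h)) x x' w) (he : e ∉ cherryEdges h) : IsCherry (Gr h) x x' w := by
  have key : ∀ x x', IsCherry (Gr (e :: h)) x x' w → IsPendant (Gr h) x w := by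
    intro x x' hc
    have hsub : ∀ {a b}, (Gr h).Adj a b → (Gr (e :: h)).Adj a b := fun hab => le_addIf _ _ hab
    by_contra hx
    have hxw : ¬ (Gr h).Adj x w := by
      intro hxw
      exact hx fun y => ⟨fun hy => (hc.2.1 y).1 (hsub hy), fun hy => hy ▸ hxw⟩
    have hxe : s(x, w) = e := (adj_of_addIf_adj ((hc.2.1 w).2 rfl)).resolve_left hxw
    have hx'w : (Gr h).Adj x' w := by
      refine (adj_of_addIf_adj ((hc.2.2 w).2 rfl)).resolve_right fun h1 => ?_
      rcases Sym2.eq_iff.1 (hxe.trans h1.symm) with ⟨h2, -⟩ | ⟨h2, h3⟩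
      · exact hc.1 h2
      · exact hc.1 (h2.trans h3)
    have hp : IsPendant (Gr h) x' w :=
      fun y => ⟨fun hy => (hc.2.2 y).1 (hsub hy), fun hy => hy ▸ hx'w⟩
    refine he (Finset.mem_biUnion.2 ⟨(x, x'), Finset.mem_product.2 ⟨?_, ?_⟩,
      Finset.mem_image.2 ⟨w, Finset.mem_filter.2 ⟨Finset.mem_univ _, hp⟩, hxe⟩⟩)
    · rw [mem_isolated]
      intro y hy
      exact hxw ((hc.2.1 y).1 (hsub hy) ▸ hy)
    · exact Finset.mem_filter.2 ⟨Finset.mem_univ _, w, hp⟩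
  exact ⟨hc.1, key x x' hc, key x' x hc.symm⟩

theorem card_pendants_le {h' h : List (Sym2 (Fin n))} (hs : h' <:+ h) :
    (pendants (Gr h)).card ≤ (pendants (Gr h')).card + isoCount h' := by
  refine le_trans (Finset.card_le_card ?_) (Finset.card_union_le _ _)
  intro x hx
  obtain ⟨w, hw⟩ := (Finset.mem_filter.1 hx).2
  by_cases hxw : (Gr h').Adj x w
  · refine Finset.mem_union_left _ (Finset.mem_filter.2 ⟨Finset.mem_univ _, w, fun y => ?_⟩)
    exact ⟨fun hy => (hw y).1 (gr_mono hs hy), fun hy => hy ▸ hxw⟩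
  · refine Finset.mem_union_right _ ?_
    rw [mem_isolated]
    intro y hy
    exact hxw ((hw y).1 (gr_mono hs hy) ▸ hy)

/-- While there are few isolated and few pendant vertices, no cherry is created. -/
theorem pr_cherry_created_le {T : ℕ} (hT : T < pairCount n) {K p : ℝ} (hK : 0 ≤ K) (hp : 0 ≤ p) :
    Pr n (fun σ => ∃ s < T, (isoCount (hist σ s) : ℝ) ≤ K ∧
        ((pendants (Gr (hist σ s))).card : ℝ) ≤ p ∧
        ∃ x x' w, IsCherry (Gr (hist σ (s + 1))) x x' w ∧ ¬ IsCherry (Gr (hist σ s)) x x' w) ≤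
      T * (K * p / (pairCount n - T)) := by
  let B : List (Sym2 (Fin n)) → Finset (Sym2 (Fin n)) := fun h =>
    if (isoCount h : ℝ) ≤ K ∧ ((pendants (Gr h)).card : ℝ) ≤ p then cherryEdges h else ∅
  have hB : ∀ h, ((B h).card : ℝ) ≤ K * p := by
    intro h
    simp only [B]
    split_ifs with hc
    · have h1 : ((cherryEdges h).card : ℝ) ≤ isoCount h * (pendants (Gr h)).card := by
        exact_mod_cast card_cherryEdges_le h
      exact h1.trans (mul_le_mul hc.1 hc.2 (by positivity) hK)
    · simpa using mul_nonneg hK hp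
  refine le_trans (pr_mono ?_) (pr_exists_mem_le hT B hB)
  rintro σ ⟨s, hs, h1, h2, x, x', w, h3, h4⟩
  have hsN : s < pairCount n := hs.trans hT
  refine ⟨s, hs, σ.1 ⟨s, hsN⟩, ?_, hist_succ σ hsN⟩
  rw [hist_succ σ hsN] at h3
  have hBs : B (hist σ s) = cherryEdges (hist σ s) := if_pos ⟨h1, h2⟩
  rw [hBs]
  by_contra hcon
  exact h4 (h3.of_cons hcon)

end Traps

/-! ### Bounding the accumulated decay rate -/

section Typical

variable {n : ℕ}

theorem goodStep_or (hn : Even n) {D : ℝ} {h : List (Sym2 (Fin n))} (hN : Nice D h)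
    (hc : ∀ x x' w, ¬ IsCherry (Gr h) x x' w)
    (htrap : ∀ X W : Finset (Fin n), X.card = W.card + 1 → 2 ≤ W.card →
      (X.card : ℝ) ≤ n / 1000 → ¬ IsTrap (Gr h) X W) :
    GoodStep h ∨ ManyCoPairs (1 / 1000000) h ∨ FewUncovered (2 / 1000) h := by
  by_cases hM : ManyCoPairs (1 / 1000000) h
  · exact Or.inr (Or.inl hM)
  by_cases hF : FewUncovered (2 / 1000) h
  · exact Or.inr (Or.inr hF)
  have h1 := card_isolated_add_le (Gr h)
  have h1' : (isoCount h : ℝ) + 2 * matchNum (Gr h) ≤ n := by exact_mod_cast h1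
  have hk : (isoCount h : ℝ) ≤ 2 / 1000 * n := by linarith [hN.1]
  refine Or.inl ⟨hk, fun heven => ?_⟩
  have hge : n ≤ (isolated (Gr h)).card + 2 * matchNum (Gr h) := by
    by_contra hlt
    have h2 : (isolated (Gr h)).card + 2 * matchNum (Gr h) + 2 ≤ n := by
      obtain ⟨a, ha⟩ := hn
      obtain ⟨b, hb⟩ := heven
      rw [isoCount] at hb
      omega
    refine hM ?_
    have h3 := mul_self_le_card_coPairs (isKonig_gr h) h2 ⌈(n : ℝ) / 1000⌉₊ ?_
    · have h4 : (n : ℝ) / 1000 ≤ ⌈(n : ℝ) / 1000⌉₊ := Nat.le_ceil _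
      have h5 : ((⌈(n : ℝ) / 1000⌉₊ : ℝ)) * ⌈(n : ℝ) / 1000⌉₊ ≤ (coPairs (Gr h)).card := by
        exact_mod_cast h3
      have h6 : (0 : ℝ) ≤ n / 1000 := by positivity
      rw [ManyCoPairs]
      nlinarith [mul_le_mul h4 h4 h6 (h6.trans h4)]
    · intro X W hXW hd hW hne hsub htwo
      by_contra hlt'
      have hXn : (X.card : ℝ) ≤ n / 1000 := (Nat.lt_ceil.1 (not_le.1 hlt')).le
      rcases Nat.lt_or_ge W.card 2 with hW2 | hW2
      · have hW1 : W.card = 1 := by have := hW.card_pos; omega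
        obtain ⟨w, rfl⟩ := Finset.card_eq_one.1 hW1
        obtain ⟨x, x', hxx, rfl⟩ := Finset.card_eq_two.1 (hXW.trans (by rw [hW1]))
        have hp : ∀ y ∈ ({x, x'} : Finset (Fin n)), IsPendant (Gr h) y w := by
          intro y hy v
          refine ⟨fun hv => Finset.mem_singleton.1 (hsub y hy v hv), ?_⟩
          rintro rfl
          obtain ⟨u, hu⟩ := hne y hy
          rwa [Finset.mem_singleton.1 (hsub y hy u hu)] at hu
        exact hc x x' w ⟨hxx, hp x (by simp), hp x' (by simp)⟩
      · exact htrap X W hXW hW2 hXn ⟨hd, hsub, fun w hw => (htwo w hw).trans (by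
          exact le_of_eq (by congr))⟩
  have h2 : ((uncovered (Gr h)).card : ℝ) ≤ rigidCount h + isoCount h := by
    exact_mod_cast card_uncovered_le_card_rigid_add hge
  have h3 := not_lt.1 hF
  linarith

theorem nice_of_card_manyCoPairs_lt {T tA : ℕ} {D : ℝ} (hn : 1000 ≤ n) (σ : EdgeOrdering n)
    (htA : tA ≤ T)
    (hM : (((Finset.range T).filter fun s => ManyCoPairs (1 / 1000000) (hist σ s)).card : ℝ) < tA)
    (hD : ∀ x, ∀ t ≤ T, (offeredDeg (hist σ t) x : ℝ) ≤ D) {t : ℕ} (h1 : tA ≤ t) (h2 : t ≤ T) :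
    Nice D (hist σ t) := by
  refine ⟨?_, fun x => hD x t h2⟩
  obtain ⟨s, hs, hsM⟩ : ∃ s < tA, ¬ ManyCoPairs (1 / 1000000) (hist σ s) := by
    by_contra! hcon
    have hsub : Finset.range tA ⊆
        (Finset.range T).filter fun s => ManyCoPairs (1 / 1000000) (hist σ s) := by
      intro s hs
      have hs := Finset.mem_range.1 hs
      exact Finset.mem_filter.2 ⟨Finset.mem_range.2 (hs.trans_le htA), hcon s hs⟩
    have := Finset.card_le_card hsub
    rw [Finset.card_range] at this
    exact absurd hM (not_lt.2 (by exact_mod_cast this))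
  have hmono := matchNum_mono (gr_mono (hist_suffix σ (hs.le.trans h1)))
  have hmono' : (matchNum (Gr (hist σ s)) : ℝ) ≤ matchNum (Gr (hist σ t)) := by
    exact_mod_cast hmono
  have hco := mul_pred_le_card_coPairs (Gr (hist σ s))
  have hle := two_mul_matchNum_le (Gr (hist σ s))
  set d := n - 2 * matchNum (Gr (hist σ s)) with hd
  have hdn : (n : ℝ) - 2 * matchNum (Gr (hist σ s)) = d := by
    rw [hd, Nat.cast_sub hle]; push_cast; ring
  have hco' : ((d * (d - 1) : ℕ) : ℝ) < 1 / 1000000 * n ^ 2 :=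
    lt_of_le_of_lt (by exact_mod_cast hco) (not_le.1 hsM)
  have hn' : (1000 : ℝ) ≤ n := by exact_mod_cast hn
  have hd1 : (d : ℝ) ≤ 1 / 1000 * n + 1 := by
    by_contra hcon
    push Not at hcon
    have hd0 : 1 ≤ d := by
      have : (0 : ℝ) < d := by linarith
      exact_mod_cast this
    push_cast [Nat.cast_sub hd0] at hco'
    nlinarith
  linarith

theorem le_niceClock {T T₀ tA : ℕ} {D a : ℝ} (ha : 0 ≤ a) {σ : EdgeOrdering n}
    (hT : T < pairCount n) (htA : tA ≤ T₀) (hT₀ : T₀ ≤ T)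
    (hN : ∀ t, tA ≤ t → t ≤ T → Nice D (hist σ t)) {t : ℕ} (ht : T₀ ≤ t) :
    98 / 100 * a / n * ((T₀ : ℝ) - tA) ≤ niceClock D T₀ a σ t := by
  have h1 : ∑ s ∈ Finset.Ico tA T₀, 98 / 100 * a / (n : ℝ) ≤ niceClock D T₀ a σ t := by
    refine le_trans (Finset.sum_le_sum fun s hs => ?_)
      (Finset.sum_le_sum_of_subset_of_nonneg (s := Finset.Ico tA T₀) ?_ ?_)
    · obtain ⟨hs1, hs2⟩ := Finset.mem_Ico.1 hs
      rw [if_pos]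
      refine ⟨?_, hN s hs1 (hs2.le.trans hT₀)⟩
      rwa [length_hist σ (by omega)]
    · intro s hs
      obtain ⟨hs1, hs2⟩ := Finset.mem_Ico.1 hs
      exact Finset.mem_range.2 (by omega)
    · intro s _ _
      split_ifs <;> positivity
  rw [Finset.sum_const, Nat.card_Ico, nsmul_eq_mul, Nat.cast_sub htA] at h1
  linarith

theorem isCherry_of_le {T T₀ : ℕ} {σ : EdgeOrdering n} {x x' w : Fin n}
    (hcr : ∀ s, T₀ ≤ s → s < T → ∀ x x' w, IsCherry (Gr (hist σ (s + 1))) x x' w →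
      IsCherry (Gr (hist σ s)) x x' w) {s t : ℕ} (hs : T₀ ≤ s) (hst : s ≤ t) (ht : t ≤ T)
    (hc : IsCherry (Gr (hist σ t)) x x' w) : IsCherry (Gr (hist σ s)) x x' w := by
  induction t, hst using Nat.le_induction with
  | base => exact hc
  | succ t hst ih => exact ih (by omega) (hcr t (hs.trans hst) (by omega) x x' w hc)

/-- The forced rate at which a surviving cherry is attacked bounds `∑ (1 - rigidCount / n)`. -/
theorem sum_one_sub_rigidCount_le {T T₀ tA u : ℕ} {D ρ₀ : ℝ} (hn : 0 < n) {σ : EdgeOrdering n}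
    (hT : T < pairCount n) (htA : tA ≤ T₀) (hu : T₀ ≤ u) (huT : u < T)
    (hN : ∀ t, tA ≤ t → t ≤ T → Nice D (hist σ t)) {x x' w : Fin n}
    (hc : ∀ s, T₀ ≤ s → s ≤ u → IsCherry (Gr (hist σ s)) x x' w)
    (hρ : ∑ s ∈ Finset.range u, cherryRate D T₀ x x' w (hist σ s) < ρ₀) :
    ∑ s ∈ Finset.Ico T₀ u, 2 * (1 - (rigidCount (hist σ s) : ℝ) / n) ≤
      (n * ρ₀ - 196 / 100 * ((T₀ : ℝ) - tA)) / 2 + 2 / 100 * ((T : ℝ) - T₀) := by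
  have hn' : (0 : ℝ) < n := by exact_mod_cast hn
  have h1 : ∑ s ∈ Finset.Ico tA T₀, 98 / 100 * 2 / (n : ℝ) ≤
      ∑ s ∈ Finset.range T₀, cherryRate D T₀ x x' w (hist σ s) := by
    refine le_trans (Finset.sum_le_sum fun s hs => ?_)
      (Finset.sum_le_sum_of_subset_of_nonneg (s := Finset.Ico tA T₀) ?_ ?_)
    · obtain ⟨hs1, hs2⟩ := Finset.mem_Ico.1 hs
      rw [cherryRate, if_pos (by rwa [length_hist σ (by omega)]), if_pos (hN s hs1 (by omega))]
    · intro s hs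
      obtain ⟨hs1, hs2⟩ := Finset.mem_Ico.1 hs
      exact Finset.mem_range.2 (by omega)
    · intro s hs _
      have hs2 := Finset.mem_range.1 hs
      rw [cherryRate, if_pos (by rwa [length_hist σ (by omega)])]
      split_ifs <;> positivity
  have h2 : ∑ s ∈ Finset.Ico T₀ u, cherryRate D T₀ x x' w (hist σ s) =
      ∑ s ∈ Finset.Ico T₀ u, (2 / n * (2 * (1 - (rigidCount (hist σ s) : ℝ) / n)) -
        4 / 100 / n) := by
    refine Finset.sum_congr rfl fun s hs => ?_
    obtain ⟨hs1, hs2⟩ := Finset.mem_Ico.1 hs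
    rw [cherryRate, if_neg (by rw [length_hist σ (by omega)]; omega),
      if_pos ⟨hN s (by omega) (by omega), hc s hs1 hs2.le⟩, rigidCount]
    ring
  rw [← Finset.sum_range_add_sum_Ico _ hu, h2, Finset.sum_sub_distrib, ← Finset.mul_sum,
    Finset.sum_const, Nat.card_Ico, nsmul_eq_mul, Nat.cast_sub hu] at hρ
  rw [Finset.sum_const, Nat.card_Ico, nsmul_eq_mul, Nat.cast_sub htA] at h1
  set Q := ∑ s ∈ Finset.Ico T₀ u, 2 * (1 - (rigidCount (hist σ s) : ℝ) / n)
  have h3 : ((T₀ : ℝ) - tA) * (98 / 100 * 2 / n) + (2 / n * Q - ((u : ℝ) - T₀) * (4 / 100 / n))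
      < ρ₀ := by linarith
  have h4 := mul_lt_mul_of_pos_left h3 hn'
  have e : n * (((T₀ : ℝ) - tA) * (98 / 100 * 2 / n) +
      (2 / n * Q - ((u : ℝ) - T₀) * (4 / 100 / n))) =
      196 / 100 * ((T₀ : ℝ) - tA) + (2 * Q - 4 / 100 * ((u : ℝ) - T₀)) := by
    field_simp
    ring
  rw [e] at h4
  have h5 : (u : ℝ) ≤ T := by exact_mod_cast huT.le
  linarith

theorem not_isCherry_of_cherryFreeSeen {T T₀ s : ℕ} {σ : EdgeOrdering n} (hT : T < pairCount n)
    (hs : s < T)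
    (hcr : ∀ s, T₀ ≤ s → s < T → ∀ x x' w, IsCherry (Gr (hist σ (s + 1))) x x' w →
      IsCherry (Gr (hist σ s)) x x' w) (hf : CherryFreeSeen T₀ (hist σ s)) (x x' w : Fin n) :
    ¬ IsCherry (Gr (hist σ s)) x x' w := by
  obtain ⟨h', hsuf, hlen, hno⟩ := hf
  have hls := hsuf.length_le
  rw [length_hist σ (by omega)] at hls
  have e : h' = hist σ h'.length := by
    have h1 : (hist σ h'.length).length = h'.length := length_hist σ (by omega)
    exact (List.suffix_of_suffix_length_le hsuf (hist_suffix σ hls) h1.ge).eq_of_length h1.symm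
  intro hc
  have := isCherry_of_le hcr hlen hls hs.le hc
  rw [← e] at this
  exact hno x x' w this

theorem sum_decayRate_le {T T₀ tA : ℕ} {D ρ₀ M : ℝ} (hn : 0 < n) {σ : EdgeOrdering n}
    (hT : T < pairCount n) (htA : tA ≤ T₀) (hT₀ : T₀ ≤ T)
    (hρ₀ : 196 / 100 * ((T₀ : ℝ) - tA) ≤ n * ρ₀)
    (hN : ∀ t, tA ≤ t → t ≤ T → Nice D (hist σ t))
    (hcr : ∀ s, T₀ ≤ s → s < T → ∀ x x' w, IsCherry (Gr (hist σ (s + 1))) x x' w →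
      IsCherry (Gr (hist σ s)) x x' w)
    (hc : ∀ x x' w, ∀ t ≤ T, IsCherry (Gr (hist σ t)) x x' w →
      ∑ s ∈ Finset.range t, cherryRate D T₀ x x' w (hist σ s) < ρ₀)
    {E : Finset ℕ} (hE : (E.card : ℝ) ≤ M)
    (hgood : ∀ s, T₀ ≤ s → s < T → (∀ x x' w, ¬ IsCherry (Gr (hist σ s)) x x' w) →
      s ∉ E → GoodStep (hist σ s)) :
    ∑ s ∈ Finset.range T, decayRate T₀ (hist σ s) ≤
      2005 / 1000 * T₀ + 13714 / 10000 * ((T : ℝ) - T₀) +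
        16 / 100 * (n * ρ₀ - 196 / 100 * ((T₀ : ℝ) - tA)) + 64 / 100 + 164 / 100 * M := by
  have hTT : (T₀ : ℝ) ≤ T := by exact_mod_cast hT₀
  let q : ℕ → ℝ := fun s => 2 * (1 - (rigidCount (hist σ s) : ℝ) / n)
  have hq2 : ∀ s, q s ≤ 2 := fun s => by
    have : (0 : ℝ) ≤ (rigidCount (hist σ s) : ℝ) / n := by positivity
    simp only [q]; linarith
  have hq0 : ∀ s, 0 ≤ q s := fun s => by
    have h1 : (rigidCount (hist σ s) : ℝ) ≤ n := by
      have : rigidCount (hist σ s) ≤ n := by simpa [rigidCount] using Finset.card_le_univ (rigid (Gr (hist σ s)))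
      exact_mod_cast this
    have : (rigidCount (hist σ s) : ℝ) / n ≤ 1 := div_le_one_of_le₀ h1 (by positivity)
    simp only [q]; linarith
  have hfirst : ∑ s ∈ Finset.range T₀, decayRate T₀ (hist σ s) ≤ 2005 / 1000 * T₀ := by
    have : ∀ s ∈ Finset.range T₀, decayRate T₀ (hist σ s) ≤ 2005 / 1000 := by
      intro s hs
      have hs := Finset.mem_range.1 hs
      have hno : ¬ CherryFreeSeen T₀ (hist σ s) := by
        rintro ⟨h', h1, h2, -⟩
        have := h1.length_le
        rw [length_hist σ (by omega)] at this
        omega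
      rw [decayRate, if_neg hno]
      have := hq2 s
      simp only [q] at this
      linarith
    refine (Finset.sum_le_sum this).trans (le_of_eq ?_)
    rw [Finset.sum_const, Finset.card_range, nsmul_eq_mul, mul_comm]
  have hpt : ∀ s ∈ Finset.Ico T₀ T, decayRate T₀ (hist σ s) ≤ 1365 / 1000 +
      (32 / 100 * (if CherryFreeSeen T₀ (hist σ s) then 0 else q s) +
        164 / 100 * (if s ∈ E then 1 else 0)) := by
    intro s hs
    obtain ⟨hs1, hs2⟩ := Finset.mem_Ico.1 hs
    by_cases hf : CherryFreeSeen T₀ (hist σ s)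
    · rw [decayRate, if_pos hf, if_pos hf]
      by_cases hsE : s ∈ E
      · rw [if_pos hsE]
        split_ifs <;> norm_num
      · rw [if_neg hsE, if_pos (hgood s hs1 hs2
          (not_isCherry_of_cherryFreeSeen hT hs2 hcr hf) hsE)]
        norm_num
    · rw [decayRate, if_neg hf, if_neg hf]
      have h1 := hq2 s
      have h2 : (0 : ℝ) ≤ if s ∈ E then 1 else 0 := by split_ifs <;> norm_num
      simp only [q] at h1 ⊢
      linarith
  have hE' : ∑ s ∈ Finset.Ico T₀ T, (if s ∈ E then (1 : ℝ) else 0) ≤ M := by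
    refine le_trans ?_ hE
    rw [Finset.sum_boole]
    exact_mod_cast Finset.card_le_card fun s hs => (Finset.mem_filter.1 hs).2
  have hq : ∑ s ∈ Finset.Ico T₀ T, (if CherryFreeSeen T₀ (hist σ s) then 0 else q s) ≤
      (n * ρ₀ - 196 / 100 * ((T₀ : ℝ) - tA)) / 2 + 2 / 100 * ((T : ℝ) - T₀) + 2 := by
    set S := (Finset.Ico T₀ T).filter fun s => ¬ CherryFreeSeen T₀ (hist σ s) with hS
    have e : ∑ s ∈ Finset.Ico T₀ T, (if CherryFreeSeen T₀ (hist σ s) then 0 else q s) =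
        ∑ s ∈ S, q s := by
      rw [hS, Finset.sum_filter]
      exact Finset.sum_congr rfl fun s _ => (ite_not _ _ _).symm
    rw [e]
    rcases S.eq_empty_or_nonempty with h0 | h0
    · rw [h0, Finset.sum_empty]
      linarith
    · obtain ⟨hu1, hu2⟩ := Finset.mem_filter.1 (S.max'_mem h0)
      set u := S.max' h0 with hu
      obtain ⟨hu3, hu4⟩ := Finset.mem_Ico.1 hu1
      obtain ⟨x, x', w, hxw⟩ : ∃ x x' w, IsCherry (Gr (hist σ u)) x x' w := by
        by_contra! hcon
        exact hu2 ⟨_, List.suffix_rfl, by rwa [length_hist σ (by omega)], hcon⟩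
      have h1 := sum_one_sub_rigidCount_le hn hT htA hu3 hu4 hN
        (fun s hs hsu => isCherry_of_le hcr hs hsu hu4.le hxw) (hc x x' w u hu4.le hxw)
      have h2 : ∑ s ∈ S, q s ≤ ∑ s ∈ Finset.Ico T₀ (u + 1), q s := by
        refine Finset.sum_le_sum_of_subset_of_nonneg (fun s hs => ?_) fun s _ _ => hq0 s
        have := S.le_max' s hs
        have h3 := (Finset.mem_Ico.1 (Finset.mem_filter.1 hs).1).1
        exact Finset.mem_Ico.2 ⟨h3, by omega⟩
      rw [Finset.sum_Ico_succ_top hu3] at h2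
      have := hq2 u
      simp only [q] at h2 this ⊢
      linarith
  have hsecond := Finset.sum_le_sum hpt
  rw [Finset.sum_add_distrib, Finset.sum_const, Nat.card_Ico, nsmul_eq_mul, Nat.cast_sub hT₀,
    Finset.sum_add_distrib, ← Finset.mul_sum, ← Finset.mul_sum] at hsecond
  rw [← Finset.sum_range_add_sum_Ico _ hT₀]
  linarith

end Typical

section Combine

variable {n : ℕ}

/-- Few isolated vertices at time `T` force one of the unlikely events. -/
theorem unlikely_of_isoCount_lt (hn : 10000 ≤ n) (heven : Even n) {T T₀ : ℕ}
    (hT : T < pairCount n) (htA : 8000000 * n ≤ T₀) (hT₀ : T₀ ≤ T) (m : ℕ) {β ρ₀ B K p : ℝ}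
    (hβ : β ≤ 98 / 100 / n * ((T₀ : ℝ) - 8000000 * n))
    (hρ₀ : 196 / 100 * ((T₀ : ℝ) - 8000000 * n) ≤ n * ρ₀)
    (hB : 2005 / 1000 * T₀ + 13714 / 10000 * ((T : ℝ) - T₀) +
        16 / 100 * (n * ρ₀ - 196 / 100 * ((T₀ : ℝ) - 8000000 * n)) + 64 / 100 +
          164 / 100 * (8500000 * n) ≤ B * n)
    (σ : EdgeOrdering n) (hiso : isoCount (hist σ T) < 2000) :
    8 / (1 / 1000000) * (n : ℝ) ≤
        ((Finset.range T).filter fun s => ManyCoPairs (1 / 1000000) (hist σ s)).card ∨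
    2 / (2 / 1000) ^ 2 * (n : ℝ) ≤
        ((Finset.range T).filter fun s => FewUncovered (2 / 1000) (hist σ s)).card ∨
    (∃ x, ∃ t ≤ T, m ≤ offeredDeg (hist σ t) x) ∨
    (∃ X W : Finset (Fin n), X.card = W.card + 1 ∧ 2 ≤ W.card ∧ (X.card : ℝ) ≤ n / 1000 ∧
        ∃ t ≤ T, IsTrap (Gr (hist σ t)) X W ∧ β * X.card ≤ niceClock m T₀ X.card σ t) ∨
    (β ≤ niceClock m T₀ 1 σ T₀ ∧ p ≤ (pendants (Gr (hist σ T₀))).card) ∨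
    (∃ s < T, (isoCount (hist σ s) : ℝ) ≤ K ∧ ((pendants (Gr (hist σ s))).card : ℝ) ≤ p + K ∧
        ∃ x x' w, IsCherry (Gr (hist σ (s + 1))) x x' w ∧ ¬ IsCherry (Gr (hist σ s)) x x' w) ∨
    (∃ x ∈ Finset.univ, ∃ x' ∈ Finset.univ, ∃ w ∈ Finset.univ, ∃ t ≤ T,
        IsCherry (Gr (hist σ t)) x x' w ∧
          ρ₀ ≤ ∑ s ∈ Finset.range t, cherryRate m T₀ x x' w (hist σ s)) ∨
    (isoCount (hist σ T) < 2000 ∧ K ≤ isoCount (hist σ T₀)) ∨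
    (isoCount (hist σ T) < 2000 ∧ ∑ s ∈ Finset.range T, decayRate T₀ (hist σ s) ≤ B * n) := by
  by_contra! hcon
  obtain ⟨h1, h2, h3, h4, h5, h6, h7, h8, h9⟩ := hcon
  refine absurd ?_ (not_le.2 (h9 hiso))
  have hn' : (10000 : ℝ) ≤ n := by exact_mod_cast hn
  have hN : ∀ t, 8000000 * n ≤ t → t ≤ T → Nice m (hist σ t) := by
    intro t ht htT
    refine nice_of_card_manyCoPairs_lt (by omega) σ (htA.trans hT₀) (h1.trans_le (le_of_eq ?_))
      (fun x t ht => ?_) ht htT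
    · push_cast; ring
    · exact_mod_cast (h3 x t ht).le
  have hclock : ∀ a : ℝ, 0 ≤ a → ∀ t, T₀ ≤ t → β * a ≤ niceClock m T₀ a σ t := by
    intro a ha t ht
    refine le_trans ?_ (le_niceClock ha hT htA hT₀ hN ht)
    refine (mul_le_mul_of_nonneg_right hβ ha).trans (le_of_eq ?_)
    push_cast; ring
  have hK : (isoCount (hist σ T₀) : ℝ) < K := h8 hiso
  have hp : ((pendants (Gr (hist σ T₀))).card : ℝ) < p :=
    h5 (by simpa using hclock 1 zero_le_one T₀ le_rfl)
  have hcr : ∀ s, T₀ ≤ s → s < T → ∀ x x' w, IsCherry (Gr (hist σ (s + 1))) x x' w →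
      IsCherry (Gr (hist σ s)) x x' w := by
    intro s hs hsT x x' w hc
    have hsuf := hist_suffix σ hs
    refine h6 s hsT ?_ ?_ x x' w hc
    · exact le_trans (by exact_mod_cast isoCount_anti hsuf) hK.le
    · have : ((pendants (Gr (hist σ s))).card : ℝ) ≤
          (pendants (Gr (hist σ T₀))).card + isoCount (hist σ T₀) := by
        exact_mod_cast card_pendants_le hsuf
      linarith
  set E := ((Finset.range T).filter fun s => ManyCoPairs (1 / 1000000) (hist σ s)) ∪
    ((Finset.range T).filter fun s => FewUncovered (2 / 1000) (hist σ s)) with hEdef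
  have hE : (E.card : ℝ) ≤ 8500000 * n := by
    have h10 : (E.card : ℝ) ≤
        ((Finset.range T).filter fun s => ManyCoPairs (1 / 1000000) (hist σ s)).card +
        ((Finset.range T).filter fun s => FewUncovered (2 / 1000) (hist σ s)).card := by
      exact_mod_cast Finset.card_union_le _ _
    norm_num at h1 h2 h10 ⊢
    linarith
  refine (sum_decayRate_le (by omega) hT htA hT₀ (by push_cast; exact hρ₀) hN hcr
    (fun x x' w t ht hc => h7 x (Finset.mem_univ _) x' (Finset.mem_univ _) w (Finset.mem_univ _)
      t ht hc) hE fun s hs hsT hc hsE => ?_).trans (le_trans (le_of_eq (by push_cast; ring)) hB)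
  rcases goodStep_or heven (hN s (htA.trans hs) hsT.le) hc (fun X W hXW hW hX htr =>
    (h4 X W hXW hW hX s hsT.le htr).not_ge (hclock X.card (by positivity) s hs)) with h | h | h
  · exact h
  · exact absurd (Finset.mem_union_left _ (Finset.mem_filter.2 ⟨Finset.mem_range.2 hsT, h⟩)) hsE
  · exact absurd (Finset.mem_union_right _ (Finset.mem_filter.2 ⟨Finset.mem_range.2 hsT, h⟩)) hsE

theorem cast_pairCount (n : ℕ) : (pairCount n : ℝ) = n * (n - 1) / 2 := by
  rw [← Nat.cast_choose_two, Nat.choose_two_right]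

theorem pr_isoCount_lt_total_le (hn : 10000 ≤ n) (heven : Even n) {T T₀ : ℕ}
    (hT : T < pairCount n) (htA : 8000000 * n ≤ T₀) (hT₀ : T₀ ≤ T) (m : ℕ) {β ρ₀ B K p ℓ : ℝ}
    (hβ : β ≤ 98 / 100 / n * ((T₀ : ℝ) - 8000000 * n))
    (hρ₀ : 196 / 100 * ((T₀ : ℝ) - 8000000 * n) ≤ n * ρ₀)
    (hB : 2005 / 1000 * T₀ + 13714 / 10000 * ((T : ℝ) - T₀) +
        16 / 100 * (n * ρ₀ - 196 / 100 * ((T₀ : ℝ) - 8000000 * n)) + 64 / 100 +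
          164 / 100 * (8500000 * n) ≤ B * n)
    (hTκ : (T : ℝ) ≤ 1 / 1000000 * n ^ 2 / 4)
    (hTε : (T : ℝ) + 2 / 1000 * n / 2 ≤ (2 / 1000) ^ 2 * n ^ 2 / 4)
    (hTN : 999 / 2000 * (n : ℝ) ^ 2 ≤ pairCount n - T) (hm : (m : ℝ) ≤ 6 / 1000 * n)
    (hℓ : 0 < ℓ) (hℓn : ℓ ≤ n) (hTℓ : (T : ℝ) / (pairCount n - T) ≤ 104 / 100 * ℓ / n)
    (hβℓ : Real.exp (304 / 100 - β) * ℓ ^ 2 ≤ 1 / 2) (hp : 0 < p) (hK : 2000 ≤ K) :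
    Pr n (fun σ => isoCount (hist σ T) < 2000) ≤
      Real.exp (-n) + (2 ^ n * Real.exp (-n) + (n * (Real.exp (208 / 100 * ℓ) / Real.exp 1 ^ m) +
      (2 * (n * Real.exp (2 - β) * (Real.exp (304 / 100 - β) * ℓ ^ 2) ^ 2) +
      (n ^ 2 * (Real.exp (104 / 100 - β) / (n / ℓ)) / p +
      (K * (p + K) * (104 / 100 * ℓ / n) +
      (n ^ 3 * (Real.exp (208 / 100 - ρ₀) / (n / ℓ) ^ 2) +
      (2000 / K * Real.exp (2005 / 1000 / n * (T - T₀)) +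
      6001 / (3 * n) * Real.exp B))))))) := by
  have hn' : (0 : ℝ) < n := by
    have : (10000 : ℝ) ≤ n := by exact_mod_cast hn
    linarith
  have hpos : (0 : ℝ) < pairCount n - T := by rw [sub_pos]; exact_mod_cast hT
  have hz : 1 ≤ n / ℓ := by rwa [one_le_div hℓ]
  have hzT : n / ℓ * T / (pairCount n - T) ≤ 104 / 100 := by
    rw [mul_div_assoc]
    refine (mul_le_mul_of_nonneg_left hTℓ (by positivity)).trans (le_of_eq ?_)
    field_simp
  refine (pr_mono (unlikely_of_isoCount_lt hn heven hT htA hT₀ m hβ hρ₀ hB (K := K)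
    (p := p))).trans ?_
  refine (pr_or_le _ _).trans (add_le_add (pr_manyCoPairs_le hT (by norm_num) hTκ) ?_)
  refine (pr_or_le _ _).trans (add_le_add (pr_fewUncovered_le hT (by norm_num) hTε) ?_)
  refine (pr_or_le _ _).trans (add_le_add ((pr_offeredDeg_le hT m).trans ?_) ?_)
  · gcongr
    rw [mul_div_assoc]
    refine (mul_le_mul_of_nonneg_left hTℓ (by positivity)).trans (le_of_eq ?_)
    field_simp
    norm_num
  refine (pr_or_le _ _).trans (add_le_add (pr_trap_le hT hm hℓ hTℓ T₀ hβℓ) ?_)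
  refine (pr_or_le _ _).trans (add_le_add ((pr_pendants_le hT hm (by omega) hz T₀ β hT₀ hp).trans
    ?_) ?_)
  · gcongr
  refine (pr_or_le _ _).trans (add_le_add ((pr_cherry_created_le hT (by linarith)
    (by linarith)).trans ?_) ?_)
  · have e : T * (K * (p + K) / (pairCount n - T)) = K * (p + K) * (T / (pairCount n - T)) := by
      ring
    rw [e]
    have : 0 ≤ K * (p + K) := mul_nonneg (by linarith) (by linarith)
    gcongr
  refine (pr_or_le _ _).trans (add_le_add ?_ ?_)
  · have h1 : ∀ x x' w : Fin n, Pr n (fun σ => ∃ t ≤ T, IsCherry (Gr (hist σ t)) x x' w ∧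
        ρ₀ ≤ ∑ s ∈ Finset.range t, cherryRate m T₀ x x' w (hist σ s)) ≤
        Real.exp (208 / 100 - ρ₀) / (n / ℓ) ^ 2 := by
      intro x x' w
      refine (pr_cherry_le hT hm (by omega) hz ρ₀).trans (div_le_div_of_nonneg_right
        (Real.exp_le_exp.2 (sub_le_sub_right ?_ _)) (by positivity))
      have h2 : (n / ℓ - 1) * 2 * T / (pairCount n - T) =
          2 * (n / ℓ * T / (pairCount n - T)) - 2 * (T / (pairCount n - T)) := by ring
      have h3 : 0 ≤ (T : ℝ) / (pairCount n - T) := by positivity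
      linarith
    refine (pr_exists_le _ _).trans ((Finset.sum_le_sum fun x _ => (pr_exists_le _ _).trans
      (Finset.sum_le_sum fun x' _ => (pr_exists_le _ _).trans
        (Finset.sum_le_sum fun w _ => h1 x x' w))).trans (le_of_eq ?_))
    simp only [Finset.sum_const, Finset.card_univ, Fintype.card_fin, nsmul_eq_mul]
    ring
  refine (pr_or_le _ _).trans (add_le_add (pr_isoCount_lt_of_le hn hTN hT₀ hK)
    (pr_isoCount_lt_le hn hTN T₀ B))

end Combine

/-! ### Asymptotics -/

section Asymptotics

/-- The part of the error bound that depends on `n` only through `ℓ = log n`. -/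
def logError (ℓ : ℝ) : ℝ :=
  Real.exp (-(92 / 100 * ℓ)) + (2 * Real.exp (808 / 100) * (ℓ ^ 4 * Real.exp (-(101 / 1000 * ℓ))) +
    (Real.exp (104 / 100) * (ℓ * Real.exp (-(7 / 1000 * ℓ))) +
    (208 / 100 * (ℓ * Real.exp (-(7 / 100 * ℓ))) +
    (Real.exp (208 / 100) * (ℓ ^ 2 * Real.exp (-(6 / 1000 * ℓ))) +
    (2000 * Real.exp (2005 / 1000) * Real.exp (-(1 / 100 * ℓ)) +
    6001 / 3 * Real.exp (-(1 / 100 * ℓ)))))))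

theorem tendsto_pow_mul_exp_neg (k : ℕ) {c : ℝ} (hc : 0 < c) :
    Filter.Tendsto (fun ℓ : ℝ => ℓ ^ k * Real.exp (-(c * ℓ))) Filter.atTop (nhds 0) := by
  have h := ((Real.tendsto_pow_mul_exp_neg_atTop_nhds_zero k).comp
    (Filter.tendsto_id.const_mul_atTop hc)).const_mul ((c ^ k)⁻¹)
  rw [mul_zero] at h
  refine h.congr fun ℓ => ?_
  simp only [Function.comp, id]
  rw [mul_pow]
  field_simp

theorem tendsto_logError : Filter.Tendsto logError Filter.atTop (nhds 0) := by
  have h0 : ∀ c : ℝ, 0 < c →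
      Filter.Tendsto (fun ℓ : ℝ => Real.exp (-(c * ℓ))) Filter.atTop (nhds 0) := fun c hc => by
    simpa using tendsto_pow_mul_exp_neg 0 hc
  have h1 : ∀ c : ℝ, 0 < c →
      Filter.Tendsto (fun ℓ : ℝ => ℓ * Real.exp (-(c * ℓ))) Filter.atTop (nhds 0) := fun c hc => by
    simpa using tendsto_pow_mul_exp_neg 1 hc
  have h2 := fun k => @tendsto_pow_mul_exp_neg k
  have := (h0 (92 / 100) (by norm_num)).add
    (((h2 4 (c := 101 / 1000) (by norm_num)).const_mul (2 * Real.exp (808 / 100))).add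
    (((h1 (7 / 1000) (by norm_num)).const_mul (Real.exp (104 / 100))).add
    (((h1 (7 / 100) (by norm_num)).const_mul (208 / 100)).add
    (((h2 2 (c := 6 / 1000) (by norm_num)).const_mul (Real.exp (208 / 100))).add
    (((h0 (1 / 100) (by norm_num)).const_mul (2000 * Real.exp (2005 / 1000))).add
    ((h0 (1 / 100) (by norm_num)).const_mul (6001 / 3)))))))
  simp only [mul_zero, add_zero] at this
  exact this

theorem error_le_logError {n m : ℕ} {ℓ d : ℝ} (hexp : Real.exp ℓ = n) (hℓ : 0 < ℓ)
    (hm : 4 * ℓ ≤ m) (hd : d ≤ 2005 / 1000 + 28 / 100 * ℓ) :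
    n * (Real.exp (208 / 100 * ℓ) / Real.exp 1 ^ m) +
      (2 * (n * Real.exp (2 - 367 / 1000 * ℓ) *
        (Real.exp (304 / 100 - 367 / 1000 * ℓ) * ℓ ^ 2) ^ 2) +
      (n ^ 2 * (Real.exp (104 / 100 - 367 / 1000 * ℓ) / (n / ℓ)) / Real.exp (64 / 100 * ℓ) +
      (Real.exp (29 / 100 * ℓ) * (Real.exp (64 / 100 * ℓ) + Real.exp (29 / 100 * ℓ)) *
        (104 / 100 * ℓ / n) +
      (n ^ 3 * (Real.exp (208 / 100 - 1006 / 1000 * ℓ) / (n / ℓ) ^ 2) +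
      (2000 / Real.exp (29 / 100 * ℓ) * Real.exp d +
      6001 / (3 * n) * Real.exp (99 / 100 * ℓ)))))) ≤ logError ℓ := by
  have hexp' : ∀ {a b : ℝ}, a ≤ b → Real.exp a ≤ Real.exp b := fun h => Real.exp_le_exp.2 h
  have hn0 : (0 : ℝ) < n := hexp ▸ Real.exp_pos ℓ
  rw [logError]
  refine add_le_add ?_ (add_le_add ?_ (add_le_add ?_ (add_le_add ?_ (add_le_add ?_
    (add_le_add ?_ ?_)))))
  · rw [← Real.exp_nat_mul, ← Real.exp_sub, ← hexp, ← Real.exp_add, mul_one]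
    exact hexp' (by linarith)
  · rw [mul_pow, ← Real.exp_nat_mul, ← hexp]
    have : Real.exp ℓ * Real.exp (2 - 367 / 1000 * ℓ) *
        Real.exp ((2 : ℕ) * (304 / 100 - 367 / 1000 * ℓ)) =
        Real.exp (808 / 100) * Real.exp (-(101 / 1000 * ℓ)) := by
      rw [← Real.exp_add, ← Real.exp_add, ← Real.exp_add]
      congr 1
      push_cast; ring
    exact le_of_eq (by linear_combination (2 * ℓ ^ 4) * this)
  · have : Real.exp ℓ * Real.exp (104 / 100 - 367 / 1000 * ℓ) / Real.exp (64 / 100 * ℓ) =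
        Real.exp (104 / 100) * Real.exp (-(7 / 1000 * ℓ)) := by
      rw [← Real.exp_add, ← Real.exp_sub, ← Real.exp_add]
      congr 1
      ring
    rw [hexp] at this
    have e : (n : ℝ) ^ 2 * (Real.exp (104 / 100 - 367 / 1000 * ℓ) / (n / ℓ)) /
        Real.exp (64 / 100 * ℓ) =
        ℓ * (n * Real.exp (104 / 100 - 367 / 1000 * ℓ) / Real.exp (64 / 100 * ℓ)) := by
      field_simp
    rw [e, this]
    exact le_of_eq (by ring)
  · have h1 : Real.exp (29 / 100 * ℓ) ≤ Real.exp (64 / 100 * ℓ) := hexp' (by linarith)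
    have h2 : Real.exp (29 / 100 * ℓ) * Real.exp (64 / 100 * ℓ) / Real.exp ℓ =
        Real.exp (-(7 / 100 * ℓ)) := by
      rw [← Real.exp_add, ← Real.exp_sub]
      congr 1
      ring
    rw [hexp] at h2
    calc Real.exp (29 / 100 * ℓ) * (Real.exp (64 / 100 * ℓ) + Real.exp (29 / 100 * ℓ)) *
          (104 / 100 * ℓ / n)
        ≤ Real.exp (29 / 100 * ℓ) * (Real.exp (64 / 100 * ℓ) + Real.exp (64 / 100 * ℓ)) *
          (104 / 100 * ℓ / n) := by gcongr
      _ = 208 / 100 * (ℓ * (Real.exp (29 / 100 * ℓ) * Real.exp (64 / 100 * ℓ) / n)) := by ring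
      _ = _ := by rw [h2]
  · have : Real.exp ℓ * Real.exp (208 / 100 - 1006 / 1000 * ℓ) =
        Real.exp (208 / 100) * Real.exp (-(6 / 1000 * ℓ)) := by
      rw [← Real.exp_add, ← Real.exp_add]
      congr 1
      ring
    rw [hexp] at this
    have e : (n : ℝ) ^ 3 * (Real.exp (208 / 100 - 1006 / 1000 * ℓ) / (n / ℓ) ^ 2) =
        ℓ ^ 2 * (n * Real.exp (208 / 100 - 1006 / 1000 * ℓ)) := by
      field_simp
    rw [e, this]
    exact le_of_eq (by ring)
  · rw [div_mul_eq_mul_div, mul_div_assoc, ← Real.exp_sub, mul_assoc, ← Real.exp_add]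
    refine mul_le_mul_of_nonneg_left (hexp' ?_) (by norm_num)
    linarith
  · have : Real.exp (99 / 100 * ℓ) / Real.exp ℓ = Real.exp (-(1 / 100 * ℓ)) := by
      rw [← Real.exp_sub]
      congr 1
      ring
    rw [hexp] at this
    rw [← this]
    exact le_of_eq (by field_simp)

theorem pr_isoCount_lt_le_logError {n : ℕ} (heven : Even n) {ℓ : ℝ} (hexp : Real.exp ℓ = n)
    (hℓ : 100000000000 ≤ ℓ) (hℓn : 1000000000 * ℓ ≤ n)
    (hsmall : Real.exp (304 / 100 - 367 / 1000 * ℓ) * ℓ ^ 2 ≤ 1 / 2) :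
    Pr n (fun σ => isoCount (hist σ ⌈(1 / 2 + 1 / 70 : ℝ) * n * ℓ⌉₊) < 2000) ≤
      Real.exp (-n) + (2 ^ n * Real.exp (-n) + logError ℓ) := by
  have hℓ0 : 0 < ℓ := by linarith
  have hn5 : (10000 : ℝ) ≤ n := by linarith
  have hn0 : (0 : ℝ) < n := by linarith
  have hn : 10000 ≤ n := by exact_mod_cast hn5
  set T := ⌈(1 / 2 + 1 / 70 : ℝ) * n * ℓ⌉₊ with hTdef
  set T₀ := ⌈(3 / 8 : ℝ) * n * ℓ⌉₊ with hT₀def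
  have hnl : 0 < n * ℓ := by positivity
  have hT1 : 18 / 35 * (n * ℓ) ≤ T := by
    refine le_trans (le_of_eq ?_) (Nat.le_ceil _)
    ring
  have hT2 : (T : ℝ) ≤ 18 / 35 * (n * ℓ) + 1 := by
    refine (Nat.ceil_lt_add_one (by positivity)).le.trans (le_of_eq ?_)
    ring
  have hS1 : 3 / 8 * (n * ℓ) ≤ T₀ := by
    refine le_trans (le_of_eq ?_) (Nat.le_ceil _)
    ring
  have hS2 : (T₀ : ℝ) ≤ 3 / 8 * (n * ℓ) + 1 := by
    refine (Nat.ceil_lt_add_one (by positivity)).le.trans (le_of_eq ?_)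
    ring
  have hbig : 100000000000 * (n : ℝ) ≤ n * ℓ := by nlinarith
  have hnn : 1000000000 * (n * ℓ) ≤ (n : ℝ) ^ 2 := by nlinarith
  have hT₀T : T₀ ≤ T := Nat.ceil_mono (by linarith)
  clear_value T T₀
  have hpc : (pairCount n : ℝ) = n * (n - 1) / 2 := cast_pairCount n
  have hTN : 999 / 2000 * (n : ℝ) ^ 2 ≤ pairCount n - T := by
    rw [hpc]
    linarith
  have hTpos : (0 : ℝ) < pairCount n - T := lt_of_lt_of_le (by positivity) hTN
  have hT : T < pairCount n := by
    have : (T : ℝ) < pairCount n := by linarith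
    exact_mod_cast this
  have htA : 8000000 * n ≤ T₀ := by
    have : 8000000 * (n : ℝ) ≤ T₀ := by linarith
    exact_mod_cast this
  have hm1 : 4 * ℓ ≤ (⌈4 * ℓ⌉₊ : ℝ) := Nat.le_ceil _
  have hm2 : (⌈4 * ℓ⌉₊ : ℝ) ≤ 4 * ℓ + 1 := (Nat.ceil_lt_add_one (by positivity)).le
  have hK : 2000 ≤ Real.exp (29 / 100 * ℓ) := by
    have := Real.add_one_le_exp (29 / 100 * ℓ)
    linarith
  have hTℓ : (T : ℝ) / (pairCount n - T) ≤ 104 / 100 * ℓ / n := by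
    rw [div_le_div_iff₀ hTpos hn0]
    linarith [mul_le_mul_of_nonneg_left hTN hℓ0.le, mul_le_mul_of_nonneg_right hT2 hn0.le,
      mul_le_mul_of_nonneg_right hbig hn0.le, mul_le_mul_of_nonneg_right hn5 hn0.le]
  refine (pr_isoCount_lt_total_le hn heven hT htA hT₀T ⌈4 * ℓ⌉₊ (β := 367 / 1000 * ℓ)
    (ρ₀ := 1006 / 1000 * ℓ) (B := 99 / 100 * ℓ) (K := Real.exp (29 / 100 * ℓ))
    (p := Real.exp (64 / 100 * ℓ)) (ℓ := ℓ) ?_ ?_ ?_ ?_ ?_ hTN ?_ hℓ0 ?_ hTℓ hsmall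
    (Real.exp_pos _) hK).trans ?_
  · rw [div_mul_eq_mul_div (98 / 100) (n : ℝ), le_div_iff₀ hn0]
    linarith
  · linarith
  · linarith
  · linarith
  · linarith
  · linarith
  · linarith
  have hd : 2005 / 1000 / n * ((T : ℝ) - T₀) ≤ 2005 / 1000 + 28 / 100 * ℓ := by
    rw [div_mul_eq_mul_div, div_le_iff₀ hn0]
    linarith
  exact add_le_add_right (add_le_add_right (error_le_logError hexp hℓ0 hm1 hd) _) _

theorem pr_le_one {n : ℕ} (A : EdgeOrdering n → Prop) : Pr n A ≤ 1 := by
  have h := pr_not fun σ => ¬ A σ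
  simp only [not_not] at h
  exact h.le.trans (sub_le_self 1 (pr_nonneg _))

theorem not_perfect_of_isolated {n : ℕ} {G : SimpleGraph (Fin n)} {v : Fin n}
    (hv : ∀ w, ¬ G.Adj v w) :
    ¬ ∃ M : Finset (Sym2 (Fin n)), IsMatchingOn G M ∧ ∀ v : Fin n, ∃ f ∈ M, v ∈ f := by
  rintro ⟨M, hM, hcov⟩
  obtain ⟨f, hf, hvf⟩ := hcov v
  obtain ⟨w, rfl⟩ := Sym2.mem_iff_exists.1 hvf
  exact hv w (hM.1 _ hf)

theorem tendsto_pr_isoCount_lt :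
    Filter.Tendsto (fun k : ℕ => Pr (2 * k) fun σ =>
      isoCount (hist σ ⌈(1 / 2 + 1 / 70 : ℝ) * (2 * k) * Real.log (2 * k)⌉₊) < 2000)
      Filter.atTop (nhds 0) := by
  have h2k : Filter.Tendsto (fun k : ℕ => 2 * k) Filter.atTop Filter.atTop :=
    Filter.tendsto_id.const_mul_atTop' (by norm_num)
  have hcast : Filter.Tendsto (fun k : ℕ => ((2 * k : ℕ) : ℝ)) Filter.atTop Filter.atTop :=
    tendsto_natCast_atTop_atTop.comp h2k
  have hlog := Real.tendsto_log_atTop.comp hcast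
  have hbound : Filter.Tendsto (fun k : ℕ => Real.exp (-((2 * k : ℕ) : ℝ)) +
      (2 ^ (2 * k) * Real.exp (-((2 * k : ℕ) : ℝ)) + logError (Real.log ((2 * k : ℕ) : ℝ))))
      Filter.atTop (nhds 0) := by
    have h1 := Real.tendsto_exp_neg_atTop_nhds_zero.comp hcast
    have h2 : Filter.Tendsto (fun k : ℕ => (2 : ℝ) ^ (2 * k) * Real.exp (-((2 * k : ℕ) : ℝ)))
        Filter.atTop (nhds 0) := by
      have hlt : 2 * Real.exp (-1) < 1 := by
        rw [Real.exp_neg, ← div_eq_mul_inv, div_lt_one (Real.exp_pos 1)]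
        linarith [Real.exp_one_gt_d9]
      refine ((tendsto_pow_atTop_nhds_zero_of_lt_one (by positivity) hlt).comp h2k).congr
        fun k => ?_
      simp only [Function.comp]
      rw [mul_pow, ← Real.exp_nat_mul, mul_neg_one]
    simpa using h1.add (h2.add (tendsto_logError.comp hlog))
  refine tendsto_of_tendsto_of_tendsto_of_le_of_le' tendsto_const_nhds hbound
    (Filter.Eventually.of_forall fun k => pr_nonneg _) ?_
  have hsmall : ∀ᶠ ℓ : ℝ in Filter.atTop,
      Real.exp (304 / 100 - 367 / 1000 * ℓ) * ℓ ^ 2 ≤ 1 / 2 := by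
    have h := (tendsto_pow_mul_exp_neg 2 (c := 367 / 1000) (by norm_num)).const_mul
      (Real.exp (304 / 100))
    rw [mul_zero] at h
    filter_upwards [h.eventually_le_const (u := 1 / 2) (by norm_num)] with ℓ hℓ
    refine le_trans (le_of_eq ?_) hℓ
    rw [sub_eq_add_neg, Real.exp_add]
    ring
  have hlogn : ∀ᶠ x : ℝ in Filter.atTop, 1000000000 * Real.log x ≤ x := by
    have := Real.isLittleO_log_id_atTop.def (c := 1 / 1000000000) (by norm_num)
    filter_upwards [this, Filter.eventually_ge_atTop 1] with x hx hx1
    rw [Real.norm_of_nonneg (Real.log_nonneg hx1), id, Real.norm_of_nonneg (by linarith)] at hx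
    linarith
  filter_upwards [hlog.eventually hsmall, hcast.eventually hlogn,
    hlog.eventually_ge_atTop 100000000000, Filter.eventually_gt_atTop 0] with k h1 h2 h3 h4
  have hk : (0 : ℝ) < ((2 * k : ℕ) : ℝ) := by exact_mod_cast (by omega : 0 < 2 * k)
  have := pr_isoCount_lt_le_logError (n := 2 * k) (even_two_mul k) (Real.exp_log hk) h3 h2 h1
  push_cast at this ⊢
  exact this

end Asymptotics

/-- With `m = ⌈(1/2 + 1/70) n log n⌉`, whp the graph `G_m` of the König process contains an
isolated vertex; in particular it has no perfect matching. -/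
theorem koenig_process_delayed_perfect_matching :
    Filter.Tendsto (fun k : ℕ =>
      Pr (2*k) (fun σ =>
        (∃ v : Fin (2*k), ∀ w : Fin (2*k),
          ¬ (KonigProc σ ⌈(1/2 + 1/70 : ℝ) * (2*k) * Real.log (2*k)⌉₊).Adj v w) ∧
        ¬ ∃ M : Finset (Sym2 (Fin (2*k))),
            IsMatchingOn (KonigProc σ ⌈(1/2 + 1/70 : ℝ) * (2*k) * Real.log (2*k)⌉₊) M ∧
            ∀ v : Fin (2*k), ∃ f ∈ M, v ∈ f))
      Filter.atTop (nhds 1) := by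
  have h := tendsto_pr_isoCount_lt.const_sub 1
  rw [sub_zero] at h
  refine tendsto_of_tendsto_of_tendsto_of_le_of_le h tendsto_const_nhds (fun k => ?_) fun k => ?_
  · simp only
    rw [← pr_not]
    refine pr_mono fun σ hσ => ?_
    rw [konigProc_eq_gr]
    obtain ⟨v, hv⟩ : (isolated (Gr (hist σ
        ⌈(1 / 2 + 1 / 70 : ℝ) * (2 * k) * Real.log (2 * k)⌉₊))).Nonempty := by
      rw [← Finset.card_pos]
      exact lt_of_lt_of_le (by norm_num) (not_lt.1 hσ)
    rw [mem_isolated] at hv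
    exact ⟨⟨v, hv⟩, not_perfect_of_isolated hv⟩
  · exact pr_le_one _
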